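/- Fix α ∈ (1/2, ln 3/ln 2 − 1) and let ζ = 1 − 2(2^α − 1) > 0. There exist constants θ₀ = θ₀(α) > 0, β₀ = β₀(α) > 0 (and a sufficiently large value of J(1), depending on α) such that for every 0 < θ ≤ θ₀, every β ≥ β₀, and every finite set Λ ⊂ ℤ with 0 ∈ Λ, the random field event { h : μ⁺_Λ( { σ : σ₀ = −1 } ) ≥ e^{−b̄/200} } has probability at most e^{−b̄/200}, where b̄ = min(βζ/4, ζ²/(2¹⁰θ²)). In other words, with probability at least 1 − e^{−b̄/200} over the random field, μ⁺_Λ(σ₀ = −1) < e^{−b̄/200}. -/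

import Mathlib

open scoped BigOperators Classical

noncomputable section

/-- The spin value associated to a Boolean: `true ↦ +1`, `false ↦ -1`. -/
def spin (b : Bool) : ℝ := if b then 1 else -1

/-- The pair coupling: `J(1) = J₁` (a large constant) and `J(n) = n^{-(2-α)}` for `n ≥ 2`. -/
def Jcoup (J₁ α : ℝ) (n : ℕ) : ℝ := if n = 1 then J₁ else (n : ℝ) ^ (α - 2)

/-- The Hamiltonian in the finite volume `Λ ⊂ ℤ` with homogeneous boundary condition `τ`,
random field `h` and field strength `θ`:
`H^τ(σ) = (1/2) Σ_{i≠j∈Λ} J(|i-j|)(1-σᵢσⱼ) + Σ_{i∈Λ} Σ_{j∉Λ} J(|i-j|)(1-τσᵢ) - θ Σ_{i∈Λ} hᵢσᵢ`. -/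
def Ham (J₁ α θ τ : ℝ) (Λ : Finset ℤ) (h : ℤ → ℝ) (σ : Λ → Bool) : ℝ :=
  (1 / 2) * ∑ i : Λ, ∑ j : Λ, (if i = j then 0 else
      Jcoup J₁ α ((i : ℤ) - (j : ℤ)).natAbs * (1 - spin (σ i) * spin (σ j)))
  + ∑ i : Λ, (∑' j : ℤ, if j ∈ Λ then 0 else Jcoup J₁ α ((i : ℤ) - j).natAbs)
      * (1 - τ * spin (σ i))
  - θ * ∑ i : Λ, h (i : ℤ) * spin (σ i)

/-- The finite volume Gibbs probability of an event `E` at inverse temperature `β`,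
with boundary condition `τ`. -/
def gibbs (J₁ α θ τ β : ℝ) (Λ : Finset ℤ) (h : ℤ → ℝ) (E : (Λ → Bool) → Prop) : ℝ :=
  (∑ σ : Λ → Bool, if E σ then Real.exp (-β * Ham J₁ α θ τ Λ h σ) else 0) /
    ∑ σ : Λ → Bool, Real.exp (-β * Ham J₁ α θ τ Λ h σ)

/-- Expectation over the i.i.d. symmetric `±1` random field (only its restriction to `Λ`
matters, so it is an average over the `2^|Λ|` field configurations in `Λ`). -/
def fieldE (Λ : Finset ℤ) (f : (ℤ → ℝ) → ℝ) : ℝ :=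
  (1 / 2 ^ Λ.card) *
    ∑ η : Λ → Bool, f (fun i => if hi : i ∈ Λ then spin (η ⟨i, hi⟩) else 1)

namespace RF

def kern (α : ℝ) (n : ℕ) : ENNReal := ENNReal.ofReal ((n : ℝ) ^ (α - 2))
def Sep (B : Finset ℤ) (x y : ℤ) : Prop := ¬ (x ∈ B ↔ y ∈ B)
def fE (J : ℕ → ENNReal) (B : Finset ℤ) (x : ℤ) : ENNReal :=
  ∑' y : ℤ, if Sep B x y then J (x - y).natAbs else 0
def En (J : ℕ → ENNReal) (B : Finset ℤ) : ENNReal := ∑' x : ℤ, fE J B x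
def Wall (B : Finset ℤ) (i : ℤ) : Prop := Sep B i (i + 1)
/-- total mass of the kernel on ℕ -/
def kS (α : ℝ) : ENNReal := ∑' n : ℕ, kern α n

lemma kern_one (α : ℝ) : kern α 1 = 1 := by simp [kern]

lemma kern_anti {α : ℝ} (h : α < 1) {m n : ℕ} (hm : 1 ≤ m) (hmn : m ≤ n) :
    kern α n ≤ kern α m := by
  unfold kern
  apply ENNReal.ofReal_le_ofReal
  apply Real.rpow_le_rpow_of_nonpos
  · exact_mod_cast hm
  · exact_mod_cast hmn
  · linarith

lemma kern_double {α : ℝ} (h0 : 0 < α) (h : α < 1) {m n : ℕ} (hm : 1 ≤ m) (hn : 1 ≤ n)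
    (hmn : m ≤ 2 * n) : kern α n ≤ 4 * kern α m := by
  unfold kern
  rw [show (4 : ENNReal) = ENNReal.ofReal 4 by norm_num, ← ENNReal.ofReal_mul (by norm_num)]
  apply ENNReal.ofReal_le_ofReal
  have h1 : ((2 * n : ℕ) : ℝ) ^ (α - 2) ≤ (m : ℝ) ^ (α - 2) := by
    apply Real.rpow_le_rpow_of_nonpos
    · exact_mod_cast hm
    · exact_mod_cast hmn
    · linarith
  have h2 : ((2 * n : ℕ) : ℝ) ^ (α - 2) = 2 ^ (α - 2) * (n : ℝ) ^ (α - 2) := by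
    push_cast
    rw [Real.mul_rpow (by norm_num) (by positivity)]
  have h3 : (1 / 4 : ℝ) ≤ 2 ^ (α - 2) := by
    have : (2 : ℝ) ^ (-2 : ℝ) ≤ 2 ^ (α - 2) :=
      Real.rpow_le_rpow_of_exponent_le (by norm_num) (by linarith)
    calc (1 / 4 : ℝ) = (2 : ℝ) ^ (-2 : ℝ) := by
          rw [Real.rpow_neg (by norm_num)]; norm_num
      _ ≤ _ := this
  have h4 : 0 ≤ (n : ℝ) ^ (α - 2) := by positivity
  nlinarith

lemma kS_ne_top {α : ℝ} (h : α < 1) : kS α ≠ ⊤ := by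
  unfold kS kern
  have : Summable fun n : ℕ => (n : ℝ) ^ (α - 2) := Real.summable_nat_rpow.2 (by linarith)
  rw [← ENNReal.ofReal_tsum_of_nonneg (fun n => by positivity) this]
  exact ENNReal.ofReal_ne_top

lemma kern_tail_nat {α : ℝ} (h : α < 1) {R : ℕ} (hR : 1 ≤ R) :
    ∑' n : ℕ, (if R ≤ n then kern α n else 0) ≤ ENNReal.ofReal ((R : ℝ) ^ (α - 1)) * kS α := by
  have : NeZero R := ⟨by omega⟩
  have hR' : (0 : ℝ) < R := by exact_mod_cast hR
  rw [← (Nat.divModEquiv R).symm.tsum_eq (fun n => if R ≤ n then kern α n else 0)]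
  rw [ENNReal.tsum_prod']
  have key : ∀ (q : ℕ) (r : Fin R),
      (if R ≤ (Nat.divModEquiv R).symm (q, r) then kern α ((Nat.divModEquiv R).symm (q, r)) else 0)
        ≤ ENNReal.ofReal ((R : ℝ) ^ (α - 2)) * kern α q := by
    intro q r
    simp only [Nat.divModEquiv_symm_apply]
    split_ifs with hc
    · have hq : 1 ≤ q := by
        rcases Nat.eq_zero_or_pos q with h0 | h0
        · subst h0; have := r.2; omega
        · exact h0
      calc kern α (q * R + r) ≤ kern α (q * R) := kern_anti h (Nat.mul_pos hq hR) (by omega)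
        _ = _ := by
          unfold kern
          rw [← ENNReal.ofReal_mul (by positivity)]
          push_cast
          rw [Real.mul_rpow (by positivity) (by positivity), mul_comm]
    · exact zero_le
  calc _ ≤ ∑' q : ℕ, ∑' r : Fin R, ENNReal.ofReal ((R : ℝ) ^ (α - 2)) * kern α q :=
        ENNReal.tsum_le_tsum fun q => ENNReal.tsum_le_tsum fun r => key q r
    _ = ∑' q : ℕ, ENNReal.ofReal ((R : ℝ) ^ (α - 1)) * kern α q := by
        congr 1; ext q
        rw [tsum_fintype, Finset.sum_const, Finset.card_univ, Fintype.card_fin, nsmul_eq_mul,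
          ← mul_assoc]
        congr 1
        rw [← ENNReal.ofReal_natCast, ← ENNReal.ofReal_mul (by positivity)]
        congr 1
        rw [show α - 1 = 1 + (α - 2) by ring, Real.rpow_add hR', Real.rpow_one]
    _ = _ := by rw [ENNReal.tsum_mul_left]; rfl

lemma tsum_natAbs_le (g : ℕ → ENNReal) : ∑' z : ℤ, g z.natAbs ≤ 2 * ∑' n, g n := by
  have h := HasSum.of_nat_of_neg_add_one (f := fun z : ℤ => g z.natAbs)
    (ENNReal.summable.hasSum) (ENNReal.summable.hasSum)
  rw [h.tsum_eq, two_mul]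
  apply add_le_add
  · simp
  · have : ∀ n : ℕ, (-((n : ℤ) + 1)).natAbs = n + 1 := by intro n; omega
    simp only [this]
    exact ENNReal.tsum_comp_le_tsum_of_injective (add_left_injective 1) g

lemma kern_tail {α : ℝ} (h : α < 1) {R : ℕ} (hR : 1 ≤ R) (x : ℤ) :
    ∑' y : ℤ, (if R ≤ (x - y).natAbs then kern α (x - y).natAbs else 0)
      ≤ 2 * (ENNReal.ofReal ((R : ℝ) ^ (α - 1)) * kS α) := by
  have hh := (Equiv.subLeft x).tsum_eq (fun z : ℤ => if R ≤ z.natAbs then kern α z.natAbs else 0)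
  simp only [Equiv.subLeft_apply] at hh
  rw [hh]
  exact (tsum_natAbs_le (fun n => if R ≤ n then kern α n else 0)).trans
    (by gcongr; exact kern_tail_nat h hR)

lemma kern_zero {α : ℝ} (h : α < 1) : kern α 0 = 0 := by
  unfold kern
  rw [Nat.cast_zero, Real.zero_rpow (by linarith)]; simp

lemma kern_total (α : ℝ) (x : ℤ) : ∑' y : ℤ, kern α (x - y).natAbs ≤ 2 * kS α := by
  have hh := (Equiv.subLeft x).tsum_eq (fun z : ℤ => kern α z.natAbs)
  simp only [Equiv.subLeft_apply] at hh
  rw [hh]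
  exact tsum_natAbs_le _

/-! Separation -/
lemma Sep.symm {B : Finset ℤ} {x y : ℤ} (h : Sep B x y) : Sep B y x := by
  unfold Sep at *; tauto
lemma sep_comm {B : Finset ℤ} {x y : ℤ} : Sep B x y ↔ Sep B y x := ⟨Sep.symm, Sep.symm⟩
lemma Sep.ne {B : Finset ℤ} {x y : ℤ} (h : Sep B x y) : x ≠ y := by
  rintro rfl; exact h Iff.rfl
lemma Sep.trans_or {B : Finset ℤ} {x y : ℤ} (h : Sep B x y) (z : ℤ) : Sep B x z ∨ Sep B z y := by
  unfold Sep at *; tauto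

lemma exists_wall_of_sep {B : Finset ℤ} : ∀ (n : ℕ) (x : ℤ), Sep B x (x + n) →
    ∃ i, x ≤ i ∧ i < x + n ∧ Wall B i := by
  intro n
  induction n with
  | zero => intro x h; exact absurd (by simp) h.ne
  | succ n ih =>
    intro x h
    rcases h.trans_or (x + n) with h1 | h1
    · obtain ⟨i, h2, h3, h4⟩ := ih x h1
      exact ⟨i, h2, by push_cast; omega, h4⟩
    · refine ⟨x + n, by omega, by push_cast; omega, ?_⟩
      unfold Wall
      convert h1 using 1
      push_cast; ring

lemma exists_wall {B : Finset ℤ} {x y : ℤ} (h : Sep B x y) (hxy : x < y) :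
    ∃ i, x ≤ i ∧ i < y ∧ Wall B i := by
  obtain ⟨n, hn⟩ := Int.le.dest hxy.le
  subst hn
  exact exists_wall_of_sep n x h

/-- wall between, symmetric version -/
lemma exists_wall_between {B : Finset ℤ} {x y : ℤ} (h : Sep B x y) :
    ∃ i, min x y ≤ i ∧ i < max x y ∧ Wall B i := by
  rcases lt_or_gt_of_ne h.ne with h1 | h1
  · obtain ⟨i, a, b, c⟩ := exists_wall h h1
    exact ⟨i, by omega, by omega, c⟩
  · obtain ⟨i, a, b, c⟩ := exists_wall h.symm h1
    exact ⟨i, by omega, by omega, c⟩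

lemma exists_wall_right {B : Finset ℤ} {x : ℤ} (hx : x ∈ B) :
    ∃ i, x ≤ i ∧ i < x + B.card ∧ Wall B i := by
  have : ∃ y ∈ Finset.Icc x (x + B.card), y ∉ B := by
    by_contra! hc
    have := Finset.card_le_card (show Finset.Icc x (x + B.card) ⊆ B from hc)
    rw [Int.card_Icc] at this
    omega
  obtain ⟨y, hy, hyB⟩ := this
  rw [Finset.mem_Icc] at hy
  have hs : Sep B x y := by unfold Sep; tauto
  have : x ≠ y := hs.ne
  obtain ⟨i, a, b, c⟩ := exists_wall hs (by omega)
  exact ⟨i, a, by omega, c⟩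

lemma exists_wall_left {B : Finset ℤ} {x : ℤ} (hx : x ∈ B) :
    ∃ i, x - B.card ≤ i ∧ i < x ∧ Wall B i := by
  have : ∃ y ∈ Finset.Icc (x - B.card) x, y ∉ B := by
    by_contra! hc
    have := Finset.card_le_card (show Finset.Icc (x - B.card) x ⊆ B from hc)
    rw [Int.card_Icc] at this
    omega
  obtain ⟨y, hy, hyB⟩ := this
  rw [Finset.mem_Icc] at hy
  have hs : Sep B y x := by unfold Sep; tauto
  have : y ≠ x := hs.ne
  obtain ⟨i, a, b, c⟩ := exists_wall hs (by omega)
  exact ⟨i, by omega, b, c⟩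

/-- wall set -/
def walls (B : Finset ℤ) : Finset ℤ := (B ∪ B.image (fun x => x - 1)).filter (Wall B)
lemma mem_walls {B : Finset ℤ} {i : ℤ} : i ∈ walls B ↔ Wall B i := by
  unfold walls
  simp only [Finset.mem_filter, Finset.mem_union, Finset.mem_image, and_iff_right_iff_imp]
  intro h
  unfold Wall Sep at h
  by_cases h1 : i ∈ B
  · exact Or.inl h1
  · right; exact ⟨i + 1, by tauto, by ring⟩

lemma fE_outer (J : ℕ → ENNReal) (B : Finset ℤ) {x : ℤ} (hx : x ∈ B) :
    fE J B x = ∑' y : ℤ, if y ∉ B then J (x - y).natAbs else 0 := by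
  unfold fE Sep; simp [hx]

lemma En_eq_prod (J : ℕ → ENNReal) (B : Finset ℤ) :
    En J B = ∑' p : ℤ × ℤ, if Sep B p.1 p.2 then J (p.1 - p.2).natAbs else 0 := by
  unfold En fE
  rw [← ENNReal.tsum_prod]

/-- `En` as twice the sum from inside. -/
lemma En_eq_two (J : ℕ → ENNReal) (B : Finset ℤ) : En J B = 2 * ∑ x ∈ B, fE J B x := by
  have h1 : ∀ x y : ℤ, (if Sep B x y then J (x - y).natAbs else 0)
      = (if x ∈ B ∧ y ∉ B then J (x - y).natAbs else 0)
        + (if y ∈ B ∧ x ∉ B then J (y - x).natAbs else 0) := by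
    intro x y
    have : (y - x).natAbs = (x - y).natAbs := by omega
    rw [this]
    unfold Sep
    by_cases hx : x ∈ B <;> by_cases hy : y ∈ B <;> simp [hx, hy]
  unfold En
  have h2 : ∑' x : ℤ, ∑' y : ℤ, (if x ∈ B ∧ y ∉ B then J (x - y).natAbs else 0)
      = ∑ x ∈ B, fE J B x := by
    rw [tsum_eq_sum (s := B)]
    · apply Finset.sum_congr rfl
      intro x hx
      rw [fE_outer J B hx]; simp [hx]
    · intro x hx; simp [hx]
  calc ∑' x, fE J B x = ∑' x : ℤ, ((∑' y : ℤ, (if x ∈ B ∧ y ∉ B then J (x - y).natAbs else 0))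
        + ∑' y : ℤ, (if y ∈ B ∧ x ∉ B then J (y - x).natAbs else 0)) := by
        congr 1; ext x; unfold fE; rw [← ENNReal.tsum_add]; congr 1; ext y; exact h1 x y
    _ = _ := by
        rw [ENNReal.tsum_add, h2, two_mul]; congr 1
        rw [ENNReal.tsum_comm, h2]

lemma fE_le (α : ℝ) (B : Finset ℤ) (x : ℤ) : fE (kern α) B x ≤ 2 * kS α := by
  refine le_trans ?_ (kern_total α x)
  unfold fE
  apply ENNReal.tsum_le_tsum
  intro y
  split_ifs <;> simp

lemma En_ne_top {α : ℝ} (h : α < 1) (B : Finset ℤ) : En (kern α) B ≠ ⊤ := by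
  rw [En_eq_two]
  refine ENNReal.mul_ne_top (by simp) ?_
  rw [ENNReal.sum_ne_top]
  intro x _
  exact ne_top_of_le_ne_top (ENNReal.mul_ne_top (by simp) (kS_ne_top h)) (fE_le α B x)

lemma sum_le_fE (J : ℕ → ENNReal) (B : Finset ℤ) (x : ℤ) (T : Finset ℤ)
    (hT : ∀ y ∈ T, Sep B x y) : ∑ y ∈ T, J (x - y).natAbs ≤ fE J B x := by
  unfold fE
  refine le_trans ?_ (ENNReal.sum_le_tsum T)
  apply Finset.sum_le_sum
  intro y hy
  rw [if_pos (hT y hy)]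

/-- isoperimetry -/
lemma isoper {α : ℝ} (h : α < 1) (B : Finset ℤ) (hB : B.Nonempty) :
    ENNReal.ofReal ((B.card : ℝ) ^ α) ≤ En (kern α) B := by
  have hn : 1 ≤ B.card := hB.card_pos
  set n := B.card with hndef
  have hn' : (0 : ℝ) < n := by exact_mod_cast hn
  have h1 : ∀ x ∈ B, ENNReal.ofReal ((n : ℝ) ^ (α - 1)) ≤ fE (kern α) B x := by
    intro x hx
    set T := (Finset.Icc (x - n) (x + n)) \ B with hT
    have hTc : n ≤ T.card := by
      have := Finset.le_card_sdiff B (Finset.Icc (x - n) (x + n))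
      rw [Int.card_Icc, ← hndef, ← hT] at this
      omega
    have h2 : ∑ y ∈ T, kern α (x - y).natAbs ≤ fE (kern α) B x := by
      apply sum_le_fE
      intro y hy
      rw [hT, Finset.mem_sdiff] at hy
      unfold Sep; tauto
    refine le_trans ?_ h2
    calc ENNReal.ofReal ((n : ℝ) ^ (α - 1)) = (n : ENNReal) * kern α n := by
          unfold kern
          rw [← ENNReal.ofReal_natCast, ← ENNReal.ofReal_mul (by positivity)]
          congr 1
          rw [show α - 1 = 1 + (α - 2) by ring, Real.rpow_add hn', Real.rpow_one]
      _ ≤ (T.card : ENNReal) * kern α n := by gcongr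
      _ = ∑ y ∈ T, kern α n := by rw [Finset.sum_const, nsmul_eq_mul]
      _ ≤ _ := by
        apply Finset.sum_le_sum
        intro y hy
        rw [hT, Finset.mem_sdiff, Finset.mem_Icc] at hy
        have : x ≠ y := by rintro rfl; exact hy.2 hx
        exact kern_anti h (by omega) (by omega)
  rw [En_eq_two]
  calc ENNReal.ofReal ((n : ℝ) ^ α) = ∑ x ∈ B, ENNReal.ofReal ((n : ℝ) ^ (α - 1)) := by
        rw [Finset.sum_const, nsmul_eq_mul, ← hndef, ← ENNReal.ofReal_natCast,
          ← ENNReal.ofReal_mul (by positivity)]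
        congr 1
        rw [show α = 1 + (α - 1) by ring, Real.rpow_add hn', Real.rpow_one]; ring_nf
    _ ≤ ∑ x ∈ B, fE (kern α) B x := Finset.sum_le_sum h1
    _ ≤ _ := by rw [two_mul]; exact le_self_add

lemma one_le_En {α : ℝ} (h0 : 0 < α) (h : α < 1) (B : Finset ℤ) (hB : B.Nonempty) :
    1 ≤ En (kern α) B := by
  refine le_trans ?_ (isoper h B hB)
  rw [ENNReal.one_le_ofReal]
  exact Real.one_le_rpow (by exact_mod_cast hB.card_pos) h0.le

/-- integer size -/
def qq (α : ℝ) (B : Finset ℤ) : ℕ := ⌈(En (kern α) B).toReal⌉₊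

lemma En_le_qq {α : ℝ} (h : α < 1) (B : Finset ℤ) : En (kern α) B ≤ qq α B := by
  rw [← ENNReal.ofReal_toReal (En_ne_top h B), ← ENNReal.ofReal_natCast]
  exact ENNReal.ofReal_le_ofReal (Nat.le_ceil _)

lemma one_le_qq {α : ℝ} (h0 : 0 < α) (h : α < 1) {B : Finset ℤ} (hB : B.Nonempty) : 1 ≤ qq α B := by
  have := (one_le_En h0 h B hB).trans (En_le_qq h B)
  exact_mod_cast this

lemma qq_le {α : ℝ} (h0 : 0 < α) (h : α < 1) {B : Finset ℤ} (hB : B.Nonempty) :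
    (qq α B : ℝ) ≤ 2 * (En (kern α) B).toReal := by
  have h1 : 1 ≤ (En (kern α) B).toReal := by
    have := ENNReal.toReal_mono (En_ne_top h B) (one_le_En h0 h B hB)
    simpa using this
  have := Nat.ceil_lt_add_one (a := (En (kern α) B).toReal) (by positivity)
  unfold qq
  linarith

lemma qq_mono {α : ℝ} (h : α < 1) {B B' : Finset ℤ} (hl : En (kern α) B ≤ En (kern α) B') :
    qq α B ≤ qq α B' := by
  unfold qq
  exact Nat.ceil_mono (ENNReal.toReal_mono (En_ne_top h B') hl)

/-- `|B| ≤ q^{1/α}` -/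
lemma card_le_qq {α : ℝ} (h0 : 0 < α) (h : α < 1) {B : Finset ℤ} (hB : B.Nonempty) :
    (B.card : ℝ) ≤ (qq α B : ℝ) ^ (1 / α) := by
  have h1 := (isoper h B hB).trans (En_le_qq h B)
  rw [← ENNReal.ofReal_natCast, ENNReal.ofReal_le_ofReal_iff (by positivity)] at h1
  calc (B.card : ℝ) = ((B.card : ℝ) ^ α) ^ (1 / α) := by
        rw [← Real.rpow_mul (by positivity), mul_one_div_cancel h0.ne', Real.rpow_one]
    _ ≤ _ := Real.rpow_le_rpow (by positivity) h1 (by positivity)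

lemma card_le_qq_sq {α : ℝ} (h0 : 1 / 2 < α) (h : α < 1) {B : Finset ℤ} (hB : B.Nonempty) :
    B.card ≤ qq α B ^ 2 := by
  have h1 := card_le_qq (by linarith) h hB
  have h2 : (1 : ℝ) ≤ qq α B := by exact_mod_cast one_le_qq (by linarith) h hB
  have h3 : (qq α B : ℝ) ^ (1 / α) ≤ (qq α B : ℝ) ^ (2 : ℝ) := by
    apply Real.rpow_le_rpow_of_exponent_le h2
    rw [div_le_iff₀ (by linarith)]; linarith
  have h4 := h1.trans h3
  rw [Real.rpow_two] at h4
  exact_mod_cast h4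

end RF

namespace RF

def Far (α : ℝ) (M : ℕ) (B B' : Finset ℤ) : Prop :=
  ∀ i j, Wall B i → Wall B' j → M * (min (qq α B) (qq α B')) ^ 2 ≤ (i - j).natAbs

def Wb (J : ℕ → ENNReal) (B A : Finset ℤ) : ENNReal :=
  ∑' x : ℤ, ∑' y : ℤ, if Sep B x y ∧ Sep A x y then J (x - y).natAbs else 0

lemma Far.symm {α : ℝ} {M : ℕ} {B B' : Finset ℤ} (h : Far α M B B') : Far α M B' B := by
  intro i j hi hj
  rw [min_comm]
  have := h j i hj hi
  omega

lemma sep_symmDiff {A B : Finset ℤ} {x y : ℤ} :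
    Sep (symmDiff A B) x y ↔ ¬ (Sep A x y ↔ Sep B x y) := by
  unfold Sep
  simp only [Finset.mem_symmDiff]
  tauto

lemma En_identity (J : ℕ → ENNReal) (A B : Finset ℤ) :
    En J (symmDiff A B) + 2 * Wb J B A = En J A + En J B := by
  unfold En fE Wb
  rw [← ENNReal.tsum_mul_left, ← ENNReal.tsum_add, ← ENNReal.tsum_add]
  congr 1; ext x
  rw [← ENNReal.tsum_mul_left, ← ENNReal.tsum_add, ← ENNReal.tsum_add]
  congr 1; ext y
  simp only [sep_symmDiff]
  by_cases h1 : Sep A x y <;> by_cases h2 : Sep B x y <;> simp [h1, h2, two_mul]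

/-- Comparison of `f` near a well separated small set. -/
lemma fE_compare {α : ℝ} (h0 : 0 < α) (h : α < 1) {B : Finset ℤ} {x : ℤ} {ρ : ℕ}
    (hw : ∀ j, Wall B j → 2 * ρ + 1 ≤ (j - x).natAbs) {y : ℤ} (hy : (x - y).natAbs ≤ ρ) :
    fE (kern α) B x ≤ 4 * fE (kern α) B y := by
  unfold fE
  rw [← ENNReal.tsum_mul_left]
  apply ENNReal.tsum_le_tsum
  intro z
  split_ifs with h1 h2 h2
  · have hz : 2 * ρ ≤ (x - z).natAbs := by
      obtain ⟨j, a, b, c⟩ := exists_wall_between h1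
      have := hw j c
      omega
    have n1 := h1.ne
    have n2 := h2.ne
    exact kern_double h0 h (by omega) (by omega) (by omega)
  · exfalso
    have : Sep B x y := by
      rcases h1.trans_or y with h3 | h3
      · exact h3
      · exact absurd h3 h2
    obtain ⟨j, a, b, c⟩ := exists_wall_between this
    have := hw j c
    omega
  · exact zero_le
  · simp

lemma fE_avg {α : ℝ} (h0 : 0 < α) (h : α < 1) {B : Finset ℤ} {x : ℤ} {ρ : ℕ} (hρ : 1 ≤ ρ)
    (hw : ∀ j, Wall B j → 2 * ρ + 1 ≤ (j - x).natAbs) :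
    fE (kern α) B x ≤ ∑' y : ℤ, (if (x - y).natAbs ≤ ρ then (2 / (ρ : ENNReal)) else 0)
      * fE (kern α) B y := by
  have hρ0 : (ρ : ENNReal) ≠ 0 := by exact_mod_cast (by omega : ρ ≠ 0)
  have h1 : ∑ y ∈ Finset.Icc (x - ρ) (x + ρ), (2 / (ρ : ENNReal)) * fE (kern α) B y
      ≤ ∑' y : ℤ, (if (x - y).natAbs ≤ ρ then (2 / (ρ : ENNReal)) else 0)
      * fE (kern α) B y := by
    refine le_trans ?_ (ENNReal.sum_le_tsum (Finset.Icc (x - ρ) (x + ρ)))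
    apply Finset.sum_le_sum
    intro y hy
    rw [Finset.mem_Icc] at hy
    rw [if_pos (by omega)]
  refine le_trans ?_ h1
  have h2 : ∀ y ∈ Finset.Icc (x - ρ) (x + ρ),
      (2 / (ρ : ENNReal)) * (fE (kern α) B x / 4) ≤ (2 / (ρ : ENNReal)) * fE (kern α) B y := by
    intro y hy
    rw [Finset.mem_Icc] at hy
    gcongr
    apply ENNReal.div_le_of_le_mul'
    exact fE_compare h0 h hw (by omega)
  refine le_trans ?_ (Finset.sum_le_sum h2)
  rw [Finset.sum_const, nsmul_eq_mul, Int.card_Icc]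
  have h3 : ((2 * ρ : ℕ) : ENNReal) ≤ ((x + ρ + 1 - (x - ρ)).toNat : ENNReal) := by
    exact_mod_cast (by omega : 2 * ρ ≤ (x + ρ + 1 - (x - ρ)).toNat)
  calc fE (kern α) B x = ((2 * ρ : ℕ) : ENNReal) * (2 / (ρ : ENNReal) * (fE (kern α) B x / 4)) := by
        push_cast
        rw [div_eq_mul_inv, div_eq_mul_inv]
        have e1 : (ρ : ENNReal) * (ρ : ENNReal)⁻¹ = 1 := ENNReal.mul_inv_cancel hρ0 (by simp)
        have e2 : (4 : ENNReal) * (4 : ENNReal)⁻¹ = 1 := ENNReal.mul_inv_cancel (by simp) (by simp)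
        calc fE (kern α) B x = ((ρ : ENNReal) * (ρ : ENNReal)⁻¹) * ((4 : ENNReal) * (4 : ENNReal)⁻¹)
            * fE (kern α) B x := by rw [e1, e2]; simp
          _ = _ := by ring
    _ ≤ _ := by gcongr

/-- geometric constant -/
def cG (α : ℝ) : ENNReal := ∑' k : ℕ, ENNReal.ofReal (((2 : ℝ) ^ k) ^ (1 / α - 2))

lemma cG_ne_top {α : ℝ} (h0 : 1 / 2 < α) : cG α ≠ ⊤ := by
  unfold cG
  have he : (1 / α - 2) < 0 := by
    rw [sub_neg, div_lt_iff₀ (by linarith)]; linarith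
  have e : ∀ k : ℕ, (((2 : ℝ) ^ k) ^ (1 / α - 2)) = ((2 : ℝ) ^ (1 / α - 2)) ^ k := by
    intro k
    rw [← Real.rpow_natCast, ← Real.rpow_mul (by norm_num), mul_comm, Real.rpow_mul (by norm_num),
      Real.rpow_natCast]
  simp only [e]
  have hs : Summable fun k : ℕ => ((2 : ℝ) ^ (1 / α - 2)) ^ k :=
    summable_geometric_of_lt_one (by positivity)
      (Real.rpow_lt_one_of_one_lt_of_neg (by norm_num) he)
  rw [← ENNReal.ofReal_tsum_of_nonneg (fun n => by positivity) hs]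
  exact ENNReal.ofReal_ne_top

lemma far_point {α : ℝ} (h0 : 1 / 2 < α) (h : α < 1) {L : ℕ} {B B' : Finset ℤ}
    (hne : B'.Nonempty) (hq : qq α B' ≤ qq α B) (hf : Far α (16 * L) B B') {x : ℤ} (hx : x ∈ B')
    (hL : 1 ≤ L) : ∀ j, Wall B j → 2 * (L * qq α B' ^ 2) + 1 ≤ (j - x).natAbs := by
  intro j hj
  obtain ⟨r, a, b, c⟩ := exists_wall_right hx
  have h1 := hf j r hj c
  rw [min_eq_right hq] at h1
  have h2 := card_le_qq_sq h0 h hne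
  have h3 : 1 ≤ qq α B' ^ 2 := Nat.one_le_pow _ _ (one_le_qq (by linarith) h hne)
  have h4 : qq α B' ^ 2 ≤ L * qq α B' ^ 2 := Nat.le_mul_of_pos_left _ hL
  have h5 : 16 * L * qq α B' ^ 2 = 16 * (L * qq α B' ^ 2) := by ring
  rw [h5] at h1
  omega

lemma small_coeff {α : ℝ} (h0 : 1 / 2 < α) (h : α < 1) {L : ℕ} (hL : 1 ≤ L)
    (F : Finset (Finset ℤ)) (hne : ∀ B' ∈ F, B'.Nonempty)
    (hpw : ∀ B' ∈ F, ∀ B'' ∈ F, B' ≠ B'' → Far α (16 * L) B' B'') (y : ℤ) :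
    ∑ B' ∈ F, ∑ x ∈ B', (if (x - y).natAbs ≤ L * qq α B' ^ 2 then
      (2 / ((L * qq α B' ^ 2 : ℕ) : ENNReal)) else 0) ≤ (2 / (L : ENNReal)) * cG α := by
  set F' := F.filter (fun B' => ∃ x ∈ B', (x - y).natAbs ≤ L * qq α B' ^ 2) with hF'
  have hL0 : (L : ENNReal) ≠ 0 := by exact_mod_cast (by omega : L ≠ 0)
  have hterm : ∀ B' ∈ F, ∑ x ∈ B', (if (x - y).natAbs ≤ L * qq α B' ^ 2 then
      (2 / ((L * qq α B' ^ 2 : ℕ) : ENNReal)) else 0) ≤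
      if (∃ x ∈ B', (x - y).natAbs ≤ L * qq α B' ^ 2) then
        (2 / (L : ENNReal)) * ENNReal.ofReal (((2 : ℝ) ^ (Nat.log 2 (qq α B'))) ^ (1 / α - 2))
      else 0 := by
    intro B' hB'
    have hq1 := one_le_qq (by linarith) h (hne B' hB')
    split_ifs with hc
    · calc _ ≤ ∑ x ∈ B', (2 / ((L * qq α B' ^ 2 : ℕ) : ENNReal)) := by
            apply Finset.sum_le_sum; intro x _; split_ifs <;> simp
        _ = (2 / (L : ENNReal)) * (B'.card / ((qq α B' ^ 2 : ℕ) : ENNReal)) := by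
            rw [Finset.sum_const, nsmul_eq_mul]
            push_cast
            simp only [div_eq_mul_inv]
            rw [ENNReal.mul_inv (Or.inl hL0) (Or.inl (by simp))]
            ring
        _ ≤ _ := by
            gcongr
            have hqpos : (0 : ℝ) < qq α B' := by exact_mod_cast hq1
            have e1 : (B'.card : ENNReal) / ((qq α B' ^ 2 : ℕ) : ENNReal)
                = ENNReal.ofReal ((B'.card : ℝ) / (qq α B' : ℝ) ^ 2) := by
              rw [ENNReal.ofReal_div_of_pos (by positivity), ENNReal.ofReal_natCast,
                ENNReal.ofReal_pow (by positivity), ENNReal.ofReal_natCast]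
              push_cast; rfl
            rw [e1]
            apply ENNReal.ofReal_le_ofReal
            have c1 := card_le_qq (by linarith) h (hne B' hB')
            calc (B'.card : ℝ) / (qq α B' : ℝ) ^ 2 ≤ (qq α B' : ℝ) ^ (1 / α) / (qq α B' : ℝ) ^ 2 := by
                  gcongr
              _ = (qq α B' : ℝ) ^ (1 / α - 2) := by
                  rw [Real.rpow_sub hqpos, Real.rpow_two]
              _ ≤ _ := by
                  apply Real.rpow_le_rpow_of_nonpos (by positivity)
                  · exact_mod_cast Nat.pow_log_le_self 2 (by omega)
                  · rw [sub_nonpos, div_le_iff₀ (by linarith)]; linarith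
    · push Not at hc
      rw [Finset.sum_eq_zero]
      intro x hx
      rw [if_neg (by have := hc x hx; omega)]
  refine (Finset.sum_le_sum hterm).trans ?_
  rw [← Finset.sum_filter, ← hF', ← Finset.mul_sum]
  gcongr
  unfold cG
  have hinj : Set.InjOn (fun B' : Finset ℤ => Nat.log 2 (qq α B')) (F' : Set (Finset ℤ)) := by
    intro B1 h1 B2 h2 heq
    by_contra hne12
    simp only [hF', Finset.coe_filter, Set.mem_ofPred_eq] at h1 h2
    obtain ⟨m1, x1, hx1, d1⟩ := h1
    obtain ⟨m2, x2, hx2, d2⟩ := h2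
    obtain ⟨r1, a1, b1, c1⟩ := exists_wall_right hx1
    obtain ⟨r2, a2, b2, c2⟩ := exists_wall_right hx2
    have s1 := card_le_qq_sq h0 h (hne B1 m1)
    have s2 := card_le_qq_sq h0 h (hne B2 m2)
    have hf := hpw B1 m1 B2 m2 hne12 r1 r2 c1 c2
    have q1 := one_le_qq (by linarith) h (hne B1 m1)
    have q2 := one_le_qq (by linarith) h (hne B2 m2)
    simp only at heq
    set k := Nat.log 2 (qq α B1) with hk
    have u1 : qq α B1 < 2 ^ (k + 1) := Nat.lt_pow_succ_log_self (by norm_num) _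
    have u2 : qq α B2 < 2 ^ (k + 1) := by
      rw [heq]; exact Nat.lt_pow_succ_log_self (by norm_num) _
    have l1 : 2 ^ k ≤ qq α B1 := Nat.pow_log_le_self 2 (by omega)
    have l2 : 2 ^ k ≤ qq α B2 := by rw [heq]; exact Nat.pow_log_le_self 2 (by omega)
    have lm : 2 ^ k ≤ min (qq α B1) (qq α B2) := le_min l1 l2
    have lm2 : (2 ^ k) ^ 2 ≤ (min (qq α B1) (qq α B2)) ^ 2 := Nat.pow_le_pow_left lm 2
    have v1 : qq α B1 ^ 2 < 4 * (2 ^ k) ^ 2 := by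
      calc qq α B1 ^ 2 < (2 ^ (k + 1)) ^ 2 := Nat.pow_lt_pow_left u1 (by norm_num)
        _ = _ := by ring
    have v2 : qq α B2 ^ 2 < 4 * (2 ^ k) ^ 2 := by
      calc qq α B2 ^ 2 < (2 ^ (k + 1)) ^ 2 := Nat.pow_lt_pow_left u2 (by norm_num)
        _ = _ := by ring
    set X := (2 ^ k) ^ 2 with hX
    have w1 : L * qq α B1 ^ 2 ≤ L * (4 * X) := Nat.mul_le_mul_left _ v1.le
    have w2 : L * qq α B2 ^ 2 ≤ L * (4 * X) := Nat.mul_le_mul_left _ v2.le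
    have w3 : 16 * L * X ≤ 16 * L * (min (qq α B1) (qq α B2)) ^ 2 := Nat.mul_le_mul_left _ lm2
    have w4 : X ≤ L * X := Nat.le_mul_of_pos_left _ hL
    have w5 : L * (4 * X) = 4 * (L * X) := by ring
    have w6 : 16 * L * X = 16 * (L * X) := by ring
    omega
  calc ∑ B' ∈ F', ENNReal.ofReal (((2 : ℝ) ^ (Nat.log 2 (qq α B'))) ^ (1 / α - 2))
      = ∑ k ∈ F'.image (fun B' : Finset ℤ => Nat.log 2 (qq α B')),
        ENNReal.ofReal (((2 : ℝ) ^ k) ^ (1 / α - 2)) := by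
        rw [Finset.sum_image hinj]
    _ ≤ _ := ENNReal.sum_le_tsum _

lemma small_sum {α : ℝ} (h0 : 1 / 2 < α) (h : α < 1) {L : ℕ} (hL : 1 ≤ L) (B : Finset ℤ)
    (F : Finset (Finset ℤ)) (hne : ∀ B' ∈ F, B'.Nonempty)
    (hq : ∀ B' ∈ F, qq α B' ≤ qq α B) (hf : ∀ B' ∈ F, Far α (16 * L) B B')
    (hpw : ∀ B' ∈ F, ∀ B'' ∈ F, B' ≠ B'' → Far α (16 * L) B' B'') :
    ∑ B' ∈ F, ∑ x ∈ B', fE (kern α) B x ≤ (2 / (L : ENNReal)) * cG α * En (kern α) B := by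
  calc ∑ B' ∈ F, ∑ x ∈ B', fE (kern α) B x
      ≤ ∑ B' ∈ F, ∑ x ∈ B', ∑' y : ℤ, (if (x - y).natAbs ≤ L * qq α B' ^ 2 then
      (2 / ((L * qq α B' ^ 2 : ℕ) : ENNReal)) else 0) * fE (kern α) B y := by
        apply Finset.sum_le_sum; intro B' hB'
        apply Finset.sum_le_sum; intro x hx
        have h3 : 1 ≤ qq α B' ^ 2 := Nat.one_le_pow _ _ (one_le_qq (by linarith) h (hne B' hB'))
        exact fE_avg (by linarith) h (Nat.mul_pos hL h3)
          (far_point h0 h (hne B' hB') (hq B' hB') (hf B' hB') hx hL)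
    _ = ∑' y : ℤ, (∑ B' ∈ F, ∑ x ∈ B', (if (x - y).natAbs ≤ L * qq α B' ^ 2 then
      (2 / ((L * qq α B' ^ 2 : ℕ) : ENNReal)) else 0)) * fE (kern α) B y := by
        simp only [Finset.sum_mul]
        rw [Summable.tsum_finsetSum (fun _ _ => ENNReal.summable)]
        apply Finset.sum_congr rfl; intro B' _
        rw [Summable.tsum_finsetSum (fun _ _ => ENNReal.summable)]
    _ ≤ ∑' y : ℤ, ((2 / (L : ENNReal)) * cG α) * fE (kern α) B y := by
        apply ENNReal.tsum_le_tsum; intro y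
        gcongr
        exact small_coeff h0 h hL F hne hpw y
    _ = _ := by rw [ENNReal.tsum_mul_left]; rfl

lemma big_sum {α : ℝ} (h0 : 1 / 2 < α) (h : α < 1) {M : ℕ} (hM : 1 ≤ M) (B : Finset ℤ)
    (hB : B.Nonempty) :
    ∑ x ∈ B, ∑' y : ℤ, (if M * qq α B ^ 2 ≤ (x - y).natAbs then kern α (x - y).natAbs else 0)
      ≤ 2 * kS α * ENNReal.ofReal ((M : ℝ) ^ (α - 1)) * En (kern α) B := by
  have hq1 := one_le_qq (by linarith) h hB
  have hc := card_le_qq_sq h0 h hB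
  have hqp : (0 : ℝ) < qq α B := by exact_mod_cast hq1
  have hcp : (0 : ℝ) < B.card := by exact_mod_cast hB.card_pos
  have hMp : (0 : ℝ) < M := by exact_mod_cast hM
  calc _ ≤ ∑ x ∈ B, 2 * (ENNReal.ofReal (((M * qq α B ^ 2 : ℕ) : ℝ) ^ (α - 1)) * kS α) := by
        apply Finset.sum_le_sum; intro x _
        exact kern_tail h (Nat.mul_pos hM (Nat.pow_pos hq1)) x
    _ = 2 * kS α * ((B.card : ENNReal) * ENNReal.ofReal (((M * qq α B ^ 2 : ℕ) : ℝ) ^ (α - 1))) := by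
        rw [Finset.sum_const, nsmul_eq_mul]; ring
    _ ≤ 2 * kS α * (ENNReal.ofReal ((M : ℝ) ^ (α - 1)) * En (kern α) B) := by
        refine mul_le_mul_right ?_ _
        refine le_trans ?_ (mul_le_mul_right (isoper h B hB) _)
        rw [← ENNReal.ofReal_natCast, ← ENNReal.ofReal_mul (by positivity),
          ← ENNReal.ofReal_mul (by positivity)]
        apply ENNReal.ofReal_le_ofReal
        push_cast
        rw [Real.mul_rpow (by positivity) (by positivity)]
        have : ((qq α B : ℝ) ^ 2) ^ (α - 1) ≤ (B.card : ℝ) ^ (α - 1) := by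
          apply Real.rpow_le_rpow_of_nonpos hcp
          · exact_mod_cast hc
          · linarith
        calc (B.card : ℝ) * ((M : ℝ) ^ (α - 1) * ((qq α B : ℝ) ^ 2) ^ (α - 1))
            ≤ (B.card : ℝ) * ((M : ℝ) ^ (α - 1) * (B.card : ℝ) ^ (α - 1)) := by gcongr
          _ = (M : ℝ) ^ (α - 1) * ((B.card : ℝ) ^ (1 : ℝ) * (B.card : ℝ) ^ (α - 1)) := by
              rw [Real.rpow_one]; ring
          _ = _ := by rw [← Real.rpow_add hcp]; ring_nf
    _ = _ := by ring

lemma Wb_le {α : ℝ} (h0 : 1 / 2 < α) (h : α < 1) {L : ℕ} (hL : 1 ≤ L) (B A : Finset ℤ)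
    (hB : B.Nonempty)
    (F : Finset (Finset ℤ)) (hne : ∀ B' ∈ F, B'.Nonempty)
    (hf : ∀ B' ∈ F, Far α (16 * L) B B')
    (hpw : ∀ B' ∈ F, ∀ B'' ∈ F, B' ≠ B'' → Far α (16 * L) B' B'')
    (hA : ∀ x y, Sep A x y → ∃ B' ∈ F, Sep B' x y) :
    Wb (kern α) B A ≤ 2 * ((2 / (L : ENNReal)) * cG α * En (kern α) B) +
      2 * (2 * kS α * ENNReal.ofReal (((16 * L : ℕ) : ℝ) ^ (α - 1)) * En (kern α) B) := by
  set F1 := F.filter (fun B' => qq α B' ≤ qq α B) with hF1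
  have hpt : ∀ x y : ℤ, (if Sep B x y ∧ Sep A x y then kern α (x - y).natAbs else 0) ≤
      ((∑ B' ∈ F1, if x ∈ B' then (if Sep B x y then kern α (x - y).natAbs else 0) else 0)
      + (∑ B' ∈ F1, if y ∈ B' then (if Sep B y x then kern α (y - x).natAbs else 0) else 0))
      + ((if x ∈ B then
          (if 16 * L * qq α B ^ 2 ≤ (x - y).natAbs then kern α (x - y).natAbs else 0) else 0)
      + (if y ∈ B then
          (if 16 * L * qq α B ^ 2 ≤ (y - x).natAbs then kern α (y - x).natAbs else 0) else 0)) := by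
    intro x y
    have hxy : (y - x).natAbs = (x - y).natAbs := by omega
    rw [hxy]
    by_cases hs : Sep B x y ∧ Sep A x y
    swap
    · rw [if_neg hs]; exact zero_le
    rw [if_pos hs]
    obtain ⟨hs1, hs2⟩ := hs
    obtain ⟨B', hB', hs3⟩ := hA x y hs2
    by_cases hq : qq α B' ≤ qq α B
    · have hm : B' ∈ F1 := by rw [hF1, Finset.mem_filter]; exact ⟨hB', hq⟩
      have : x ∈ B' ∨ y ∈ B' := by unfold Sep at hs3; tauto
      rcases this with hx | hx
      · calc kern α (x - y).natAbs = (if x ∈ B' then (if Sep B x y then kern α (x - y).natAbs else 0) else 0) := by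
              rw [if_pos hx, if_pos hs1]
          _ ≤ ∑ B' ∈ F1, if x ∈ B' then (if Sep B x y then kern α (x - y).natAbs else 0) else 0 :=
              Finset.single_le_sum (f := fun B' => if x ∈ B' then (if Sep B x y then kern α (x - y).natAbs else 0) else 0) (fun _ _ => zero_le) hm
          _ ≤ _ := by rw [add_assoc]; exact le_self_add
      · calc kern α (x - y).natAbs = (if y ∈ B' then (if Sep B y x then kern α (x - y).natAbs else 0) else 0) := by
              rw [if_pos hx, if_pos hs1.symm]
          _ ≤ ∑ B' ∈ F1, if y ∈ B' then (if Sep B y x then kern α (x - y).natAbs else 0) else 0 :=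
              Finset.single_le_sum (f := fun B' => if y ∈ B' then (if Sep B y x then kern α (x - y).natAbs else 0) else 0) (fun _ _ => zero_le) hm
          _ ≤ _ := by
              refine le_trans ?_ le_self_add
              exact le_add_self
    · have hd : 16 * L * qq α B ^ 2 ≤ (x - y).natAbs := by
        obtain ⟨i, a1, b1, c1⟩ := exists_wall_between hs1
        obtain ⟨j, a2, b2, c2⟩ := exists_wall_between hs3
        have := hf B' hB' i j c1 c2
        rw [min_eq_left (by omega)] at this
        omega
      refine le_trans ?_ le_add_self
      have : x ∈ B ∨ y ∈ B := by unfold Sep at hs1; tauto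
      rcases this with hx | hx
      · rw [if_pos hx, if_pos hd]; exact le_self_add
      · rw [if_pos hx, if_pos hd]; exact le_add_self
  have e1 : ∑' x : ℤ, ∑' y : ℤ,
      (∑ B' ∈ F1, if x ∈ B' then (if Sep B x y then kern α (x - y).natAbs else 0) else 0)
      = ∑ B' ∈ F1, ∑ x ∈ B', fE (kern α) B x := by
    calc _ = ∑' x : ℤ, ∑ B' ∈ F1, if x ∈ B' then fE (kern α) B x else 0 := by
          congr 1; ext x
          rw [Summable.tsum_finsetSum (fun _ _ => ENNReal.summable)]
          apply Finset.sum_congr rfl; intro B' _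
          by_cases hx : x ∈ B' <;> simp [hx, fE]
      _ = _ := by
          rw [Summable.tsum_finsetSum (fun _ _ => ENNReal.summable)]
          apply Finset.sum_congr rfl; intro B' _
          rw [tsum_eq_sum (s := B') (fun x hx => if_neg hx)]
          apply Finset.sum_congr rfl; intro x hx; rw [if_pos hx]
  have e2 : ∑' x : ℤ, ∑' y : ℤ, (if x ∈ B then
          (if 16 * L * qq α B ^ 2 ≤ (x - y).natAbs then kern α (x - y).natAbs else 0) else 0)
      = ∑ x ∈ B, ∑' y : ℤ, (if 16 * L * qq α B ^ 2 ≤ (x - y).natAbs then kern α (x - y).natAbs else 0) := by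
    rw [tsum_eq_sum (s := B) (fun x hx => by simp [hx])]
    apply Finset.sum_congr rfl; intro x hx; simp [hx]
  have hsm := small_sum h0 h hL B F1 (fun B' hB' => hne B' (Finset.mem_filter.1 hB').1)
    (fun B' hB' => (Finset.mem_filter.1 hB').2) (fun B' hB' => hf B' (Finset.mem_filter.1 hB').1)
    (fun B' hB' B'' hB'' => hpw B' (Finset.mem_filter.1 hB').1 B'' (Finset.mem_filter.1 hB'').1)
  have hbg := big_sum h0 h (M := 16 * L) (by omega) B hB
  unfold Wb
  calc _ ≤ _ := ENNReal.tsum_le_tsum fun x => ENNReal.tsum_le_tsum fun y => hpt x y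
    _ = ((∑ B' ∈ F1, ∑ x ∈ B', fE (kern α) B x) + (∑ B' ∈ F1, ∑ x ∈ B', fE (kern α) B x))
      + ((∑ x ∈ B, ∑' y : ℤ, (if 16 * L * qq α B ^ 2 ≤ (x - y).natAbs then kern α (x - y).natAbs else 0))
      + (∑ x ∈ B, ∑' y : ℤ, (if 16 * L * qq α B ^ 2 ≤ (x - y).natAbs then kern α (x - y).natAbs else 0))) := by
        simp only [ENNReal.tsum_add]
        congr 1
        · congr 1
          rw [ENNReal.tsum_comm, e1]
        · congr 1
          rw [ENNReal.tsum_comm, e2]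
    _ ≤ _ := by
        rw [← two_mul, ← two_mul]
        gcongr

/-- The key gap estimate: choice of the separation constant. -/
lemma exists_M {α : ℝ} (h0 : 1 / 2 < α) (h : α < 1) : ∃ M : ℕ, 1 ≤ M ∧
    ∀ (B A : Finset ℤ), B.Nonempty → ∀ F : Finset (Finset ℤ), (∀ B' ∈ F, B'.Nonempty) →
    (∀ B' ∈ F, Far α M B B') →
    (∀ B' ∈ F, ∀ B'' ∈ F, B' ≠ B'' → Far α M B' B'') →
    (∀ x y, Sep A x y → ∃ B' ∈ F, Sep B' x y) →
    4 * Wb (kern α) B A ≤ En (kern α) B := by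
  have t : Filter.Tendsto (fun L : ℕ => 4 * (2 * ((2 / (L : ENNReal)) * cG α) +
      2 * (2 * kS α * ENNReal.ofReal (((16 * L : ℕ) : ℝ) ^ (α - 1))))) Filter.atTop
      (nhds (4 * (2 * ((0 * cG α)) + 2 * (2 * kS α * ENNReal.ofReal 0)))) := by
    have t1 : Filter.Tendsto (fun L : ℕ => (2 / (L : ENNReal))) Filter.atTop (nhds 0) := by
      have := ENNReal.Tendsto.const_div (a := 2) ENNReal.tendsto_nat_nhds_top (Or.inr (by simp))
      simpa using this
    have t2 : Filter.Tendsto (fun L : ℕ => (((16 * L : ℕ) : ℝ) ^ (α - 1))) Filter.atTop (nhds 0) := by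
      have a1 : Filter.Tendsto (fun L : ℕ => ((16 * L : ℕ) : ℝ)) Filter.atTop Filter.atTop := by
        apply tendsto_natCast_atTop_atTop.comp
        exact Filter.tendsto_id.const_mul_atTop' (by norm_num)
      have := (tendsto_rpow_neg_atTop (y := 1 - α) (by linarith)).comp a1
      simpa [Function.comp_def] using this
    have t3 := ENNReal.tendsto_ofReal t2
    apply ENNReal.Tendsto.const_mul _ (Or.inr (by simp))
    apply Filter.Tendsto.add
    · apply ENNReal.Tendsto.const_mul _ (Or.inr (by simp))
      exact ENNReal.Tendsto.mul_const t1 (Or.inr (cG_ne_top h0))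
    · apply ENNReal.Tendsto.const_mul _ (Or.inr (by simp))
      exact ENNReal.Tendsto.const_mul t3 (Or.inr (ENNReal.mul_ne_top (by simp) (kS_ne_top h)))
  have t0 : (4 * (2 * ((0 * cG α)) + 2 * (2 * kS α * ENNReal.ofReal 0))) = 0 := by simp
  rw [t0] at t
  have ev := (t.eventually (gt_mem_nhds (show (0 : ENNReal) < 1 by simp))).and
    (Filter.eventually_ge_atTop 1)
  obtain ⟨L, hL1, hL⟩ := ev.exists
  refine ⟨16 * L, by omega, ?_⟩
  intro B A hB F hne hf hpw hA
  have := Wb_le h0 h hL B A hB F hne hf hpw hA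
  calc 4 * Wb (kern α) B A ≤ 4 * (2 * ((2 / (L : ENNReal)) * cG α * En (kern α) B) +
      2 * (2 * kS α * ENNReal.ofReal (((16 * L : ℕ) : ℝ) ^ (α - 1)) * En (kern α) B)) := by gcongr
    _ = (4 * (2 * ((2 / (L : ENNReal)) * cG α) +
      2 * (2 * kS α * ENNReal.ofReal (((16 * L : ℕ) : ℝ) ^ (α - 1))))) * En (kern α) B := by ring
    _ ≤ 1 * En (kern α) B := by gcongr
    _ = _ := one_mul _

end RF

namespace RF

/-- The gap property of the separation constant. -/
def GapM (α : ℝ) (M : ℕ) : Prop := 1 ≤ M ∧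
    ∀ (B A : Finset ℤ), B.Nonempty → ∀ F : Finset (Finset ℤ), (∀ B' ∈ F, B'.Nonempty) →
    (∀ B' ∈ F, Far α M B B') →
    (∀ B' ∈ F, ∀ B'' ∈ F, B' ≠ B'' → Far α M B' B'') →
    (∀ x y, Sep A x y → ∃ B' ∈ F, Sep B' x y) →
    4 * Wb (kern α) B A ≤ En (kern α) B

def Indec (α : ℝ) (M : ℕ) (B : Finset ℤ) : Prop := B.Nonempty ∧
  ∀ B1 B2 : Finset ℤ, B1.Nonempty → B2.Nonempty → symmDiff B1 B2 = B → ¬ Far α M B1 B2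

lemma far_no_common {α : ℝ} (h0 : 0 < α) (h : α < 1) {M : ℕ} (hM : 1 ≤ M) {B B' : Finset ℤ}
    (hB : B.Nonempty) (hB' : B'.Nonempty) (hf : Far α M B B') {i : ℤ} (hi : Wall B i) :
    ¬ Wall B' i := by
  intro hi'
  have h1 := hf i i hi hi'
  have h2 := one_le_qq h0 h hB
  have h3 := one_le_qq h0 h hB'
  simp at h1
  rcases h1 with h1 | h1
  · omega
  · have := le_min h2 h3
    omega

lemma far_ne {α : ℝ} (h0 : 0 < α) (h : α < 1) {M : ℕ} (hM : 1 ≤ M) {B B' : Finset ℤ}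
    (hB : B.Nonempty) (hf : Far α M B B') : B ≠ B' := by
  rintro rfl
  obtain ⟨x, hx⟩ := hB
  obtain ⟨i, hi⟩ := exists_wall_right hx
  have hw : Wall B i := hi.2.2
  exact far_no_common h0 h hM ⟨x, hx⟩ ⟨x, hx⟩ hf hw hw

lemma wall_sd {A B : Finset ℤ} {i : ℤ} :
    Wall (symmDiff A B) i ↔ ¬ (Wall A i ↔ Wall B i) := sep_symmDiff

lemma wall_of_far {α : ℝ} (h0 : 0 < α) (h : α < 1) {M : ℕ} (hM : 1 ≤ M) {B B' : Finset ℤ}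
    (hB : B.Nonempty) (hB' : B'.Nonempty) (hf : Far α M B B') {i : ℤ} (hi : Wall B i) :
    Wall (symmDiff B B') i := by
  rw [wall_sd]
  have := far_no_common h0 h hM hB hB' hf hi
  tauto

lemma subset_Icc_of_walls {B B' : Finset ℤ} {a b : ℤ} (hB : B ⊆ Finset.Icc a b)
    (hw : ∀ i, Wall B' i → Wall B i) : B' ⊆ Finset.Icc a b := by
  have key : ∀ i, Wall B i → a ≤ i + 1 ∧ i ≤ b := by
    intro i hi
    have : i ∈ B ∨ i + 1 ∈ B := by
      unfold Wall Sep at hi; tauto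
    rcases this with h | h
    · have := Finset.mem_Icc.1 (hB h); omega
    · have := Finset.mem_Icc.1 (hB h); omega
  intro x hx
  obtain ⟨i, hi⟩ := exists_wall_right hx
  obtain ⟨j, hj⟩ := exists_wall_left hx
  have h1 := key i (hw i hi.2.2)
  have h2 := key j (hw j hj.2.2)
  have h3 : x ≤ i := hi.1
  have h4 : j < x := hj.2.1
  rw [Finset.mem_Icc]; omega

lemma En_le_of_far {α : ℝ} (h : α < 1) {M : ℕ} (hG : GapM α M) {B B' : Finset ℤ}
    (hB : B.Nonempty) (hB' : B'.Nonempty) (hf : Far α M B B') :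
    En (kern α) B' ≤ En (kern α) (symmDiff B B') := by
  have h1 := hG.2 B B' hB {B'} (by simpa using hB') (by simpa using hf) (by simp) (by
    intro x y hxy; exact ⟨B', by simp, hxy⟩)
  have h2 := En_identity (kern α) B' B
  have h3 : 2 * Wb (kern α) B B' ≤ En (kern α) B := by
    refine le_trans ?_ h1
    gcongr; norm_num
  have h4 : En (kern α) B' + En (kern α) B ≤ En (kern α) (symmDiff B B') + En (kern α) B := by
    rw [← h2, symmDiff_comm B' B]; gcongr
  exact (ENNReal.add_le_add_iff_right (En_ne_top h B)).1 h4

def fam (F : Finset (Finset ℤ)) (x : ℤ) : Prop := Odd (F.filter (fun B => x ∈ B)).card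

lemma fam_insert {F : Finset (Finset ℤ)} {B : Finset ℤ} (hB : B ∉ F) (x : ℤ) :
    fam (insert B F) x ↔ ¬ (x ∈ B ↔ fam F x) := by
  unfold fam
  rw [Finset.filter_insert]
  split_ifs with hx
  · rw [Finset.card_insert_of_notMem (by simp [hB]), Nat.odd_add_one]; tauto
  · tauto

lemma fam_sep {F : Finset (Finset ℤ)} {x y : ℤ} (hs : ∀ B ∈ F, ¬ Sep B x y) : fam F x ↔ fam F y := by
  unfold fam
  have : F.filter (fun B => x ∈ B) = F.filter (fun B => y ∈ B) := by
    apply Finset.filter_congr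
    intro B hB
    have := hs B hB
    unfold Sep at this; tauto
  rw [this]

lemma decomposition {α : ℝ} (h0 : 0 < α) (h : α < 1) {M : ℕ} (hG : GapM α M)
    (A : Finset ℤ) (hA : A.Nonempty) (a b : ℤ) (hAI : A ⊆ Finset.Icc a b) :
    ∃ F : Finset (Finset ℤ), (∀ B ∈ F, Indec α M B ∧ B ⊆ Finset.Icc a b) ∧
      (∀ B ∈ F, ∀ B' ∈ F, B ≠ B' → Far α M B B') ∧ (∀ x, x ∈ A ↔ fam F x) := by
  have hM := hG.1
  set P : Finset (Finset ℤ) → Prop := fun F => (∀ B ∈ F, B.Nonempty) ∧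
      (∀ B ∈ F, ∀ B' ∈ F, B ≠ B' → Far α M B B') ∧ (∀ x, x ∈ A ↔ fam F x) with hP
  set Ω := ((Finset.Icc a b).powerset.powerset).filter P with hΩ
  have hne : Ω.Nonempty := by
    refine ⟨{A}, ?_⟩
    rw [hΩ, Finset.mem_filter]
    refine ⟨by simp [hAI], by simpa using hA, by simp, ?_⟩
    intro x
    have := fam_insert (F := ∅) (B := A) (by simp) x
    have h2 : ¬ fam ∅ x := by simp [fam]
    simp only [insert_empty_eq] at this
    rw [this]; tauto
  obtain ⟨F, hF, hmax⟩ := Finset.exists_max_image Ω Finset.card hne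
  rw [hΩ, Finset.mem_filter] at hF
  obtain ⟨hF1, hF2, hF3, hF4⟩ := hF
  have hFI : ∀ B ∈ F, B ⊆ Finset.Icc a b := by
    intro B hB
    have := Finset.mem_powerset.1 hF1 hB
    simpa using this
  refine ⟨F, fun B hB => ⟨⟨hF2 B hB, ?_⟩, hFI B hB⟩, hF3, hF4⟩
  intro B1 B2 hB1 hB2 hsd hfar
  have w1 : ∀ i, Wall B1 i → Wall B i := fun i hi => hsd ▸ wall_of_far h0 h hM hB1 hB2 hfar hi
  have w2 : ∀ i, Wall B2 i → Wall B i := fun i hi => by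
    rw [← hsd, symmDiff_comm]; exact wall_of_far h0 h hM hB2 hB1 hfar.symm hi
  have q2 : qq α B2 ≤ qq α B := qq_mono h (hsd ▸ En_le_of_far h hG hB1 hB2 hfar)
  have q1 : qq α B1 ≤ qq α B := qq_mono h (by
    rw [← hsd, symmDiff_comm]; exact En_le_of_far h hG hB2 hB1 hfar.symm)
  have far' : ∀ B' : Finset ℤ, B' ∈ F.erase B → ∀ D : Finset ℤ, (∀ i, Wall D i → Wall B i) →
      qq α D ≤ qq α B → Far α M D B' := by
    intro B' hB' D hw hq i j hi hj
    have := hF3 B hB B' (Finset.mem_of_mem_erase hB') (Finset.ne_of_mem_erase hB').symm i j (hw i hi) hj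
    refine le_trans ?_ this
    gcongr
  have n2 : B2 ∉ F.erase B := fun hm => far_ne h0 h hM hB2 (far' B2 hm B2 w2 q2) rfl
  have n1 : B1 ∉ insert B2 (F.erase B) := by
    intro hm
    rcases Finset.mem_insert.1 hm with e | hm
    · exact far_ne h0 h hM hB1 hfar e
    · exact far_ne h0 h hM hB1 (far' B1 hm B1 w1 q1) rfl
  have hmem : insert B1 (insert B2 (F.erase B)) ∈ Ω := by
    rw [hΩ, Finset.mem_filter]
    refine ⟨?_, ?_, ?_, ?_⟩
    · rw [Finset.mem_powerset]
      intro D hD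
      rw [Finset.mem_powerset]
      simp only [Finset.mem_insert, Finset.mem_erase] at hD
      rcases hD with rfl | rfl | hD
      · exact subset_Icc_of_walls (hFI B hB) w1
      · exact subset_Icc_of_walls (hFI B hB) w2
      · exact hFI D hD.2
    · intro D hD
      simp only [Finset.mem_insert, Finset.mem_erase] at hD
      rcases hD with rfl | rfl | hD
      · exact hB1
      · exact hB2
      · exact hF2 D hD.2
    · intro D hD D' hD' hne
      simp only [Finset.mem_insert] at hD hD'
      rcases hD with rfl | rfl | hD <;> rcases hD' with rfl | rfl | hD'
      · exact absurd rfl hne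
      · exact hfar
      · exact far' _ hD' _ w1 q1
      · exact hfar.symm
      · exact absurd rfl hne
      · exact far' _ hD' _ w2 q2
      · exact (far' _ hD _ w1 q1).symm
      · exact (far' _ hD _ w2 q2).symm
      · exact hF3 _ (Finset.mem_of_mem_erase hD) _ (Finset.mem_of_mem_erase hD') hne
    · intro x
      rw [hF4 x, fam_insert n1, fam_insert n2]
      have e1 := fam_insert (F := F.erase B) (B := B) (by simp) x
      rw [Finset.insert_erase hB] at e1
      rw [e1]
      have : x ∈ B ↔ ¬ (x ∈ B1 ↔ x ∈ B2) := by
        rw [← hsd, Finset.mem_symmDiff]; clear * -; tauto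
      clear * - this
      by_cases u1 : x ∈ B1 <;> by_cases u2 : x ∈ B2 <;> by_cases u3 : x ∈ B <;>
        by_cases u4 : fam (F.erase B) x <;> simp_all
  have := hmax _ hmem
  rw [Finset.card_insert_of_notMem n1, Finset.card_insert_of_notMem n2,
    Finset.card_erase_of_mem hB] at this
  have : 0 < F.card := Finset.card_pos.2 ⟨B, hB⟩
  omega

/-- Every configuration containing `x` has an indecomposable part containing `x`
whose removal gains energy. -/
lemma exists_part {α : ℝ} (h0 : 0 < α) (h : α < 1) {M : ℕ} (hG : GapM α M)
    (A : Finset ℤ) (x : ℤ) (hx : x ∈ A) (a b : ℤ) (hAI : A ⊆ Finset.Icc a b) :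
    ∃ B : Finset ℤ, Indec α M B ∧ B ⊆ Finset.Icc a b ∧ x ∈ B ∧
      4 * Wb (kern α) B (symmDiff A B) ≤ En (kern α) B ∧
      ∀ i, Wall B i → ¬ Wall (symmDiff A B) i := by
  obtain ⟨F, h1, h2, h3⟩ := decomposition h0 h hG A ⟨x, hx⟩ a b hAI
  have hx' := (h3 x).1 hx
  have : (F.filter (fun B => x ∈ B)).Nonempty := by
    rw [← Finset.card_pos]; exact Odd.pos hx'
  obtain ⟨B, hB⟩ := this
  rw [Finset.mem_filter] at hB
  obtain ⟨hBF, hxB⟩ := hB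
  have hsep : ∀ y z, Sep (symmDiff A B) y z → ∃ B' ∈ F.erase B, Sep B' y z := by
    intro y z hyz
    by_contra hc
    push Not at hc
    have e := fam_sep hc
    have ey := fam_insert (F := F.erase B) (B := B) (by simp) y
    have ez := fam_insert (F := F.erase B) (B := B) (by simp) z
    rw [Finset.insert_erase hBF, ← h3] at ey ez
    unfold Sep at hyz
    simp only [Finset.mem_symmDiff] at hyz
    tauto
  have hfar : ∀ B' ∈ F.erase B, Far α M B B' := fun B' hB' =>
    h2 B hBF B' (Finset.mem_of_mem_erase hB') (Finset.ne_of_mem_erase hB').symm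
  refine ⟨B, (h1 B hBF).1, (h1 B hBF).2, hxB, ?_, ?_⟩
  · apply hG.2 B _ (h1 B hBF).1.1 (F.erase B)
    · exact fun B' hB' => (h1 B' (Finset.mem_of_mem_erase hB')).1.1
    · exact hfar
    · exact fun B' hB' B'' hB'' hn =>
        h2 B' (Finset.mem_of_mem_erase hB') B'' (Finset.mem_of_mem_erase hB'') hn
    · exact hsep
  · intro i hi hi'
    obtain ⟨B', hB', hs⟩ := hsep i (i+1) hi'
    exact far_no_common h0 h hG.1 (h1 B hBF).1.1 (h1 B' (Finset.mem_of_mem_erase hB')).1.1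
      (hfar B' hB') hi hs

end RF

namespace RF

lemma not_sep_of_no_wall {B : Finset ℤ} {x y : ℤ} (hxy : x ≤ y)
    (h : ∀ i, x ≤ i → i < y → ¬ Wall B i) : ¬ Sep B x y := by
  intro hs
  obtain ⟨i, h1, h2, h3⟩ := exists_wall hs (lt_of_le_of_ne hxy hs.ne)
  exact h i h1 h2 h3

def eU (α : ℝ) (B U : Finset ℤ) : ENNReal :=
  ∑ x ∈ U, ∑ y ∈ U, if Sep B x y then kern α (x - y).natAbs else 0

lemma eU_eq (α : ℝ) (B U : Finset ℤ) (p : ℤ) :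
    eU α B U = 2 * ∑ x ∈ U.filter (fun x => Sep B p x), ∑ y ∈ U.filter (fun y => ¬ Sep B p y),
      kern α (x - y).natAbs := by
  unfold eU
  rw [← Finset.sum_filter_add_sum_filter_not U (fun x => Sep B p x)]
  have h1 : ∑ x ∈ U.filter (fun x => Sep B p x),
      ∑ y ∈ U, (if Sep B x y then kern α (x - y).natAbs else 0) =
      ∑ x ∈ U.filter (fun x => Sep B p x), ∑ y ∈ U.filter (fun y => ¬ Sep B p y),
      kern α (x - y).natAbs := by
    apply Finset.sum_congr rfl
    intro x hx
    rw [Finset.sum_filter]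
    apply Finset.sum_congr rfl
    intro y hy
    have hx2 := (Finset.mem_filter.1 hx).2
    have : Sep B x y ↔ ¬ Sep B p y := by unfold Sep at *; tauto
    simp only [this]
  have h2 : ∑ x ∈ U.filter (fun x => ¬ Sep B p x),
      ∑ y ∈ U, (if Sep B x y then kern α (x - y).natAbs else 0) =
      ∑ x ∈ U.filter (fun x => Sep B p x), ∑ y ∈ U.filter (fun y => ¬ Sep B p y),
      kern α (x - y).natAbs := by
    conv_rhs => rw [Finset.sum_comm]
    apply Finset.sum_congr rfl
    intro x hx
    rw [Finset.sum_filter]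
    apply Finset.sum_congr rfl
    intro y hy
    have hx2 := (Finset.mem_filter.1 hx).2
    have : Sep B x y ↔ Sep B p y := by unfold Sep at *; tauto
    have e : (x - y).natAbs = (y - x).natAbs := by omega
    simp only [this, e]
  rw [h1, h2, two_mul]

def wcount (B : Finset ℤ) (p t : ℤ) (w : ℕ) : ℕ :=
  ((Finset.Ico t (t + w)).filter (fun x => Sep B p x)).card

lemma wcount_succ (B : Finset ℤ) (p t : ℤ) (w : ℕ) : wcount B p (t + 1) w ≤ wcount B p t w + 1 := by
  unfold wcount
  have : (Finset.Ico (t+1) (t + 1 + w)).filter (fun x => Sep B p x) ⊆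
      insert (t + (w:ℤ)) ((Finset.Ico t (t + w)).filter (fun x => Sep B p x)) := by
    intro x hx
    simp only [Finset.mem_filter, Finset.mem_Ico, Finset.mem_insert] at *
    by_cases e : x = t + w
    · exact Or.inl e
    · right; refine ⟨by omega, hx.2⟩
  exact (Finset.card_le_card this).trans (Finset.card_insert_le _ _)

lemma window_ivt (N : ℕ → ℕ) (v : ℕ) (hv : 1 ≤ v) (h0 : N 0 = 0) (hs : ∀ j, N (j+1) ≤ N j + 1)
    (J : ℕ) (hJ : v ≤ N J) : ∃ j ≤ J, N j = v := by
  have hex : ∃ j, v ≤ N j := ⟨J, hJ⟩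
  refine ⟨Nat.find hex, Nat.find_le hJ, ?_⟩
  have h1 := Nat.find_spec hex
  rcases hn : Nat.find hex with _ | n
  · rw [hn] at h1; omega
  · have := Nat.find_min hex (m := n) (by omega)
    have := hs n
    rw [hn] at h1; omega

/-- Lower bound on the energy of a window with both phases. -/
lemma eU_window {α : ℝ} (h : α < 1) {B : Finset ℤ} {U : Finset ℤ} {p t : ℤ} {v : ℕ}
    (hU : Finset.Ico t (t + (2 * v : ℕ)) ⊆ U) (hc : wcount B p t (2 * v) = v) :
    2 * ((v : ENNReal) * ((v : ENNReal) * kern α (2 * v))) ≤ eU α B U := by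
  rw [eU_eq α B U p]
  set W := Finset.Ico t (t + (2 * v : ℕ)) with hW
  have hWc : W.card = 2 * v := by rw [hW]; simp; omega
  have c1 : (W.filter (fun x => Sep B p x)).card = v := hc
  have c2 : (W.filter (fun x => ¬ Sep B p x)).card = v := by
    have := Finset.card_filter_add_card_filter_not (s := W) (fun x => Sep B p x)
    omega
  refine mul_le_mul_right ?_ _
  calc (v : ENNReal) * ((v : ENNReal) * kern α (2 * v))
      = ∑ x ∈ W.filter (fun x => Sep B p x), ∑ y ∈ W.filter (fun x => ¬ Sep B p x), kern α (2 * v) := by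
        simp only [Finset.sum_const, c1, c2, nsmul_eq_mul]
    _ ≤ ∑ x ∈ W.filter (fun x => Sep B p x), ∑ y ∈ W.filter (fun x => ¬ Sep B p x),
          kern α (x - y).natAbs := by
        apply Finset.sum_le_sum; intro x hx
        apply Finset.sum_le_sum; intro y hy
        simp only [hW, Finset.mem_filter, Finset.mem_Ico] at hx hy
        have : x ≠ y := by rintro rfl; exact hy.2 hx.2
        apply kern_anti h <;> omega
    _ ≤ _ := by
        refine (Finset.sum_le_sum fun x _ => Finset.sum_le_sum_of_subset
          (Finset.filter_subset_filter _ hU)).trans ?_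
        exact Finset.sum_le_sum_of_subset (Finset.filter_subset_filter _ hU)

/-- `En` of the minority set. -/
lemma En_minority {α : ℝ} (h : α < 1) {B U : Finset ℤ} {p : ℤ} {v : ℕ} (hv : 1 ≤ v)
    (hin : ∀ x ∈ U, Sep B p x → ∀ y : ℤ, (x - y).natAbs < 2 * v → y ∈ U)
    (hw : ∀ x ∈ U, Sep B p x → Finset.Ico x (x + (2 * v : ℕ)) ⊆ U)
    (hc : ∀ x ∈ U, Sep B p x → wcount B p x (2 * v) < v) :
    En (kern α) (U.filter (fun x => Sep B p x)) ≤ (1 + 4 * kS α) * eU α B U := by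
  set D := U.filter (fun x => Sep B p x) with hD
  set D' := U.filter (fun x => ¬ Sep B p x) with hD'
  have hvr : (0 : ℝ) < 2 * v := by
    have : (1 : ℝ) ≤ v := by exact_mod_cast hv
    linarith
  have hk : ENNReal.ofReal (((2 * v : ℕ) : ℝ) ^ (α - 1)) = 2 * ((v : ENNReal) * kern α (2 * v)) := by
    unfold kern
    have e1 : (2 : ENNReal) * ((v : ENNReal) * ENNReal.ofReal (((2 * v : ℕ) : ℝ) ^ (α - 2))) =
        ENNReal.ofReal (2 * v) * ENNReal.ofReal (((2 * v : ℕ) : ℝ) ^ (α - 2)) := by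
      rw [ENNReal.ofReal_mul (by norm_num), ENNReal.ofReal_natCast, ENNReal.ofReal_ofNat, mul_assoc]
    rw [e1, ← ENNReal.ofReal_mul (by positivity)]
    congr 1
    push_cast
    have : α - 1 = 1 + (α - 2) := by ring
    rw [this, Real.rpow_add hvr, Real.rpow_one]
  have hlow : (D.card : ENNReal) * ENNReal.ofReal (((2 * v : ℕ) : ℝ) ^ (α - 1)) ≤ eU α B U := by
    rw [eU_eq α B U p, hk]
    calc (D.card : ENNReal) * (2 * ((v : ENNReal) * kern α (2 * v)))
        = 2 * ∑ x ∈ D, ((v : ENNReal) * kern α (2 * v)) := by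
          rw [Finset.sum_const, nsmul_eq_mul]; ring
      _ ≤ _ := by
          refine mul_le_mul_right (Finset.sum_le_sum fun x hx => ?_) _
          obtain ⟨hxU, hxs⟩ := Finset.mem_filter.1 hx
          set W := Finset.Ico x (x + (2 * v : ℕ)) with hW
          have hWc : W.card = 2 * v := by rw [hW]; simp; omega
          have c1 : (W.filter (fun x => Sep B p x)).card < v := hc x hxU hxs
          have c2 : v ≤ (W.filter (fun x => ¬ Sep B p x)).card := by
            have := Finset.card_filter_add_card_filter_not (s := W) (fun x => Sep B p x)
            omega
          calc (v : ENNReal) * kern α (2 * v)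
              ≤ ((W.filter (fun x => ¬ Sep B p x)).card : ENNReal) * kern α (2 * v) := by gcongr
            _ = ∑ y ∈ W.filter (fun x => ¬ Sep B p x), kern α (2 * v) := by
                rw [Finset.sum_const, nsmul_eq_mul]
            _ ≤ ∑ y ∈ W.filter (fun x => ¬ Sep B p x), kern α (x - y).natAbs := by
                apply Finset.sum_le_sum; intro y hy
                simp only [hW, Finset.mem_filter, Finset.mem_Ico] at hy
                have : x ≠ y := by rintro rfl; exact hy.2 hxs
                apply kern_anti h <;> omega
            _ ≤ _ := Finset.sum_le_sum_of_subset (Finset.filter_subset_filter _ (hw x hxU hxs))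
  have hfE : ∀ x ∈ D, fE (kern α) D x ≤ ∑ y ∈ D', kern α (x - y).natAbs +
      2 * (ENNReal.ofReal (((2 * v : ℕ) : ℝ) ^ (α - 1)) * kS α) := by
    intro x hx
    obtain ⟨hxU, hxs⟩ := Finset.mem_filter.1 hx
    have ht := kern_tail h (R := 2 * v) (by omega) x
    refine le_trans ?_ (add_le_add_right ht _)
    rw [show ∑ y ∈ D', kern α (x - y).natAbs =
        ∑' y : ℤ, if y ∈ D' then kern α (x - y).natAbs else 0 by
      rw [tsum_eq_sum (s := D') (by intro y hy; simp [hy])]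
      exact Finset.sum_congr rfl (fun y hy => by simp [hy])]
    rw [← ENNReal.tsum_add]
    apply ENNReal.tsum_le_tsum
    intro y
    split_ifs with a b c c <;> try simp
    have hyU := hin x hxU hxs y (by omega)
    have : y ∉ D := by
      unfold Sep at a; tauto
    rw [hD, Finset.mem_filter] at this
    rw [hD', Finset.mem_filter] at b
    tauto
  rw [En_eq_two]
  calc 2 * ∑ x ∈ D, fE (kern α) D x ≤ 2 * ∑ x ∈ D, (∑ y ∈ D', kern α (x - y).natAbs +
      2 * (ENNReal.ofReal (((2 * v : ℕ) : ℝ) ^ (α - 1)) * kS α)) :=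
        mul_le_mul_right (Finset.sum_le_sum hfE) _
    _ = eU α B U + 4 * kS α * ((D.card : ENNReal) * ENNReal.ofReal (((2 * v : ℕ) : ℝ) ^ (α - 1))) := by
        rw [Finset.sum_add_distrib, Finset.sum_const, nsmul_eq_mul, mul_add, ← eU_eq α B U p]; ring
    _ ≤ eU α B U + 4 * kS α * eU α B U := by gcongr
    _ = _ := by ring

lemma local_energy {α : ℝ} (h0 : 1 / 2 < α) (h : α < 1) {M : ℕ} {CE : ℕ}
    (hCE : 2 * (M : ENNReal) * (1 + 4 * kS α) ≤ CE) (hCE3 : 3 ≤ CE) (hM : 1 ≤ M)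
    {B : Finset ℤ} (hB : Indec α M B) {l r : ℤ} {v : ℕ} (hv : 1 ≤ v)
    (hlr : l + 4 * v ≤ r)
    (hl : ∀ i, l ≤ i → i < l + 4 * v → ¬ Wall B i)
    (hr : ∀ i, r ≤ i → i < r + 4 * v → ¬ Wall B i)
    (hin : ∃ i, l + 4 * v ≤ i ∧ i < r ∧ Wall B i)
    (hout : ∃ i, (i < l ∨ r + 4 * v ≤ i) ∧ Wall B i) :
    ((4 * v : ℕ) : ENNReal) ≤ (CE * eU α B (Finset.Ico (l + 2 * v) (r + 2 * v))) ^ 2 := by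
  set U := Finset.Ico (l + 2 * v) (r + 2 * (v:ℤ)) with hU
  set p := l + 2 * (v:ℤ) with hp
  have hleft : ∀ x, l ≤ x → x ≤ l + 4 * v → ¬ Sep B p x := by
    intro x h1 h2
    rcases le_total p x with hx | hx
    · exact not_sep_of_no_wall hx (fun i h3 h4 => hl i (by omega) (by omega))
    · intro hs
      exact not_sep_of_no_wall hx (fun i h3 h4 => hl i (by omega) (by omega)) hs.symm
  have hright : ∀ x, r ≤ x → x ≤ r + 4 * v → ¬ Sep B r x := by
    intro x h1 h2
    exact not_sep_of_no_wall h1 (fun i h3 h4 => hr i (by omega) (by omega))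
  by_cases hcase : ∃ j : ℕ, p + j ≤ r ∧ v ≤ wcount B p (p + j) (2 * v)
  · obtain ⟨J, hJ1, hJ2⟩ := hcase
    obtain ⟨j, hj1, hj2⟩ := window_ivt (fun j => wcount B p (p + j) (2 * v)) v hv (by
        simp only [wcount, Finset.card_eq_zero, Finset.filter_eq_empty_iff]
        intro x hx
        simp only [Finset.mem_Ico] at hx
        apply hleft <;> push_cast at hx <;> omega)
      (by intro j
          have := wcount_succ B p (p + j) (2 * v)
          push_cast
          rwa [← add_assoc]) J hJ2
    have hsub : Finset.Ico (p + (j:ℤ)) (p + j + (2 * v : ℕ)) ⊆ U := by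
      intro x hx
      simp only [hU, Finset.mem_Ico] at *
      push_cast at hx
      omega
    have he := eU_window h hsub hj2
    refine le_trans ?_ (pow_le_pow_left' (mul_le_mul_right he _) 2)
    refine le_trans ?_ (pow_le_pow_left' (mul_le_mul_left (show ((3 : ℕ) : ENNReal) ≤ CE by
      exact_mod_cast hCE3) _) 2)
    unfold kern
    have hvr : (1 : ℝ) ≤ v := by exact_mod_cast hv
    rw [← ENNReal.ofReal_natCast, ← ENNReal.ofReal_natCast (n := v), ← ENNReal.ofReal_natCast (n := 3),
      ← ENNReal.ofReal_ofNat, ← ENNReal.ofReal_mul (by positivity), ← ENNReal.ofReal_mul (by positivity),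
      ← ENNReal.ofReal_mul (by norm_num), ← ENNReal.ofReal_mul (by norm_num),
      ← ENNReal.ofReal_pow (by positivity)]
    apply ENNReal.ofReal_le_ofReal
    push_cast
    have e1 : (2 * (v : ℝ)) ^ (α - 2) ≥ (2 * v : ℝ) ^ (1/2 - 2 : ℝ) :=
      Real.rpow_le_rpow_of_exponent_le (by linarith) (by linarith)
    have e2 : ((2 * v : ℝ) ^ (1/2 - 2 : ℝ)) ^ 2 = (2 * v : ℝ) ^ (-3 : ℤ) := by
      rw [← Real.rpow_natCast, ← Real.rpow_mul (by positivity), ← Real.rpow_intCast]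
      norm_num
    have e3 : (2 * v : ℝ) ^ (-3 : ℤ) * (2 * v) ^ 4 = 2 * v := by
      have : (2 * v : ℝ) ≠ 0 := by positivity
      field_simp
    have e4 : ((2 * v : ℝ) ^ (1/2 - 2 : ℝ)) ^ 2 ≤ ((2 * (v : ℝ)) ^ (α - 2)) ^ 2 := by
      apply pow_le_pow_left₀ (by positivity) e1
    calc (4 * v : ℝ) ≤ 9 / 4 * (2 * v) := by linarith
      _ = 9 / 4 * ((2 * v : ℝ) ^ (-3 : ℤ) * (2 * v) ^ 4) := by rw [e3]
      _ = ((2 * v : ℝ) ^ (1/2 - 2 : ℝ)) ^ 2 * (9 / 4 * (2 * v) ^ 4) := by rw [e2]; ring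
      _ ≤ ((2 * (v : ℝ)) ^ (α - 2)) ^ 2 * (9 / 4 * (2 * v) ^ 4) := by gcongr
      _ = _ := by ring
  · push Not at hcase
    have hc : ∀ t : ℤ, p ≤ t → t ≤ r → wcount B p t (2 * v) < v := by
      intro t h1 h2
      have := hcase (t - p).toNat (by omega)
      rwa [show p + ((t - p).toNat : ℤ) = t by omega] at this
    have hpr : ¬ Sep B p r := by
      intro hs
      have h1 := hc r (by omega) le_rfl
      have h2 : wcount B p r (2 * v) = 2 * v := by
        unfold wcount
        rw [Finset.filter_true_of_mem]
        · simp; omega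
        · intro x hx
          simp only [Finset.mem_Ico] at hx
          push_cast at hx
          have := hright x hx.1 (by omega)
          clear * - this hs
          unfold Sep at *; tauto
      omega
    have hright' : ∀ x, r ≤ x → x ≤ r + 4 * v → ¬ Sep B p x := by
      intro x h1 h2
      have := hright x h1 h2
      clear * - this hpr
      unfold Sep at *; tauto
    have hloc : ∀ x ∈ U, Sep B p x → l + 4 * v < x ∧ x < r := by
      intro x hx hs
      simp only [hU, Finset.mem_Ico] at hx
      constructor
      · by_contra hcon
        exact hleft x (by omega) (by omega) hs
      · by_contra hcon
        exact hright' x (by omega) (by omega) hs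
    have hE := En_minority (α := α) h (B := B) (U := U) (p := p) hv
      (by
        intro x hx hs y hy
        have := hloc x hx hs
        simp only [hU, Finset.mem_Ico]; omega)
      (by
        intro x hx hs y hy
        have := hloc x hx hs
        simp only [Finset.mem_Ico] at hy
        push_cast at hy
        simp only [hU, Finset.mem_Ico]; omega)
      (by
        intro x hx hs
        have := hloc x hx hs
        exact hc x (by omega) (by omega))
    set D := U.filter (fun x => Sep B p x) with hD
    have hDloc : ∀ x ∈ D, l + 4 * v < x ∧ x < r := fun x hx =>
      hloc x (Finset.mem_filter.1 hx).1 (Finset.mem_filter.1 hx).2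
    have hDne : D.Nonempty := by
      obtain ⟨i, h1, h2, h3⟩ := hin
      have hor : Sep B p i ∨ Sep B p (i+1) := by
        clear * - h3; unfold Wall Sep at *; tauto
      rcases hor with hs | hs
      · exact ⟨i, by rw [hD, Finset.mem_filter]; exact ⟨by simp only [hU, Finset.mem_Ico]; omega, hs⟩⟩
      · exact ⟨i + 1, by
          rw [hD, Finset.mem_filter]; exact ⟨by simp only [hU, Finset.mem_Ico]; omega, hs⟩⟩
    have hwD : ∀ i, Wall D i → l + 4 * v ≤ i ∧ i < r := by
      intro i hi
      have : i ∈ D ∨ i + 1 ∈ D := by unfold Wall Sep at hi; clear * - hi; tauto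
      rcases this with hm | hm
      · have := hDloc _ hm; omega
      · have := hDloc _ hm; omega
    have hmem : ∀ x, l ≤ x → x ≤ r + 4 * v → (x ∈ symmDiff B D ↔ p ∈ B) := by
      intro x h1 h2
      rw [Finset.mem_symmDiff]
      by_cases hxU : x ∈ U
      · have : x ∈ D ↔ Sep B p x := by rw [hD, Finset.mem_filter]; exact and_iff_right hxU
        rw [this]; unfold Sep; clear * -; tauto
      · have hxD : x ∉ D := fun hx => hxU (Finset.mem_filter.1 hx).1
        have : ¬ Sep B p x := by
          simp only [hU, Finset.mem_Ico] at hxU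
          rcases lt_or_ge x p with h3 | h3
          · exact hleft x h1 (by omega)
          · exact hright' x (by omega) h2
        unfold Sep at this; clear * - this hxD; tauto
    have hwBD : ∀ j, Wall (symmDiff B D) j → j < l ∨ r + 4 * v ≤ j := by
      intro j hj
      by_contra hcon
      push Not at hcon
      have a1 := hmem j hcon.1 (by omega)
      have a2 := hmem (j+1) (by omega) (by omega)
      unfold Wall Sep at hj; clear * - a1 a2 hj; tauto
    have hBDne : (symmDiff B D).Nonempty := by
      obtain ⟨i, hi, hwi⟩ := hout
      have n1 : i ∉ D := fun hm => by have := hDloc _ hm; omega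
      have n2 : i + 1 ∉ D := fun hm => by have := hDloc _ hm; omega
      unfold Wall Sep at hwi
      by_cases hiB : i ∈ B
      · exact ⟨i, by rw [Finset.mem_symmDiff]; clear * - hwi n1 n2 hiB; tauto⟩
      · exact ⟨i + 1, by rw [Finset.mem_symmDiff]; clear * - hwi n1 n2 hiB; tauto⟩
    have hnf := hB.2 D (symmDiff B D) hDne hBDne (by
      rw [symmDiff_comm B D, symmDiff_symmDiff_cancel_left])
    have hq : 4 * v < M * qq α D ^ 2 := by
      by_contra hcon
      push Not at hcon
      apply hnf
      intro i j hi hj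
      have h1 := hwD i hi
      have h2 := hwBD j hj
      have h3 : M * (min (qq α D) (qq α (symmDiff B D))) ^ 2 ≤ M * qq α D ^ 2 := by
        gcongr; exact min_le_left _ _
      omega
    have hq2 : (qq α D : ENNReal) ≤ 2 * ((1 + 4 * kS α) * eU α B U) := by
      refine le_trans ?_ (mul_le_mul_right hE _)
      have := ENNReal.ofReal_le_ofReal (qq_le (by linarith) h hDne)
      rw [ENNReal.ofReal_natCast, ENNReal.ofReal_mul (by norm_num),
        ENNReal.ofReal_toReal (En_ne_top h D)] at this
      simpa using this
    calc ((4 * v : ℕ) : ENNReal) ≤ ((M * qq α D ^ 2 : ℕ) : ENNReal) := by exact_mod_cast hq.le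
      _ ≤ (M * qq α D : ENNReal) ^ 2 := by
          push_cast
          rw [mul_pow]
          gcongr
          exact_mod_cast Nat.le_self_pow (by norm_num) M
      _ ≤ (M * (2 * ((1 + 4 * kS α) * eU α B U))) ^ 2 := by gcongr
      _ = ((2 * M * (1 + 4 * kS α)) * eU α B U) ^ 2 := by ring
      _ ≤ _ := by gcongr

end RF

namespace RF

def cov (B : Finset ℤ) (k : ℕ) : Finset ℤ := (walls B).image (fun i => i / (4 : ℤ) ^ k)
def starts (C : Finset ℤ) : Finset ℤ := C.filter (fun a => a - 1 ∉ C)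
def ends (C : Finset ℤ) : Finset ℤ := C.filter (fun a => a + 1 ∉ C)

lemma mem_cov {B : Finset ℤ} {k : ℕ} {j : ℤ} : j ∈ cov B k ↔ ∃ i, Wall B i ∧ i / (4 : ℤ) ^ k = j := by
  simp [cov, mem_walls]

lemma div_eq_iff' {R i c : ℤ} (hR : 0 < R) : i / R = c ↔ c * R ≤ i ∧ i < (c + 1) * R := by
  constructor
  · rintro rfl
    exact ⟨Int.ediv_mul_le i hR.ne', Int.lt_ediv_add_one_mul_self i hR⟩
  · rintro ⟨h1, h2⟩
    apply le_antisymm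
    · exact Int.lt_add_one_iff.1 (Int.ediv_lt_of_lt_mul hR h2)
    · exact Int.le_ediv_of_mul_le hR h1

lemma exists_run (C : Finset ℤ) (a : ℤ) (ha : a ∈ C) :
    ∃ b, a ≤ b ∧ (∀ x, a ≤ x → x ≤ b → x ∈ C) ∧ b + 1 ∉ C := by
  have hex : ∃ n : ℕ, a + n ∉ C := by
    by_contra hc
    push Not at hc
    have : Set.Infinite (C : Set ℤ) := by
      apply Set.infinite_of_injective_forall_mem (f := fun n : ℕ => a + n)
      · intro x y hxy; simpa using hxy
      · exact hc
    exact this C.finite_toSet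
  have h1 := Nat.find_spec hex
  have h2 : ∀ n < Nat.find hex, a + (n:ℤ) ∈ C := fun n hn => by
    have := Nat.find_min hex hn; tauto
  rcases hn : Nat.find hex with _ | n
  · rw [hn] at h1; simp at h1; exact absurd ha h1
  · rw [hn] at h1 h2
    refine ⟨a + n, by omega, ?_, ?_⟩
    · intro x hx1 hx2
      have := h2 (x - a).toNat (by omega)
      rwa [show a + ((x - a).toNat : ℤ) = x by omega] at this
    · push_cast at h1; rwa [← add_assoc] at h1

lemma sum_eU_le (α : ℝ) (B : Finset ℤ) (S : Finset ℤ) (U : ℤ → Finset ℤ)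
    (hd : ∀ a ∈ S, ∀ b ∈ S, a ≠ b → Disjoint (U a) (U b)) :
    ∑ a ∈ S, eU α B (U a) ≤ En (kern α) B := by
  calc ∑ a ∈ S, eU α B (U a) ≤ ∑ a ∈ S, ∑ x ∈ U a, fE (kern α) B x := by
        apply Finset.sum_le_sum; intro a _
        apply Finset.sum_le_sum; intro x _
        exact ENNReal.sum_le_tsum _
    _ = ∑ x ∈ S.biUnion U, fE (kern α) B x := by
        rw [Finset.sum_biUnion]
        intro a ha b hb hab
        exact hd a ha b hb hab
    _ ≤ _ := ENNReal.sum_le_tsum _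

lemma starts_bound {α : ℝ} (h0 : 1 / 2 < α) (h : α < 1) {M : ℕ} {CE : ℕ}
    (hCE : 2 * (M : ENNReal) * (1 + 4 * kS α) ≤ CE) (hCE3 : 3 ≤ CE) (hM : 1 ≤ M)
    {B : Finset ℤ} (hB : Indec α M B) {m : ℕ} (hm : qq α B ≤ m) {k : ℕ} (hk : 1 ≤ k) :
    (starts (cov B k)).card ≤ 1 ∨ (starts (cov B k)).card * 2 ^ k ≤ CE * m := by
  by_cases hs : (starts (cov B k)).card ≤ 1
  · exact Or.inl hs
  right
  push Not at hs
  set C := cov B k with hC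
  have hR : (0 : ℤ) < 4 ^ k := by positivity
  set R : ℤ := 4 ^ k with hRdef
  set v : ℕ := 4 ^ (k - 1) with hvdef
  have hv : 1 ≤ v := Nat.one_le_pow _ _ (by norm_num)
  have hvR : 4 * (v : ℤ) = R := by
    rw [hvdef, hRdef]; push_cast
    rw [← pow_succ', Nat.sub_add_cancel hk]
  have hvN : 4 * v = 2 ^ k * 2 ^ k := by
    rw [hvdef, ← pow_succ', Nat.sub_add_cancel hk, ← mul_pow]
    norm_num
  have hrun : ∀ a, ∃ b, a ∈ C → (a ≤ b ∧ (∀ x, a ≤ x → x ≤ b → x ∈ C) ∧ b + 1 ∉ C) := by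
    intro a
    by_cases ha : a ∈ C
    · obtain ⟨b, hb⟩ := exists_run C a ha
      exact ⟨b, fun _ => hb⟩
    · exact ⟨a, fun h => absurd h ha⟩
  choose bf hbf using hrun
  have hst : ∀ a ∈ starts C, a ∈ C ∧ a - 1 ∉ C := fun a ha => Finset.mem_filter.1 ha
  -- order of runs
  have hord : ∀ a ∈ starts C, ∀ a' ∈ starts C, a < a' → bf a + 2 ≤ a' := by
    intro a ha a' ha' hlt
    obtain ⟨h1, h2⟩ := hst a ha
    obtain ⟨h3, h4⟩ := hst a' ha'
    obtain ⟨b1, b2, b3⟩ := hbf a h1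
    have n1 : ¬ (a' - 1 ≤ bf a) := fun hc => h4 (b2 _ (by omega) hc)
    have n2 : a' ≠ bf a + 1 := fun hc => b3 (hc ▸ h3)
    omega
  have hnw : ∀ c, c ∉ C → ∀ i, c * R ≤ i → i < (c + 1) * R → ¬ Wall B i := by
    intro c hc i h1 h2 hw
    exact hc (mem_cov.2 ⟨i, hw, (div_eq_iff' hR).2 ⟨h1, h2⟩⟩)
  have hwc : ∀ c ∈ C, ∃ i, Wall B i ∧ c * R ≤ i ∧ i < (c + 1) * R := by
    intro c hc
    obtain ⟨i, h1, h2⟩ := mem_cov.1 hc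
    exact ⟨i, h1, (div_eq_iff' hR).1 h2⟩
  set U : ℤ → Finset ℤ := fun a => Finset.Ico ((a - 1) * R + 2 * v) ((bf a + 1) * R + 2 * v) with hU
  have hloc : ∀ a ∈ starts C, (2 ^ k : ENNReal) ≤ CE * eU α B (U a) := by
    intro a ha
    obtain ⟨h1, h2⟩ := hst a ha
    obtain ⟨b1, b2, b3⟩ := hbf a h1
    have key := local_energy h0 h hCE hCE3 hM hB (l := (a - 1) * R) (r := (bf a + 1) * R) hv
      (by rw [hvR]; nlinarith)
      (by
        intro i hi1 hi2
        exact hnw (a - 1) h2 i hi1 (by rw [hvR] at hi2; linarith))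
      (by
        intro i hi1 hi2
        exact hnw (bf a + 1) b3 i hi1 (by rw [hvR] at hi2; linarith))
      (by
        obtain ⟨i, w, i1, i2⟩ := hwc a h1
        refine ⟨i, by rw [hvR]; linarith, ?_, w⟩
        nlinarith)
      (by
        obtain ⟨a', ha', hne⟩ := Finset.exists_mem_ne hs a
        obtain ⟨i, w, i1, i2⟩ := hwc a' (hst a' ha').1
        refine ⟨i, ?_, w⟩
        rcases lt_or_gt_of_ne hne with hlt | hlt
        · left
          have q1 := hord a' ha' a ha hlt
          have q2 := (hbf a' (hst a' ha').1).1
          nlinarith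
        · right
          have q1 := hord a ha a' ha' hlt
          rw [hvR]; nlinarith)
    rw [hvN] at key
    push_cast at key
    rw [← sq] at key
    exact (ENNReal.pow_le_pow_left_iff (by norm_num)).1 key
  have hsum := sum_eU_le α B (starts C) U (by
    have aux : ∀ a ∈ starts C, ∀ b ∈ starts C, a < b → Disjoint (U a) (U b) := by
      intro a ha b hb hlt
      have q1 := hord a ha b hb hlt
      rw [Finset.disjoint_left]
      intro x hx hx'
      simp only [hU, Finset.mem_Ico] at hx hx'
      nlinarith
    intro a ha b hb hab
    rcases lt_or_gt_of_ne hab with hlt | hlt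
    · exact aux a ha b hb hlt
    · exact (aux b hb a ha hlt).symm)
  have : (((starts C).card * 2 ^ k : ℕ) : ENNReal) ≤ ((CE * m : ℕ) : ENNReal) := by
    push_cast
    calc ((starts C).card : ENNReal) * 2 ^ k = ∑ a ∈ starts C, (2 ^ k : ENNReal) := by
          rw [Finset.sum_const, nsmul_eq_mul]
      _ ≤ ∑ a ∈ starts C, CE * eU α B (U a) := Finset.sum_le_sum hloc
      _ = CE * ∑ a ∈ starts C, eU α B (U a) := by rw [Finset.mul_sum]
      _ ≤ CE * m := by
          refine mul_le_mul_right (hsum.trans ((En_le_qq h B).trans ?_)) _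
          exact_mod_cast hm
  exact_mod_cast this

lemma card_ends (C : Finset ℤ) : (ends C).card = (starts C).card := by
  have h1 : (C.filter (fun a => a - 1 ∈ C)).card + (starts C).card = C.card :=
    Finset.card_filter_add_card_filter_not (s := C) _
  have h2 : (C.filter (fun a => a + 1 ∈ C)).card + (ends C).card = C.card :=
    Finset.card_filter_add_card_filter_not (s := C) _
  have h3 : (C.filter (fun a => a + 1 ∈ C)).card = (C.filter (fun a => a - 1 ∈ C)).card := by
    apply Finset.card_bij (fun a _ => a + 1)
    · intro a ha
      simp only [Finset.mem_filter] at *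
      exact ⟨ha.2, by simpa using ha.1⟩
    · intro a _ b _ hab; omega
    · intro b hb
      simp only [Finset.mem_filter] at hb
      exact ⟨b - 1, by simp only [Finset.mem_filter]; exact ⟨hb.2, by simpa using hb.1⟩, by ring⟩
  omega

lemma card_div_four (C : Finset ℤ) :
    4 * (C.image (fun i => i / 4)).card ≤ C.card + 8 * (starts C).card := by
  set D := C.image (fun i => i / 4) with hD
  set full := D.filter (fun j => ∀ x, x / 4 = j → x ∈ C) with hfull
  have h1 : 4 * full.card ≤ C.card := by
    have hsub : full.biUnion (fun j => Finset.Ico (4 * j) (4 * j + 4)) ⊆ C := by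
      intro x hx
      simp only [Finset.mem_biUnion, Finset.mem_Ico] at hx
      obtain ⟨j, hj, hx⟩ := hx
      exact (Finset.mem_filter.1 hj).2 x (by omega)
    have := Finset.card_le_card hsub
    rw [Finset.card_biUnion] at this
    · simp at this; omega
    · intro i _ j _ hij
      change Disjoint (Finset.Ico (4 * i) (4 * i + 4)) (Finset.Ico (4 * j) (4 * j + 4))
      rw [Finset.disjoint_left]
      intro x hx hx'
      simp only [Finset.mem_Ico] at hx hx'
      omega
  have h2 : (D.filter (fun j => ¬ ∀ x, x / 4 = j → x ∈ C)).card ≤ 2 * (starts C).card := by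
    have hsub : D.filter (fun j => ¬ ∀ x, x / 4 = j → x ∈ C) ⊆
        (starts C ∪ ends C).image (fun i => i / 4) := by
      intro j hj
      obtain ⟨hjD, hj⟩ := Finset.mem_filter.1 hj
      push Not at hj
      obtain ⟨x, hx, hxC⟩ := hj
      obtain ⟨c, hc, hcj⟩ := Finset.mem_image.1 hjD
      by_contra hcon
      simp only [Finset.mem_image, Finset.mem_union, not_exists, not_and] at hcon
      have up : ∀ y ∈ C, y / 4 = j → (y+1)/4 = j → y + 1 ∈ C := by
        intro y hy e1 e2
        by_contra hn
        exact hcon y (Or.inr (Finset.mem_filter.2 ⟨hy, hn⟩)) e1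
      have dn : ∀ y ∈ C, y / 4 = j → (y-1)/4 = j → y - 1 ∈ C := by
        intro y hy e1 e2
        by_contra hn
        exact hcon y (Or.inl (Finset.mem_filter.2 ⟨hy, hn⟩)) e1
      have upn : ∀ n : ℕ, (c + n) / 4 = j → c + n ∈ C := by
        intro n
        induction n with
        | zero => intro _; simpa using hc
        | succ n ih =>
          intro e
          have e' : (c + n) / 4 = j := by push_cast at e; omega
          have := up _ (ih e') e' (by push_cast at e; rwa [add_assoc])
          push_cast; rwa [← add_assoc]
      have dnn : ∀ n : ℕ, (c - n) / 4 = j → c - n ∈ C := by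
        intro n
        induction n with
        | zero => intro _; simpa using hc
        | succ n ih =>
          intro e
          have e' : (c - n) / 4 = j := by push_cast at e; omega
          have := dn _ (ih e') e' (by push_cast at e; rwa [sub_sub])
          push_cast; rwa [← sub_sub]
      rcases le_total c x with hcx | hcx
      · have := upn (x - c).toNat (by rw [show c + ((x - c).toNat : ℤ) = x by omega]; exact hx)
        rw [show c + ((x - c).toNat : ℤ) = x by omega] at this
        exact hxC this
      · have := dnn (c - x).toNat (by rw [show c - ((c - x).toNat : ℤ) = x by omega]; exact hx)
        rw [show c - ((c - x).toNat : ℤ) = x by omega] at this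
        exact hxC this
    have := Finset.card_le_card hsub
    have h3 := Finset.card_image_le (s := starts C ∪ ends C) (f := fun i => i / 4)
    have h4 := Finset.card_union_le (starts C) (ends C)
    rw [card_ends] at h4
    omega
  have h3 := Finset.card_filter_add_card_filter_not (s := D) (fun j => ∀ x, x / 4 = j → x ∈ C)
  have : full.card = (D.filter (fun j => ∀ x, x / 4 = j → x ∈ C)).card := rfl
  omega

lemma cov_succ (B : Finset ℤ) (k : ℕ) : cov B (k+1) = (cov B k).image (fun i => i / 4) := by
  unfold cov
  rw [Finset.image_image]
  congr 1
  ext i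
  simp only [Function.comp]
  rw [pow_succ, Int.ediv_ediv_of_nonneg (by positivity)]

lemma card_walls_le {α : ℝ} (h : α < 1) {B : Finset ℤ} {m : ℕ} (hm : qq α B ≤ m) :
    (walls B).card ≤ m := by
  have : ((walls B).card : ENNReal) ≤ m := by
    refine le_trans ?_ ((En_le_qq h B).trans (by exact_mod_cast hm))
    calc ((walls B).card : ENNReal) = ∑ i ∈ walls B, 1 := by simp
      _ ≤ ∑ i ∈ walls B, fE (kern α) B i := by
          apply Finset.sum_le_sum; intro i hi
          have hw := mem_walls.1 hi
          refine le_trans ?_ (ENNReal.le_tsum (i + 1))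
          have e : (i - (i + 1)).natAbs = 1 := by omega
          rw [e, kern_one, if_pos (show Sep B i (i + 1) from hw)]
      _ ≤ _ := ENNReal.sum_le_tsum _
  exact_mod_cast this

lemma cov_card {α : ℝ} (h0 : 1 / 2 < α) (h : α < 1) {M : ℕ} {CE : ℕ}
    (hCE : 2 * (M : ENNReal) * (1 + 4 * kS α) ≤ CE) (hCE3 : 3 ≤ CE) (hM : 1 ≤ M)
    {B : Finset ℤ} (hB : Indec α M B) {m : ℕ} (hm : qq α B ≤ m) (k : ℕ) :
    (cov B k).card * 2 ^ k ≤ 8 * CE * (m + 2 ^ k) := by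
  have hc0 : (cov B 0).card ≤ m := Finset.card_image_le.trans (card_walls_le h hm)
  have hmono : ∀ k, (cov B (k+1)).card ≤ (cov B k).card := fun k => by
    rw [cov_succ]; exact Finset.card_image_le
  rcases k with _ | k
  · simp; nlinarith
  induction k with
  | zero =>
    have := hmono 0
    simp; nlinarith
  | succ k ih =>
    have h1 := card_div_four (cov B (k+1))
    rw [← cov_succ] at h1
    have h2 := starts_bound h0 h hCE hCE3 hM hB hm (k := k + 1) (by omega)
    have h3 : (starts (cov B (k+1))).card * 2 ^ (k+1) ≤ 2 ^ (k+1) + CE * m := by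
      rcases h2 with h2 | h2
      · nlinarith [Nat.zero_le (CE * m), Nat.one_le_two_pow (n := k+1)]
      · exact h2.trans (Nat.le_add_left _ _)
    have h4 : (2:ℕ) ^ (k+1+1) = 2 * 2 ^ (k+1) := by ring
    rw [h4]
    generalize (2:ℕ) ^ (k+1) = p at *
    generalize (cov B (k+1)).card = c at *
    generalize (cov B (k+1+1)).card = c' at *
    generalize (starts (cov B (k+1))).card = s at *
    have h5 : 4 * c' * p ≤ c * p + 8 * (s * p) := by nlinarith
    have h6 : 4 * c' * p ≤ 8 * CE * (m + p) + 8 * (p + CE * m) := by omega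
    have h7 : 8 * p ≤ CE * p * 8 := by nlinarith
    nlinarith

end RF

namespace RF

lemma exists_start {C : Finset ℤ} {y z : ℤ} (hy : y ∈ C) (hz : z ∉ C) (hzy : z < y) :
    ∃ a ∈ starts C, z < a ∧ a ≤ y := by
  have hne : (C.filter (fun t => z < t)).Nonempty := ⟨y, by simp [hy, hzy]⟩
  set a := (C.filter (fun t => z < t)).min' hne with ha
  have h1 := Finset.min'_mem _ hne
  rw [← ha, Finset.mem_filter] at h1
  refine ⟨a, Finset.mem_filter.2 ⟨h1.1, fun hc => ?_⟩, h1.2, Finset.min'_le _ _ (by simp [hy, hzy])⟩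
  by_cases e : a - 1 = z
  · exact hz (e ▸ hc)
  · have := Finset.min'_le (C.filter (fun t => z < t)) (a - 1) (by
      rw [Finset.mem_filter]; exact ⟨hc, by have := h1.2; omega⟩)
    rw [← ha] at this; omega

lemma exists_start_le {C : Finset ℤ} {y : ℤ} (hy : y ∈ C) : ∃ a ∈ starts C, a ≤ y := by
  have hne : C.Nonempty := ⟨y, hy⟩
  obtain ⟨a, h1, _, h3⟩ := exists_start (z := C.min' hne - 1) hy (fun hc => by
    have := Finset.min'_le C _ hc; omega) (by have := Finset.min'_le C _ hy; omega)
  exact ⟨a, h1, h3⟩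

lemma interval_of_one_start {C : Finset ℤ} (hs : (starts C).card ≤ 1) {x y : ℤ} (hx : x ∈ C)
    (hy : y ∈ C) : Finset.Icc x y ⊆ C := by
  intro z hz
  rw [Finset.mem_Icc] at hz
  by_contra hc
  have hxz : x ≠ z := fun e => hc (e ▸ hx)
  have hyz : y ≠ z := fun e => hc (e ▸ hy)
  obtain ⟨a, ha, ha2⟩ := exists_start_le hx
  obtain ⟨b, hb, hb2, hb3⟩ := exists_start hy hc (by omega)
  have := Finset.card_le_one.1 hs a ha b hb
  omega

lemma cov_location {B : Finset ℤ} (h0 : (0:ℤ) ∈ B) {K : ℕ} (hs : (starts (cov B K)).card ≤ 1) :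
    cov B K ⊆ Finset.Icc (-((cov B K).card : ℤ)) (cov B K).card := by
  have hR : (0 : ℤ) < 4 ^ K := by positivity
  obtain ⟨i, i1, _, i3⟩ := exists_wall_right h0
  obtain ⟨j, _, j2, j3⟩ := exists_wall_left h0
  have hi : i / (4:ℤ) ^ K ∈ cov B K := mem_cov.2 ⟨i, i3, rfl⟩
  have hj : j / (4:ℤ) ^ K ∈ cov B K := mem_cov.2 ⟨j, j3, rfl⟩
  have hi0 : 0 ≤ i / (4:ℤ) ^ K := Int.ediv_nonneg i1 hR.le
  have hj0 : j / (4:ℤ) ^ K < 0 := Int.ediv_lt_of_lt_mul hR (by simpa using j2)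
  intro c hc
  have h1 := Finset.card_le_card (interval_of_one_start hs hj hc)
  have h2 := Finset.card_le_card (interval_of_one_start hs hc hi)
  rw [Int.card_Icc] at h1 h2
  rw [Finset.mem_Icc]
  omega

/-- One step of the multiscale counting. -/
lemma count_step (𝓑 : Finset (Finset ℤ)) (k c : ℕ) (hc : ∀ B ∈ 𝓑, (cov B (k+1)).card ≤ c) :
    (𝓑.image (fun B => cov B k)).card ≤ 16 ^ c * (𝓑.image (fun B => cov B (k+1))).card := by
  have himg : (𝓑.image (fun B => cov B k)).image (fun C => C.image (fun i => i / 4)) =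
      𝓑.image (fun B => cov B (k+1)) := by
    rw [Finset.image_image]
    apply Finset.image_congr
    intro B _
    exact (cov_succ B k).symm
  rw [← himg]
  apply Finset.card_le_mul_card_image
  intro C' hC'
  have hC'c : C'.card ≤ c := by
    rw [himg, Finset.mem_image] at hC'
    obtain ⟨B, hB, rfl⟩ := hC'
    exact hc B hB
  have hsub : (𝓑.image (fun B => cov B k)).filter (fun C => C.image (fun i => i / 4) = C') ⊆
      (C'.biUnion (fun j => Finset.Ico (4 * j) (4 * j + 4))).powerset := by
    intro C hC
    rw [Finset.mem_powerset]
    intro x hx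
    have := (Finset.mem_filter.1 hC).2
    rw [Finset.mem_biUnion]
    refine ⟨x / 4, this ▸ Finset.mem_image_of_mem _ hx, ?_⟩
    rw [Finset.mem_Ico]; omega
  refine (Finset.card_le_card hsub).trans ?_
  rw [Finset.card_powerset]
  have : (C'.biUnion (fun j => Finset.Ico (4 * j) (4 * j + 4))).card ≤ C'.card * 4 :=
    Finset.card_biUnion_le_card_mul _ _ _ (by intro j _; simp)
  calc 2 ^ (C'.biUnion (fun j => Finset.Ico (4 * j) (4 * j + 4))).card ≤ 2 ^ (4 * c) :=
        Nat.pow_le_pow_right (by norm_num) (by omega)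
    _ = 16 ^ c := by rw [pow_mul]; norm_num

lemma sixteen_le : (16 : ℝ) ≤ Real.exp 3 := by
  have : Real.exp 3 = Real.exp 1 ^ 3 := by rw [← Real.exp_nat_mul]; norm_num
  rw [this]
  have h := Real.exp_one_gt_d9
  calc (16:ℝ) ≤ 2.7 ^ 3 := by norm_num
    _ ≤ _ := by gcongr; linarith

lemma cov_count {α : ℝ} (h0 : 1 / 2 < α) (h : α < 1) {M : ℕ} (hM : 1 ≤ M) :
    ∃ Kc C2 C3 : ℕ, 1 ≤ Kc ∧ ∀ m : ℕ, 1 ≤ m → ∀ 𝓑 : Finset (Finset ℤ),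
      (∀ B ∈ 𝓑, Indec α M B ∧ (0:ℤ) ∈ B ∧ qq α B ≤ m) → ∀ k ≤ Kc + Nat.clog 2 m,
      (∀ B ∈ 𝓑, (cov B k).card ≤ C2 * m / 2 ^ k) ∧
      ((𝓑.image (fun B => cov B k)).card : ℝ) ≤ Real.exp (C3 * m / 2 ^ k) := by
  obtain ⟨CE0, hCE0⟩ := ENNReal.exists_nat_gt (r := 2 * (M : ENNReal) * (1 + 4 * kS α)) (by
    have := kS_ne_top h
    exact ENNReal.mul_ne_top (ENNReal.mul_ne_top (by simp) (by simp))
      (ENNReal.add_ne_top.2 ⟨by simp, ENNReal.mul_ne_top (by simp) this⟩))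
  set CE := CE0 + 3 with hCEdef
  have hCE : 2 * (M : ENNReal) * (1 + 4 * kS α) ≤ CE := by
    refine hCE0.le.trans ?_
    exact_mod_cast Nat.le_add_right _ _
  have hCE3 : 3 ≤ CE := by omega
  obtain ⟨Kc, hKc⟩ : ∃ Kc : ℕ, Kc = CE := ⟨_, rfl⟩
  set C2 := 8 * CE * (1 + 2 ^ (Kc + 1)) with hC2
  set C3 := 3 * C2 + (32 * CE + 1) * 2 ^ (Kc + 1) with hC3
  refine ⟨Kc, C2, C3, by omega, ?_⟩
  intro m hm 𝓑 h𝓑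
  set K := Kc + Nat.clog 2 m with hK
  have hKl : CE * m < 2 ^ K := by
    rw [hK, pow_add]
    have h1 := Nat.le_pow_clog (b := 2) (by norm_num) m
    have h2 : CE < 2 ^ Kc := hKc ▸ Nat.lt_two_pow_self
    calc CE * m < 2 ^ Kc * m := by nlinarith
      _ ≤ _ := by gcongr
  have hKu : 2 ^ K ≤ 2 ^ (Kc + 1) * m := by
    rw [hK, pow_add, pow_succ, mul_assoc]
    refine Nat.mul_le_mul_left _ ?_
    rcases Nat.lt_or_ge 1 m with h1 | h1
    · have h2 := Nat.pow_pred_clog_lt_self (b := 2) (by norm_num) h1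
      have h3 : 1 ≤ Nat.clog 2 m := Nat.clog_pos (by norm_num) h1
      have : 2 ^ Nat.clog 2 m = 2 * 2 ^ (Nat.clog 2 m).pred := by
        rw [← pow_succ']; congr 1; simp; omega
      omega
    · have : m = 1 := by omega
      subst this; simp
  have hku : ∀ k ≤ K, 2 ^ k ≤ 2 ^ (Kc + 1) * m := fun k hk =>
    (Nat.pow_le_pow_right (by norm_num) hk).trans hKu
  have hcard : ∀ k ≤ K, ∀ B ∈ 𝓑, (cov B k).card ≤ C2 * m / 2 ^ k := by
    intro k hk B hB
    rw [Nat.le_div_iff_mul_le (by positivity)]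
    have h1 := cov_card h0 h hCE hCE3 hM (h𝓑 B hB).1 (h𝓑 B hB).2.2 k
    refine h1.trans ?_
    have := hku k hk
    rw [hC2]
    calc 8 * CE * (m + 2 ^ k) ≤ 8 * CE * (m + 2 ^ (Kc + 1) * m) := by gcongr
      _ = _ := by ring
  have hmr : (1 : ℝ) ≤ m := by exact_mod_cast hm
  have hcount : ∀ n k, k + n = K →
      ((𝓑.image (fun B => cov B k)).card : ℝ) ≤ Real.exp (C3 * m / 2 ^ k) := by
    intro n
    induction n with
    | zero =>
      intro k hk
      have hkK : k = K := by omega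
      subst hkK
      have hsub : 𝓑.image (fun B => cov B K) ⊆
          (Finset.Icc (-((16 * CE : ℕ) : ℤ)) ((16 * CE : ℕ) : ℤ)).powerset := by
        intro C hC
        obtain ⟨B, hB, rfl⟩ := Finset.mem_image.1 hC
        have hs : (starts (cov B K)).card ≤ 1 := by
          rcases starts_bound h0 h hCE hCE3 hM (h𝓑 B hB).1 (h𝓑 B hB).2.2 (k := K) (by omega) with hh | hh
          · exact hh
          · have : (starts (cov B K)).card * 2 ^ K < 1 * 2 ^ K := by omega
            have := lt_of_mul_lt_mul_right this (by positivity)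
            omega
        have hc : (cov B K).card ≤ 16 * CE := by
          have h1 := cov_card h0 h hCE hCE3 hM (h𝓑 B hB).1 (h𝓑 B hB).2.2 K
          have h2 : (cov B K).card * 2 ^ K ≤ 16 * CE * 2 ^ K := by
            have : m ≤ 2 ^ K := by nlinarith
            calc _ ≤ _ := h1
              _ ≤ 8 * CE * (2 ^ K + 2 ^ K) := by gcongr
              _ = _ := by ring
          exact Nat.le_of_mul_le_mul_right h2 (by positivity)
        rw [Finset.mem_powerset]
        refine (cov_location (h𝓑 B hB).2.1 hs).trans ?_
        apply Finset.Icc_subset_Icc <;> omega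
      have h1 := Finset.card_le_card hsub
      rw [Finset.card_powerset, Int.card_Icc,
        show (((16 * CE : ℕ) : ℤ) + 1 - -((16 * CE : ℕ) : ℤ)).toNat = 32 * CE + 1 by omega] at h1
      have h2 : ((𝓑.image (fun B => cov B K)).card : ℝ) ≤ 2 ^ (32 * CE + 1) := by exact_mod_cast h1
      refine h2.trans ?_
      have h3 : (2 : ℝ) ^ (32 * CE + 1) ≤ Real.exp ((32 * CE + 1 : ℕ)) := by
        rw [← Real.exp_one_pow]
        gcongr
        have := Real.exp_one_gt_d9; linarith
      refine h3.trans (Real.exp_le_exp.2 ?_)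
      rw [le_div_iff₀ (by positivity)]
      have : (32 * CE + 1) * 2 ^ K ≤ C3 * m := by
        calc (32 * CE + 1) * 2 ^ K ≤ (32 * CE + 1) * (2 ^ (Kc + 1) * m) := by gcongr
          _ = ((32 * CE + 1) * 2 ^ (Kc + 1)) * m := by ring
          _ ≤ C3 * m := by gcongr; omega
      exact_mod_cast this
    | succ n ih =>
      intro k hk
      have ih' := ih (k+1) (by omega)
      have h1 := count_step 𝓑 k (C2 * m / 2 ^ (k+1)) (hcard (k+1) (by omega))
      have h2 : ((𝓑.image (fun B => cov B k)).card : ℝ) ≤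
          16 ^ (C2 * m / 2 ^ (k+1)) * ((𝓑.image (fun B => cov B (k+1))).card : ℝ) := by
        exact_mod_cast h1
      refine h2.trans ?_
      have h3 : (16 : ℝ) ^ (C2 * m / 2 ^ (k+1)) ≤ Real.exp (3 * C2 * m / 2 ^ (k+1)) := by
        calc (16 : ℝ) ^ (C2 * m / 2 ^ (k+1)) ≤ (Real.exp 3) ^ (C2 * m / 2 ^ (k+1)) := by
              gcongr; exact sixteen_le
          _ = Real.exp (((C2 * m / 2 ^ (k+1) : ℕ) : ℝ) * 3) := by rw [← Real.exp_nat_mul]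
          _ ≤ _ := by
              apply Real.exp_le_exp.2
              have := Nat.cast_div_le (α := ℝ) (m := C2 * m) (n := 2 ^ (k+1))
              push_cast at this
              calc _ ≤ (C2 * m / 2 ^ (k+1) : ℝ) * 3 := by gcongr
                _ = _ := by ring
      calc _ ≤ Real.exp (3 * C2 * m / 2 ^ (k+1)) * Real.exp (C3 * m / 2 ^ (k+1)) := by gcongr
        _ = Real.exp ((3 * C2 + C3) * m / 2 ^ (k+1)) := by rw [← Real.exp_add]; ring_nf
        _ ≤ _ := by
          apply Real.exp_le_exp.2
          have : (3 * C2 : ℝ) ≤ C3 := by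
            have : 3 * C2 ≤ C3 := by omega
            exact_mod_cast this
          have e : (C3 * m / 2 ^ k : ℝ) = (2 * C3) * m / 2 ^ (k+1) := by
            rw [pow_succ]; field_simp
          rw [e]
          gcongr; linarith
  exact fun k hk => ⟨hcard k hk, hcount (K - k) k (by omega)⟩

end RF

namespace RF

def cell (k : ℕ) (j : ℤ) : Finset ℤ := Finset.Ico (j * 4 ^ k) ((j + 1) * 4 ^ k)

lemma mem_cell {k : ℕ} {j x : ℤ} : x ∈ cell k j ↔ x / (4:ℤ) ^ k = j := by
  rw [cell, Finset.mem_Ico, div_eq_iff' (by positivity)]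

lemma card_cell (k : ℕ) (j : ℤ) : (cell k j).card = 4 ^ k := by
  rw [cell, Int.card_Ico]
  rw [show (j + 1) * (4:ℤ) ^ k - j * 4 ^ k = ((4 ^ k : ℕ) : ℤ) by push_cast; ring]
  exact Int.toNat_natCast _

def cgI (B : Finset ℤ) (k : ℕ) : Finset ℤ :=
  (B.image (fun x => x / (4:ℤ) ^ k)).filter
    (fun j => 4 ^ k < 2 * ((cell k j).filter (fun x => x ∈ B)).card)

lemma mem_cgI {B : Finset ℤ} {k : ℕ} {j : ℤ} :
    j ∈ cgI B k ↔ 4 ^ k < 2 * ((cell k j).filter (fun x => x ∈ B)).card := by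
  unfold cgI
  rw [Finset.mem_filter]
  constructor
  · exact fun h => h.2
  · intro h
    refine ⟨?_, h⟩
    have : 0 < ((cell k j).filter (fun x => x ∈ B)).card := by
      have : 0 < 4 ^ k := by positivity
      omega
    obtain ⟨x, hx⟩ := Finset.card_pos.1 this
    rw [Finset.mem_filter, mem_cell] at hx
    exact Finset.mem_image.2 ⟨x, hx.2, hx.1⟩

lemma walls_inj {I I' : Finset ℤ} (h : walls I = walls I') : I = I' := by
  by_contra hne
  have hs : (symmDiff I I').Nonempty := by
    rw [Finset.nonempty_iff_ne_empty]
    intro he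
    exact hne (symmDiff_eq_bot.1 he)
  obtain ⟨x, hx⟩ := hs
  obtain ⟨i, _, _, hi⟩ := exists_wall_right hx
  rw [wall_sd] at hi
  have h1 : Wall I i ↔ Wall I' i := by rw [← mem_walls, ← mem_walls, h]
  exact hi h1

lemma walls_cgI (B : Finset ℤ) (k : ℕ) :
    walls (cgI B k) ⊆ cov B k ∪ (cov B k).image (fun j => j - 1) := by
  intro j hj
  rw [mem_walls] at hj
  by_contra hc
  simp only [Finset.mem_union, Finset.mem_image, not_or, not_exists, not_and] at hc
  obtain ⟨h1, h2⟩ := hc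
  have h2' : j + 1 ∉ cov B k := fun h => h2 (j+1) h (by ring)
  have hR : (0:ℤ) < 4 ^ k := by positivity
  have hconst : ∀ x, j * 4 ^ k ≤ x → x < (j + 2) * 4 ^ k → (x ∈ B ↔ j * 4 ^ k ∈ B) := by
    intro x hx1 hx2
    have := not_sep_of_no_wall (B := B) hx1 (by
      intro i hi1 hi2 hw
      rcases lt_or_ge i ((j+1) * 4 ^ k) with h3 | h3
      · exact h1 (mem_cov.2 ⟨i, hw, (div_eq_iff' hR).2 ⟨hi1, h3⟩⟩)
      · exact h2' (mem_cov.2 ⟨i, hw, (div_eq_iff' hR).2 ⟨h3, by linarith⟩⟩))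
    unfold Sep at this; tauto
  have hcell : ∀ j', j' = j ∨ j' = j + 1 →
      ((cell k j').filter (fun x => x ∈ B)) = if j * 4 ^ k ∈ B then cell k j' else ∅ := by
    intro j' hj'
    split_ifs with hB
    · apply Finset.filter_true_of_mem
      intro x hx
      rw [cell, Finset.mem_Ico] at hx
      refine (hconst x ?_ ?_).2 hB <;> rcases hj' with rfl | rfl <;> nlinarith
    · apply Finset.filter_false_of_mem
      intro x hx hxB
      rw [cell, Finset.mem_Ico] at hx
      refine hB ((hconst x ?_ ?_).1 hxB) <;> rcases hj' with rfl | rfl <;> nlinarith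
  apply hj
  rw [mem_cgI, mem_cgI, hcell j (Or.inl rfl), hcell (j+1) (Or.inr rfl)]
  split_ifs <;> simp [card_cell]

lemma count_cgI (𝓑 : Finset (Finset ℤ)) (k c : ℕ) (hc : ∀ B ∈ 𝓑, (cov B k).card ≤ c) :
    (𝓑.image (fun B => cgI B k)).card ≤ 4 ^ c * (𝓑.image (fun B => cov B k)).card := by
  have h1 : (𝓑.image (fun B => cgI B k)).card = ((𝓑.image (fun B => cgI B k)).image walls).card :=
    (Finset.card_image_of_injective _ (fun I I' h => walls_inj h)).symm
  rw [h1]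
  have hsub : (𝓑.image (fun B => cgI B k)).image walls ⊆
      (𝓑.image (fun B => cov B k)).biUnion (fun C => (C ∪ C.image (fun j => j - 1)).powerset) := by
    intro W hW
    rw [Finset.image_image] at hW
    obtain ⟨B, hB, rfl⟩ := Finset.mem_image.1 hW
    rw [Finset.mem_biUnion]
    exact ⟨cov B k, Finset.mem_image_of_mem _ hB, Finset.mem_powerset.2 (walls_cgI B k)⟩
  refine (Finset.card_le_card hsub).trans ?_
  rw [mul_comm]
  apply Finset.card_biUnion_le_card_mul
  intro C hC
  obtain ⟨B, hB, rfl⟩ := Finset.mem_image.1 hC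
  rw [Finset.card_powerset]
  have h3 := Finset.card_union_le (cov B k) ((cov B k).image (fun j => j - 1))
  have h4 := Finset.card_image_le (s := cov B k) (f := fun j => j - 1)
  have h5 := hc B hB
  calc _ ≤ 2 ^ (2 * c) := Nat.pow_le_pow_right (by norm_num) (by omega)
    _ = 4 ^ c := by rw [pow_mul]; norm_num

/-- Coarse grained approximation inside `Λ`. -/
def crs (Λ B : Finset ℤ) (k : ℕ) : Finset ℤ := Λ.filter (fun x => x / (4:ℤ) ^ k ∈ cgI B k)

lemma crs_subset (Λ B : Finset ℤ) (k : ℕ) : crs Λ B k ⊆ Λ := Finset.filter_subset _ _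

lemma crs_zero {Λ B : Finset ℤ} (hB : B ⊆ Λ) : crs Λ B 0 = B := by
  ext x
  unfold crs
  rw [Finset.mem_filter, mem_cgI]
  have hc : cell 0 (x / (4:ℤ) ^ 0) = {x} := by
    ext y; rw [mem_cell]; simp
  rw [hc, Finset.filter_singleton]
  by_cases hx : x ∈ B
  · simp [hx, hB hx]
  · simp [hx]

lemma crs_top {Λ B : Finset ℤ} {k : ℕ} (hk : 2 * B.card ≤ 4 ^ k) : crs Λ B k = ∅ := by
  apply Finset.filter_false_of_mem
  intro x _ hx
  rw [mem_cgI] at hx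
  have : ((cell k (x / (4:ℤ) ^ k)).filter (fun x => x ∈ B)).card ≤ B.card := by
    apply Finset.card_le_card
    intro y hy; exact (Finset.mem_filter.1 hy).2
  omega

lemma crs_approx {α : ℝ} (h : α < 1) {Λ B : Finset ℤ} (hB : B ⊆ Λ) {m : ℕ} (hm : qq α B ≤ m) (k : ℕ) :
    ((symmDiff B (crs Λ B k)).card : ℝ) ≤ 2 * m * ((4:ℝ) ^ k) ^ (1 - α) := by
  have hE : En (kern α) B ≤ m := (En_le_qq h B).trans (by exact_mod_cast hm)
  have hx : ∀ x ∈ symmDiff B (crs Λ B k),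
      ENNReal.ofReal (((4:ℝ) ^ k) ^ (α - 1) / 2) ≤ fE (kern α) B x := by
    intro x hx
    set Q := cell k (x / (4:ℤ) ^ k) with hQ
    have hxQ : x ∈ Q := mem_cell.2 rfl
    have hcnt := Finset.card_filter_add_card_filter_not (s := Q) (fun y => y ∈ B)
    rw [hQ, card_cell, ← hQ] at hcnt
    have hT : 4 ^ k ≤ 2 * (Q.filter (fun y => Sep B x y)).card := by
      by_cases hxB : x ∈ B
      · have hnc : x ∉ crs Λ B k := by rw [Finset.mem_symmDiff] at hx; tauto
        have hnI : x / (4:ℤ) ^ k ∉ cgI B k := fun hc => hnc (Finset.mem_filter.2 ⟨hB hxB, hc⟩)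
        rw [mem_cgI, ← hQ] at hnI
        have : Q.filter (fun y => Sep B x y) = Q.filter (fun y => y ∉ B) := by
          apply Finset.filter_congr; intro y _; unfold Sep; tauto
        rw [this]; omega
      · have hnc : x ∈ crs Λ B k := by rw [Finset.mem_symmDiff] at hx; tauto
        have hnI : x / (4:ℤ) ^ k ∈ cgI B k := (Finset.mem_filter.1 hnc).2
        rw [mem_cgI, ← hQ] at hnI
        have : Q.filter (fun y => Sep B x y) = Q.filter (fun y => y ∈ B) := by
          apply Finset.filter_congr; intro y _; unfold Sep; tauto
        rw [this]; omega
    refine le_trans ?_ (sum_le_fE (kern α) B x (Q.filter (fun y => Sep B x y))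
      (fun y hy => (Finset.mem_filter.1 hy).2))
    calc ENNReal.ofReal (((4:ℝ) ^ k) ^ (α - 1) / 2)
        ≤ ENNReal.ofReal ((Q.filter (fun y => Sep B x y)).card * ((4 ^ k : ℕ) : ℝ) ^ (α - 2)) := by
          apply ENNReal.ofReal_le_ofReal
          push_cast
          have hp : (0:ℝ) < 4 ^ k := by positivity
          have e : ((4:ℝ) ^ k) ^ (α - 1) = 4 ^ k * ((4:ℝ) ^ k) ^ (α - 2) := by
            rw [show α - 1 = 1 + (α - 2) by ring, Real.rpow_add hp, Real.rpow_one]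
          rw [e]
          have hT' : ((4:ℝ) ^ k) ≤ 2 * ((Q.filter (fun y => Sep B x y)).card : ℝ) := by
            exact_mod_cast hT
          have : 0 ≤ ((4:ℝ) ^ k) ^ (α - 2) := by positivity
          nlinarith
      _ = ∑ y ∈ Q.filter (fun y => Sep B x y), kern α (4 ^ k) := by
          rw [Finset.sum_const, nsmul_eq_mul, ENNReal.ofReal_mul (by positivity), ENNReal.ofReal_natCast]
          rfl
      _ ≤ _ := by
          apply Finset.sum_le_sum; intro y hy
          obtain ⟨hyQ, hs⟩ := Finset.mem_filter.1 hy
          have hne := hs.ne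
          rw [hQ, cell, Finset.mem_Ico] at hyQ hxQ
          apply kern_anti h
          · omega
          · zify
            rw [abs_le]; constructor <;> nlinarith
  have hsum : ENNReal.ofReal ((symmDiff B (crs Λ B k)).card * (((4:ℝ) ^ k) ^ (α - 1) / 2)) ≤ m := by
    calc _ = ∑ x ∈ symmDiff B (crs Λ B k), ENNReal.ofReal (((4:ℝ) ^ k) ^ (α - 1) / 2) := by
          rw [Finset.sum_const, nsmul_eq_mul, ENNReal.ofReal_mul (by positivity), ENNReal.ofReal_natCast]
      _ ≤ ∑ x ∈ symmDiff B (crs Λ B k), fE (kern α) B x := Finset.sum_le_sum hx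
      _ ≤ En (kern α) B := ENNReal.sum_le_tsum _
      _ ≤ _ := hE
  rw [← ENNReal.ofReal_natCast, ENNReal.ofReal_le_ofReal_iff (by positivity)] at hsum
  have hp : (0:ℝ) < 4 ^ k := by positivity
  have e : ((4:ℝ) ^ k) ^ (α - 1) * ((4:ℝ) ^ k) ^ (1 - α) = 1 := by
    rw [← Real.rpow_add hp]; simp
  have hq : 0 < ((4:ℝ) ^ k) ^ (1 - α) := by positivity
  calc ((symmDiff B (crs Λ B k)).card : ℝ)
      = 2 * ((symmDiff B (crs Λ B k)).card * (((4:ℝ) ^ k) ^ (α - 1) / 2)) * ((4:ℝ) ^ k) ^ (1 - α) := by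
        rw [show ∀ a b c : ℝ, 2 * (a * (b / 2)) * c = a * (b * c) by intros; ring, e, mul_one]
    _ ≤ 2 * m * ((4:ℝ) ^ k) ^ (1 - α) := by gcongr

/-- Two consecutive approximations. -/
lemma crs_step {α : ℝ} (h0 : 0 < α) (h : α < 1) {Λ B : Finset ℤ} (hB : B ⊆ Λ) {m : ℕ} (hm : qq α B ≤ m) (k : ℕ) :
    ((symmDiff (crs Λ B k) (crs Λ B (k+1))).card : ℝ) ≤ 16 * m * ((4:ℝ) ^ k) ^ (1 - α) := by
  have h1 := crs_approx h hB hm k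
  have h2 := crs_approx h hB hm (k+1)
  have h3 : (symmDiff (crs Λ B k) (crs Λ B (k+1))).card ≤
      (symmDiff B (crs Λ B k)).card + (symmDiff B (crs Λ B (k+1))).card := by
    refine le_trans (Finset.card_le_card ?_) (Finset.card_union_le _ _)
    intro x hx
    rw [Finset.mem_union, Finset.mem_symmDiff, Finset.mem_symmDiff]
    rw [Finset.mem_symmDiff] at hx
    by_cases hxB : x ∈ B
    · rcases hx with ⟨_, b⟩ | ⟨_, b⟩
      · exact Or.inr (Or.inl ⟨hxB, b⟩)
      · exact Or.inl (Or.inl ⟨hxB, b⟩)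
    · rcases hx with ⟨a, _⟩ | ⟨a, _⟩
      · exact Or.inl (Or.inr ⟨a, hxB⟩)
      · exact Or.inr (Or.inr ⟨a, hxB⟩)
  have h3' : ((symmDiff (crs Λ B k) (crs Λ B (k+1))).card : ℝ) ≤
      (symmDiff B (crs Λ B k)).card + (symmDiff B (crs Λ B (k+1))).card := by exact_mod_cast h3
  have h4 : ((4:ℝ) ^ (k+1)) ^ (1 - α) ≤ 4 ^ (1:ℝ) * ((4:ℝ) ^ k) ^ (1 - α) ∨ α < 0 := by
    by_cases ha : α < 0
    · exact Or.inr ha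
    · left
      rw [pow_succ, mul_comm, Real.mul_rpow (by norm_num) (by positivity)]
      gcongr
      · norm_num
      · linarith
  rcases h4 with h4 | h4
  · rw [Real.rpow_one] at h4
    have hm0 : (0:ℝ) ≤ m := by positivity
    have : 2 * (m:ℝ) * ((4:ℝ) ^ (k+1)) ^ (1 - α) ≤ 2 * m * (4 * ((4:ℝ) ^ k) ^ (1 - α)) := by gcongr
    have hp : 0 ≤ m * ((4:ℝ) ^ k) ^ (1 - α) := by positivity
    nlinarith
  · linarith

lemma entropy {α : ℝ} (h0 : 1 / 2 < α) (h : α < 1) {M : ℕ} (hM : 1 ≤ M) :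
    ∃ Kc C3 : ℕ, 1 ≤ Kc ∧ ∀ m : ℕ, 1 ≤ m → ∀ Λ : Finset ℤ, ∀ 𝓑 : Finset (Finset ℤ),
      (∀ B ∈ 𝓑, Indec α M B ∧ (0:ℤ) ∈ B ∧ qq α B ≤ m) → ∀ k ≤ Kc + Nat.clog 2 m,
      ((𝓑.image (fun B => crs Λ B k)).card : ℝ) ≤ Real.exp (C3 * m / 2 ^ k) := by
  obtain ⟨Kc, C2, C3, h1, h2⟩ := cov_count h0 h hM
  refine ⟨Kc, C3 + 3 * C2, h1, ?_⟩
  intro m hm Λ 𝓑 h𝓑 k hk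
  obtain ⟨hc, hn⟩ := h2 m hm 𝓑 h𝓑 k hk
  have h3 := count_cgI 𝓑 k _ hc
  have h4 : (𝓑.image (fun B => crs Λ B k)).card ≤ (𝓑.image (fun B => cgI B k)).card := by
    have : 𝓑.image (fun B => crs Λ B k) = (𝓑.image (fun B => cgI B k)).image
        (fun I => Λ.filter (fun x => x / (4:ℤ) ^ k ∈ I)) := by
      rw [Finset.image_image]; rfl
    rw [this]; exact Finset.card_image_le
  have h5 : ((𝓑.image (fun B => crs Λ B k)).card : ℝ) ≤
      4 ^ (C2 * m / 2 ^ k) * ((𝓑.image (fun B => cov B k)).card : ℝ) := by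
    exact_mod_cast h4.trans h3
  have h6 : (4 : ℝ) ^ (C2 * m / 2 ^ k) ≤ Real.exp (3 * C2 * m / 2 ^ k) := by
    calc (4 : ℝ) ^ (C2 * m / 2 ^ k) ≤ (Real.exp 3) ^ (C2 * m / 2 ^ k) := by
          gcongr; linarith [sixteen_le]
      _ = Real.exp (((C2 * m / 2 ^ k : ℕ) : ℝ) * 3) := by rw [← Real.exp_nat_mul]
      _ ≤ _ := by
          apply Real.exp_le_exp.2
          have := Nat.cast_div_le (α := ℝ) (m := C2 * m) (n := 2 ^ k)
          push_cast at this
          calc _ ≤ (C2 * m / 2 ^ k : ℝ) * 3 := by gcongr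
            _ = _ := by ring
  calc _ ≤ _ := h5
    _ ≤ Real.exp (3 * C2 * m / 2 ^ k) * Real.exp (C3 * m / 2 ^ k) := by gcongr
    _ = _ := by rw [← Real.exp_add]; push_cast; ring_nf

end RF

namespace RF

lemma hoeff_aux (V : Finset ℤ) (c : ℝ) (hc : 0 ≤ c) : ∀ φ : Finset ℤ → ℝ,
    (∀ U x, |φ (insert x U) - φ U| ≤ c) →
    ∑ U ∈ V.powerset, Real.exp (φ U) ≤
      2 ^ V.card * Real.exp ((∑ U ∈ V.powerset, φ U) / 2 ^ V.card + V.card * c ^ 2 / 8) := by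
  induction V using Finset.induction_on with
  | empty => intro φ _; simp
  | insert a V ha ih =>
    intro φ hφ
    have key : ∀ x y : ℝ, |y - x| ≤ c →
        Real.exp x + Real.exp y ≤ 2 * Real.exp (c ^ 2 / 8) * Real.exp ((x + y) / 2) := by
      intro x y hxy
      have h1 := Real.cosh_le_exp_half_sq ((y - x) / 2)
      have h2 : Real.exp x + Real.exp y = 2 * Real.cosh ((y - x) / 2) * Real.exp ((x + y) / 2) := by
        rw [Real.cosh_eq]
        rw [show 2 * ((Real.exp ((y - x) / 2) + Real.exp (-((y - x) / 2))) / 2) * Real.exp ((x + y) / 2)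
          = Real.exp ((y - x) / 2) * Real.exp ((x + y) / 2)
            + Real.exp (-((y - x) / 2)) * Real.exp ((x + y) / 2) by ring, ← Real.exp_add, ← Real.exp_add]
        rw [show (y - x) / 2 + (x + y) / 2 = y by ring, show -((y - x) / 2) + (x + y) / 2 = x by ring,
          add_comm]
      rw [h2]
      have h3 : ((y - x) / 2) ^ 2 / 2 ≤ c ^ 2 / 8 := by
        have := sq_le_sq' (by linarith [abs_le.1 hxy]) (abs_le.1 hxy).2
        nlinarith
      have h4 := h1.trans (Real.exp_le_exp.2 h3)
      gcongr
    have h5 := ih (fun U => (φ U + φ (insert a U)) / 2) (by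
      intro U x
      have e1 := abs_le.1 (hφ U x)
      have e2 := abs_le.1 (hφ (insert a U) x)
      rw [Finset.insert_comm] at e2
      rw [abs_le]; constructor <;> linarith [e1.1, e1.2, e2.1, e2.2])
    rw [Finset.sum_powerset_insert ha, Finset.sum_powerset_insert ha, Finset.card_insert_of_notMem ha,
      ← Finset.sum_add_distrib, ← Finset.sum_add_distrib]
    calc ∑ U ∈ V.powerset, (Real.exp (φ U) + Real.exp (φ (insert a U)))
        ≤ ∑ U ∈ V.powerset, 2 * Real.exp (c ^ 2 / 8) * Real.exp ((φ U + φ (insert a U)) / 2) :=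
          Finset.sum_le_sum (fun U _ => key _ _ (hφ U a))
      _ = 2 * Real.exp (c ^ 2 / 8) * ∑ U ∈ V.powerset, Real.exp ((φ U + φ (insert a U)) / 2) := by
          rw [Finset.mul_sum]
      _ ≤ 2 * Real.exp (c ^ 2 / 8) * _ := mul_le_mul_of_nonneg_left h5 (by positivity)
      _ = _ := by
          rw [show ∀ a b c : ℝ, 2 * a * (b * c) = (b * 2) * (a * c) by intros; ring, ← pow_succ,
            ← Real.exp_add]
          congr 2
          rw [← Finset.sum_div, pow_succ]
          push_cast
          field_simp
          ring

lemma sum_shift (Λ U : Finset ℤ) (hU : U ⊆ Λ) (f : Finset ℤ → ℝ) :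
    ∑ S ∈ Λ.powerset, f (symmDiff S U) = ∑ S ∈ Λ.powerset, f S := by
  have hmem : ∀ S ∈ Λ.powerset, symmDiff S U ∈ Λ.powerset := by
    intro S hS
    rw [Finset.mem_powerset] at hS ⊢
    intro x hx
    rw [Finset.mem_symmDiff] at hx
    rcases hx with h | h
    · exact hS h.1
    · exact hU h.1
  exact Finset.sum_nbij' (fun S => symmDiff S U) (fun S => symmDiff S U) hmem hmem
    (fun S _ => symmDiff_symmDiff_cancel_right U S) (fun S _ => symmDiff_symmDiff_cancel_right U S)
    (fun S _ => rfl)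

lemma concentration (Λ V : Finset ℤ) (hV : V ⊆ Λ) (X : Finset ℤ → ℝ) (c : ℝ) (hc : 0 < c)
    (hX : ∀ S x, |X (symmDiff S {x}) - X S| ≤ c) (hanti : ∀ S, X (symmDiff S V) = - X S)
    (t v : ℝ) (ht : 0 < t) (hv : 0 < v) (hVv : (V.card : ℝ) ≤ v) :
    (((Λ.powerset).filter (fun S => t ≤ X S)).card : ℝ) ≤
      2 ^ Λ.card * Real.exp (- (2 * t ^ 2 / (v * c ^ 2))) := by
  obtain ⟨l, hl⟩ : ∃ l : ℝ, l = 4 * t / (v * c ^ 2) := ⟨_, rfl⟩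
  have hl0 : 0 < l := by rw [hl]; positivity
  have hinner : ∀ S, ∑ U ∈ V.powerset, Real.exp (l * X (symmDiff S U)) ≤
      2 ^ V.card * Real.exp (v * (l * c) ^ 2 / 8) := by
    intro S
    have h1 := hoeff_aux V (l * c) (by positivity) (fun U => l * X (symmDiff S U)) (by
      intro U x
      by_cases hx : x ∈ U
      · rw [Finset.insert_eq_of_mem hx]; simp; positivity
      · have : symmDiff S (insert x U) = symmDiff (symmDiff S U) {x} := by
          rw [symmDiff_assoc]; congr 1
          ext y; simp only [Finset.mem_insert, Finset.mem_symmDiff, Finset.mem_singleton]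
          by_cases hy : y = x
          · subst hy; simp [hx]
          · simp [hy]
        rw [this, ← mul_sub, abs_mul, abs_of_pos hl0]
        have := hX (symmDiff S U) x
        gcongr)
    have h0 : ∑ U ∈ V.powerset, l * X (symmDiff S U) = 0 := by
      have e := sum_shift V V (Finset.Subset.refl _) (fun U => l * X (symmDiff S U))
      have e2 : ∀ U, l * X (symmDiff S (symmDiff U V)) = - (l * X (symmDiff S U)) := by
        intro U
        rw [← symmDiff_assoc, hanti]; ring
      simp only [e2] at e
      rw [Finset.sum_neg_distrib] at e
      linarith
    rw [h0, zero_div, zero_add] at h1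
    refine h1.trans ?_
    gcongr
  have hsum : ∑ S ∈ Λ.powerset, Real.exp (l * X S) ≤
      2 ^ Λ.card * Real.exp (v * (l * c) ^ 2 / 8) := by
    have e1 : (2:ℝ) ^ V.card * ∑ S ∈ Λ.powerset, Real.exp (l * X S) =
        ∑ S ∈ Λ.powerset, ∑ U ∈ V.powerset, Real.exp (l * X (symmDiff S U)) := by
      rw [Finset.sum_comm]
      rw [Finset.sum_congr rfl (fun U hU => sum_shift Λ U
        ((Finset.mem_powerset.1 hU).trans hV) (fun S => Real.exp (l * X S)))]
      rw [Finset.sum_const, Finset.card_powerset, nsmul_eq_mul]; push_cast; rfl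
    have e2 : ∑ S ∈ Λ.powerset, ∑ U ∈ V.powerset, Real.exp (l * X (symmDiff S U)) ≤
        ∑ S ∈ Λ.powerset, 2 ^ V.card * Real.exp (v * (l * c) ^ 2 / 8) :=
      Finset.sum_le_sum (fun S _ => hinner S)
    rw [← e1, Finset.sum_const, Finset.card_powerset, nsmul_eq_mul] at e2
    push_cast at e2
    have hp : (0:ℝ) < 2 ^ V.card := by positivity
    rw [mul_left_comm] at e2
    exact le_of_mul_le_mul_left e2 hp
  have hmk : (((Λ.powerset).filter (fun S => t ≤ X S)).card : ℝ) * Real.exp (l * t) ≤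
      ∑ S ∈ Λ.powerset, Real.exp (l * X S) := by
    rw [← nsmul_eq_mul, ← Finset.sum_const]
    refine (Finset.sum_le_sum (g := fun S => Real.exp (l * X S)) ?_).trans
      (Finset.sum_le_sum_of_subset_of_nonneg (Finset.filter_subset _ _) (fun _ _ _ => (Real.exp_pos _).le))
    intro S hS
    have := (Finset.mem_filter.1 hS).2
    apply Real.exp_le_exp.2
    gcongr
  have h3 := hmk.trans hsum
  have hcalc : - (2 * t ^ 2 / (v * c ^ 2)) = v * (l * c) ^ 2 / 8 - l * t := by
    rw [hl]; field_simp; ring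
  rw [hcalc, Real.exp_sub, ← mul_div_assoc, le_div_iff₀ (Real.exp_pos _)]
  exact h3

/-- Partition function in a field configuration `S`. -/
def Zf (Λ : Finset ℤ) (w : Finset ℤ → ℝ) (κ : ℝ) (S : Finset ℤ) : ℝ :=
  ∑ A ∈ Λ.powerset, w A * Real.exp (-(κ * (symmDiff A S).card))

lemma Zf_pos (Λ : Finset ℤ) {w : Finset ℤ → ℝ} (hw : ∀ A, 0 < w A) (κ : ℝ) (S : Finset ℤ) :
    0 < Zf Λ w κ S :=
  Finset.sum_pos (fun A _ => mul_pos (hw A) (Real.exp_pos _)) ⟨∅, by simp⟩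

lemma Zf_step (Λ : Finset ℤ) {w : Finset ℤ → ℝ} (hw : ∀ A, 0 < w A) {κ : ℝ} (hκ : 0 ≤ κ)
    (S : Finset ℤ) (x : ℤ) : Zf Λ w κ S ≤ Real.exp κ * Zf Λ w κ (symmDiff S {x}) := by
  unfold Zf
  rw [Finset.mul_sum]
  apply Finset.sum_le_sum
  intro A _
  rw [mul_left_comm, ← Real.exp_add]
  have : (symmDiff A (symmDiff S {x})).card ≤ (symmDiff A S).card + 1 := by
    rw [← symmDiff_assoc]
    refine (Finset.card_le_card (t := symmDiff A S ∪ {x}) ?_).trans ((Finset.card_union_le _ _).trans (by simp))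
    intro y hy
    rw [Finset.mem_symmDiff] at hy
    rcases hy with h | h
    · exact Finset.mem_union_left _ h.1
    · exact Finset.mem_union_right _ h.1
  have h2 : ((symmDiff A (symmDiff S {x})).card : ℝ) ≤ (symmDiff A S).card + 1 := by exact_mod_cast this
  have := hw A
  gcongr
  nlinarith

lemma Zf_log (Λ : Finset ℤ) {w : Finset ℤ → ℝ} (hw : ∀ A, 0 < w A) {κ : ℝ} (hκ : 0 ≤ κ)
    (S : Finset ℤ) (x : ℤ) :
    |Real.log (Zf Λ w κ (symmDiff S {x})) - Real.log (Zf Λ w κ S)| ≤ κ := by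
  have h1 := Zf_step Λ hw hκ S x
  have h2 := Zf_step Λ hw hκ (symmDiff S {x}) x
  rw [symmDiff_symmDiff_cancel_right] at h2
  have l1 := Real.log_le_log (Zf_pos Λ hw κ _) h1
  have l2 := Real.log_le_log (Zf_pos Λ hw κ _) h2
  rw [Real.log_mul (Real.exp_pos _).ne' (Zf_pos Λ hw κ _).ne', Real.log_exp] at l1 l2
  rw [abs_le]; constructor <;> linarith

lemma Zf_conc (Λ : Finset ℤ) {w : Finset ℤ → ℝ} (hw : ∀ A, 0 < w A) {κ : ℝ} (hκ : 0 < κ)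
    (D D' : Finset ℤ) (hD : D ⊆ Λ) (hD' : D' ⊆ Λ)
    (t v : ℝ) (ht : 0 < t) (hv : 0 < v) (hVv : ((symmDiff D D').card : ℝ) ≤ v) :
    (((Λ.powerset).filter (fun S => t ≤ Real.log (Zf Λ w κ (symmDiff S D)) -
        Real.log (Zf Λ w κ (symmDiff S D')))).card : ℝ) ≤
      2 ^ Λ.card * Real.exp (- (t ^ 2 / (2 * v * κ ^ 2))) := by
  have h := concentration Λ (symmDiff D D') ?_ (fun S => Real.log (Zf Λ w κ (symmDiff S D)) -
        Real.log (Zf Λ w κ (symmDiff S D'))) (2 * κ) (by positivity) ?_ ?_ t v ht hv hVv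
  · rw [show t ^ 2 / (2 * v * κ ^ 2) = 2 * t ^ 2 / (v * (2 * κ) ^ 2) by field_simp]
    exact h
  · intro x hx
    rw [Finset.mem_symmDiff] at hx
    rcases hx with h | h
    · exact hD h.1
    · exact hD' h.1
  · intro S x
    have h1 := abs_le.1 (Zf_log Λ hw hκ.le (symmDiff S D) x)
    have h2 := abs_le.1 (Zf_log Λ hw hκ.le (symmDiff S D') x)
    simp only [symmDiff_right_comm S {x}]
    rw [abs_le]; constructor <;> linarith [h1.1, h1.2, h2.1, h2.2]
  · intro S
    have e1 : symmDiff (symmDiff S (symmDiff D D')) D = symmDiff S D' := by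
      rw [symmDiff_assoc, symmDiff_comm D D', symmDiff_symmDiff_cancel_right]
    have e2 : symmDiff (symmDiff S (symmDiff D D')) D' = symmDiff S D := by
      rw [symmDiff_assoc, symmDiff_symmDiff_cancel_right]
    simp only [e1, e2]; ring

end RF

namespace RF

def EJ (α j : ℝ) (A : Finset ℤ) : ℝ := (En (kern α) A).toReal + 2 * j * (walls A).card

lemma gap {α : ℝ} (h0 : 0 < α) (h : α < 1) {M : ℕ} (hG : GapM α M) {j : ℝ} (hj : 0 ≤ j)
    (A : Finset ℤ) (x : ℤ) (hx : x ∈ A) (a b : ℤ) (hAI : A ⊆ Finset.Icc a b) :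
    ∃ B : Finset ℤ, Indec α M B ∧ B ⊆ Finset.Icc a b ∧ x ∈ B ∧
      EJ α j (symmDiff A B) + ((qq α B : ℝ) / 4 + 4 * j) ≤ EJ α j A := by
  obtain ⟨B, h1, h2, h3, h4, h5⟩ := exists_part h0 h hG A x hx a b hAI
  refine ⟨B, h1, h2, h3, ?_⟩
  have hid := En_identity (kern α) (symmDiff A B) B
  rw [symmDiff_symmDiff_cancel_right] at hid
  obtain ⟨A', hA'⟩ : ∃ A', A' = symmDiff A B := ⟨_, rfl⟩
  have hAA : A = symmDiff A' B := by rw [hA', symmDiff_symmDiff_cancel_right]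
  rw [← hA'] at hid h4 h5 ⊢
  have tA := En_ne_top h A
  have tA' := En_ne_top h A'
  have tB := En_ne_top h B
  have tW : Wb (kern α) B A' ≠ ⊤ := by
    intro hW; rw [hW] at h4
    rw [ENNReal.mul_top (by norm_num)] at h4
    exact tB (top_le_iff.1 h4)
  have h4' : 4 * (Wb (kern α) B A').toReal ≤ (En (kern α) B).toReal := by
    have := ENNReal.toReal_mono tB h4
    simpa [ENNReal.toReal_mul] using this
  have hid' : (En (kern α) A).toReal + 2 * (Wb (kern α) B A').toReal =
      (En (kern α) A').toReal + (En (kern α) B).toReal := by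
    have := congrArg ENNReal.toReal hid
    rw [ENNReal.toReal_add tA (ENNReal.mul_ne_top (by simp) tW), ENNReal.toReal_add tA' tB,
      ENNReal.toReal_mul] at this
    simpa using this
  have hw : walls A = walls A' ∪ walls B := by
    ext i
    rw [Finset.mem_union, mem_walls, mem_walls, mem_walls]
    have hs := wall_sd (A := A') (B := B) (i := i)
    rw [← hAA] at hs
    have := h5 i
    rw [hs]
    by_cases p : Wall A' i
    · by_cases q : Wall B i
      · exact absurd p (this q)
      · simp [p, q]
    · simp [p]
  have hd : Disjoint (walls A') (walls B) := by
    rw [Finset.disjoint_left]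
    intro i hi hi'
    exact h5 i (mem_walls.1 hi') (mem_walls.1 hi)
  have hc : (walls A).card = (walls A').card + (walls B).card := by
    rw [hw, Finset.card_union_of_disjoint hd]
  have h2w : 2 ≤ (walls B).card := by
    obtain ⟨i, hi1, _, hi⟩ := exists_wall_right h3
    obtain ⟨i', _, hi2, hi'⟩ := exists_wall_left h3
    have : ({i, i'} : Finset ℤ) ⊆ walls B := by
      intro z hz
      rw [Finset.mem_insert, Finset.mem_singleton] at hz
      rcases hz with rfl | rfl
      · exact mem_walls.2 hi
      · exact mem_walls.2 hi'
    have h6 := Finset.card_le_card this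
    rwa [Finset.card_pair (by omega)] at h6
  have hq := qq_le h0 h (B := B) ⟨x, h3⟩
  unfold EJ
  rw [hc]
  have h2w' : (2:ℝ) ≤ (walls B).card := by exact_mod_cast h2w
  push_cast
  nlinarith

lemma peierls {α : ℝ} (h0 : 0 < α) (h : α < 1) {M : ℕ} (hG : GapM α M) {j β κ : ℝ} (hj : 0 ≤ j)
    (hβ : 0 ≤ β) (a b : ℤ) (S : Finset ℤ) :
    ∑ A ∈ (Finset.Icc a b).powerset.filter (fun A => (0:ℤ) ∈ A),
      Real.exp (-(β * EJ α j A)) * Real.exp (-(κ * (symmDiff A S).card)) ≤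
    ∑ B ∈ (Finset.Icc a b).powerset.filter (fun B => Indec α M B ∧ (0:ℤ) ∈ B),
      Real.exp (-(β * ((qq α B : ℝ) / 4 + 4 * j))) *
        Zf (Finset.Icc a b) (fun A => Real.exp (-(β * EJ α j A))) κ (symmDiff S B) := by
  obtain ⟨Λ, hΛ⟩ : ∃ Λ, Λ = Finset.Icc a b := ⟨_, rfl⟩
  rw [← hΛ]
  have e1 : ∀ B ∈ Λ.powerset.filter (fun B => Indec α M B ∧ (0:ℤ) ∈ B),
      Real.exp (-(β * ((qq α B : ℝ) / 4 + 4 * j))) *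
        Zf Λ (fun A => Real.exp (-(β * EJ α j A))) κ (symmDiff S B) =
      ∑ A ∈ Λ.powerset, Real.exp (-(β * (EJ α j (symmDiff A B) + ((qq α B : ℝ) / 4 + 4 * j)))) *
        Real.exp (-(κ * (symmDiff A S).card)) := by
    intro B hB
    have hBΛ := Finset.mem_powerset.1 (Finset.mem_filter.1 hB).1
    unfold Zf
    rw [← sum_shift Λ B hBΛ, Finset.mul_sum]
    apply Finset.sum_congr rfl
    intro A _
    rw [symmDiff_symmDiff_symmDiff_comm, symmDiff_self, symmDiff_bot, ← mul_assoc, ← Real.exp_add]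
    congr 2; ring
  rw [Finset.sum_congr rfl e1, Finset.sum_comm, Finset.sum_filter]
  apply Finset.sum_le_sum
  intro A hA
  split_ifs with hA0
  · obtain ⟨B, hB1, hB2, hB3, hB4⟩ := gap h0 h hG hj A 0 hA0 a b (hΛ ▸ Finset.mem_powerset.1 hA)
    have hBm : B ∈ Λ.powerset.filter (fun B => Indec α M B ∧ (0:ℤ) ∈ B) :=
      Finset.mem_filter.2 ⟨Finset.mem_powerset.2 (hΛ ▸ hB2), hB1, hB3⟩
    refine le_trans ?_ (Finset.single_le_sum (f := fun B =>
      Real.exp (-(β * (EJ α j (symmDiff A B) + ((qq α B : ℝ) / 4 + 4 * j)))) *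
        Real.exp (-(κ * (symmDiff A S).card))) (fun B _ => by positivity) hBm)
    gcongr
  · exact Finset.sum_nonneg (fun B _ => by positivity)

end RF

namespace RF

lemma clog_le_self (m : ℕ) : Nat.clog 2 m ≤ m :=
  Nat.clog_le_of_le_pow (Nat.lt_two_pow_self).le

lemma two_pow_K_le (Kc : ℕ) {m : ℕ} (hm : 1 ≤ m) : 2 ^ (Kc + Nat.clog 2 m) ≤ 2 ^ (Kc + 1) * m := by
  rw [pow_add, pow_succ, mul_assoc]
  refine Nat.mul_le_mul_left _ ?_
  rcases Nat.lt_or_ge 1 m with h1 | h1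
  · have h2 := Nat.pow_pred_clog_lt_self (b := 2) (by norm_num) h1
    have h3 : 1 ≤ Nat.clog 2 m := Nat.clog_pos (by norm_num) h1
    have : 2 ^ Nat.clog 2 m = 2 * 2 ^ (Nat.clog 2 m).pred := by
      rw [← pow_succ']; congr 1; simp; omega
    omega
  · have : m = 1 := by omega
    subst this; simp

lemma four_pow_K {Kc : ℕ} (hKc : 1 ≤ Kc) (m : ℕ) : 2 * m ^ 2 ≤ 4 ^ (Kc + Nat.clog 2 m) := by
  have h1 : m ≤ 2 ^ Nat.clog 2 m := Nat.le_pow_clog (by norm_num) m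
  have h2 : 2 ≤ 4 ^ Kc := by
    calc 2 ≤ 4 ^ 1 := by norm_num
      _ ≤ _ := Nat.pow_le_pow_right (by norm_num) hKc
  rw [pow_add]
  have h3 : 4 ^ Nat.clog 2 m = (2 ^ Nat.clog 2 m) ^ 2 := by
    rw [← pow_mul, mul_comm, pow_mul]; norm_num
  rw [h3]
  exact Nat.mul_le_mul h2 (Nat.pow_le_pow_left h1 2)

lemma sum_bound {ε : ℝ} (hε : 0 < ε) (Kc : ℕ) : ∃ a0 : ℝ, 0 < a0 ∧ ∀ a ≥ a0, ∀ N : ℕ,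
    ∑ m ∈ Finset.Icc 1 N, ((Kc + m : ℕ) : ℝ) * Real.exp (-(a * (m:ℝ) ^ ε)) ≤ 1 := by
  obtain ⟨n, hn⟩ := exists_nat_ge (3 / ε)
  have hnε : 3 ≤ ε * n := by rw [div_le_iff₀ hε] at hn; linarith
  have hpt : ∀ m : ℕ, 1 ≤ m → ((Kc + m : ℕ) : ℝ) * Real.exp (-((m:ℝ) ^ ε)) ≤
      ((Kc + 1) * n.factorial) * (1 / (m:ℝ) ^ 2) := by
    intro m hm
    have hm1 : (1:ℝ) ≤ m := by exact_mod_cast hm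
    have h1 := Real.pow_div_factorial_le_exp ((m:ℝ) ^ ε) (by positivity) n
    have h2 : (m:ℝ) ^ 3 ≤ ((m:ℝ) ^ ε) ^ n := by
      rw [← Real.rpow_natCast ((m:ℝ) ^ ε) n, ← Real.rpow_mul (by positivity), ← Real.rpow_natCast]
      apply Real.rpow_le_rpow_of_exponent_le hm1
      push_cast; exact hnε
    have hf : (0:ℝ) < n.factorial := by exact_mod_cast Nat.factorial_pos n
    have h3 : (m:ℝ) ^ 3 / n.factorial ≤ Real.exp ((m:ℝ) ^ ε) := le_trans (by gcongr) h1
    rw [Real.exp_neg]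
    have h4 : (Real.exp ((m:ℝ) ^ ε))⁻¹ ≤ n.factorial / (m:ℝ) ^ 3 := by
      rw [← inv_div]
      apply inv_anti₀ (by positivity) h3
    have h5 : ((Kc + m : ℕ) : ℝ) ≤ (Kc + 1) * m := by
      push_cast
      have : (0:ℝ) ≤ Kc := by positivity
      nlinarith
    calc _ ≤ ((Kc + 1) * m) * (n.factorial / (m:ℝ) ^ 3) := by gcongr
      _ = _ := by field_simp
  have hs : Summable (fun m : ℕ => ((Kc + 1) * n.factorial : ℝ) * (1 / (m:ℝ) ^ 2)) :=
    (Real.summable_one_div_nat_pow.2 (by norm_num)).mul_left _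
  obtain ⟨T, hT⟩ : ∃ T, T = ∑' m : ℕ, ((Kc + 1) * n.factorial : ℝ) * (1 / (m:ℝ) ^ 2) := ⟨_, rfl⟩
  have hT0 : 0 ≤ T := by rw [hT]; exact tsum_nonneg (fun m => by positivity)
  refine ⟨1 + T, by linarith, ?_⟩
  intro a ha N
  have hexp : Real.exp (-(a - 1)) * T ≤ 1 := by
    have h1 : T ≤ Real.exp (a - 1) := by
      have := Real.add_one_le_exp (a - 1); linarith
    calc _ ≤ Real.exp (-(a - 1)) * Real.exp (a - 1) := by gcongr
      _ = 1 := by rw [← Real.exp_add]; simp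
  calc _ ≤ ∑ m ∈ Finset.Icc 1 N, Real.exp (-(a - 1)) *
        (((Kc + 1) * n.factorial : ℝ) * (1 / (m:ℝ) ^ 2)) := by
        apply Finset.sum_le_sum
        intro m hm
        have hm1 := (Finset.mem_Icc.1 hm).1
        have hm1' : (1:ℝ) ≤ m := by exact_mod_cast hm1
        have hme : (1:ℝ) ≤ (m:ℝ) ^ ε := Real.one_le_rpow hm1' hε.le
        have : Real.exp (-(a * (m:ℝ) ^ ε)) ≤ Real.exp (-(a - 1)) * Real.exp (-((m:ℝ) ^ ε)) := by
          rw [← Real.exp_add]; apply Real.exp_le_exp.2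
          nlinarith
        calc _ ≤ ((Kc + m : ℕ) : ℝ) * (Real.exp (-(a - 1)) * Real.exp (-((m:ℝ) ^ ε))) := by gcongr
          _ = Real.exp (-(a - 1)) * (((Kc + m : ℕ) : ℝ) * Real.exp (-((m:ℝ) ^ ε))) := by ring
          _ ≤ _ := mul_le_mul_of_nonneg_left (hpt m hm1) (Real.exp_pos _).le
    _ = Real.exp (-(a - 1)) * ∑ m ∈ Finset.Icc 1 N, (((Kc + 1) * n.factorial : ℝ) * (1 / (m:ℝ) ^ 2)) := by
        rw [Finset.mul_sum]
    _ ≤ Real.exp (-(a - 1)) * T := by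
        gcongr
        rw [hT]
        exact hs.sum_le_tsum _ (fun m _ => by positivity)
    _ ≤ 1 := hexp

lemma term_bound {ε c C L j P m : ℝ} (hε : 0 < ε) (hε1 : ε < 1) (hc : 0 < c) (hC : 4 * C ≤ c)
    (hC0 : 0 ≤ C)
    (hL : 1 ≤ L) (hj : 0 ≤ j) (hm : 1 ≤ m) (hP : 1 ≤ P) (hPL : P ≤ L * m) :
    2 * C * m / P - c * ((m + j) ^ 2 / m * P ^ (-(1 - ε))) ≤ - (c / (2 * L) * (m + j) ^ ε) := by
  have hP0 : 0 < P := by linarith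
  have hm0 : 0 < m := by linarith
  have h1 : 1 / P ≤ P ^ (-(1 - ε)) := by
    rw [one_div, ← Real.rpow_neg_one]
    apply Real.rpow_le_rpow_of_exponent_le hP; linarith
  have h2 : m ≤ (m + j) ^ 2 / m := by
    rw [le_div_iff₀ hm0]; nlinarith
  have h3 : m / P ≤ (m + j) ^ 2 / m * P ^ (-(1 - ε)) := by
    calc m / P = m * (1 / P) := by ring
      _ ≤ _ := by gcongr
  have h4 : (m + j) ^ ε / L ≤ (m + j) ^ 2 / m * P ^ (-(1 - ε)) := by
    have e1 : (L * m) ^ (-(1 - ε)) ≤ P ^ (-(1 - ε)) :=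
      Real.rpow_le_rpow_of_nonpos hP0 hPL (by linarith)
    have e2 : L⁻¹ * m ^ (-(1 - ε)) ≤ (L * m) ^ (-(1 - ε)) := by
      rw [Real.mul_rpow (by linarith) hm0.le]
      gcongr
      rw [← Real.rpow_neg_one]
      apply Real.rpow_le_rpow_of_exponent_le hL; linarith
    have e3 : (m + j) ^ ε ≤ (m + j) ^ 2 / m * m ^ (-(1 - ε)) := by
      have hmj : 0 < m + j := by linarith
      have f1 : (m + j) ^ 2 = (m + j) ^ ε * (m + j) ^ (2 - ε) := by
        rw [← Real.rpow_add hmj, ← Real.rpow_natCast]; congr 1; push_cast; ring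
      have f2 : m ^ (2 - ε) ≤ (m + j) ^ (2 - ε) := by
        apply Real.rpow_le_rpow hm0.le <;> linarith
      have f3 : m ^ (2 - ε) * (m⁻¹ * m ^ (-(1 - ε))) = 1 := by
        rw [← Real.rpow_neg_one, ← Real.rpow_add hm0, ← Real.rpow_add hm0]
        rw [show 2 - ε + (-1 + -(1 - ε)) = 0 by ring, Real.rpow_zero]
      calc (m + j) ^ ε = (m + j) ^ ε * (m ^ (2 - ε) * (m⁻¹ * m ^ (-(1 - ε)))) := by rw [f3, mul_one]
        _ ≤ (m + j) ^ ε * ((m + j) ^ (2 - ε) * (m⁻¹ * m ^ (-(1 - ε)))) := by gcongr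
        _ = _ := by rw [f1]; ring
    calc (m + j) ^ ε / L ≤ ((m + j) ^ 2 / m * m ^ (-(1 - ε))) / L := by gcongr
      _ = (m + j) ^ 2 / m * (L⁻¹ * m ^ (-(1 - ε))) := by ring
      _ ≤ (m + j) ^ 2 / m * P ^ (-(1 - ε)) := by
        have := e2.trans e1
        gcongr
  obtain ⟨Y, hY⟩ : ∃ Y, Y = (m + j) ^ 2 / m * P ^ (-(1 - ε)) := ⟨_, rfl⟩
  rw [← hY] at h3 h4 ⊢
  have hY0 : 0 ≤ Y := by rw [hY]; positivity
  have h5 : 2 * C * m / P ≤ c / 2 * Y := by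
    calc 2 * C * m / P = 2 * C * (m / P) := by ring
      _ ≤ 2 * C * Y := by gcongr
      _ ≤ _ := by nlinarith
  have h6 : c / (2 * L) * (m + j) ^ ε ≤ c / 2 * Y := by
    calc c / (2 * L) * (m + j) ^ ε = c / 2 * ((m + j) ^ ε / L) := by field_simp
      _ ≤ _ := by gcongr
  linarith

lemma t_identity {α ct θ β x m : ℝ} (hθ : 0 < θ) (hβ : 0 < β) (hm : 0 < m) (k : ℕ) :
    (β * (ct * x * (((2:ℝ) ^ (-((2 * α - 1) / 4))) ^ k))) ^ 2 /
        (2 * (16 * m * ((4:ℝ) ^ k) ^ (1 - α)) * (2 * β * θ) ^ 2) =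
      (ct ^ 2 / 128 / θ ^ 2) * (x ^ 2 / m * ((2:ℝ) ^ k) ^ (-(1 - (2 * α - 1) / 2))) := by
  have hP : (0:ℝ) < 2 ^ k := by positivity
  obtain ⟨P, hPe⟩ : ∃ P : ℝ, P = 2 ^ k := ⟨_, rfl⟩
  have e1 : ((2:ℝ) ^ (-((2 * α - 1) / 4))) ^ k = P ^ (-((2 * α - 1) / 4)) := by
    rw [hPe, ← Real.rpow_natCast, ← Real.rpow_mul (by norm_num), mul_comm, Real.rpow_mul (by norm_num),
      Real.rpow_natCast]
  have e2 : ((4:ℝ) ^ k) ^ (1 - α) = P ^ (2 * (1 - α)) := by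
    rw [hPe, Real.rpow_mul (by positivity), show (2:ℝ) = ((2:ℕ):ℝ) by norm_num, Real.rpow_natCast]
    congr 1
    rw [← pow_mul, mul_comm, pow_mul]; norm_num
  rw [e1, e2, ← hPe]
  rw [← hPe] at hP
  have e3 : (P ^ (-((2 * α - 1) / 4))) ^ 2 = P ^ (-((2 * α - 1) / 2)) := by
    rw [← Real.rpow_natCast, ← Real.rpow_mul hP.le]; congr 1; push_cast; ring
  have e4 : P ^ (-(1 - (2 * α - 1) / 2)) * P ^ (2 * (1 - α)) = P ^ (-((2 * α - 1) / 2)) := by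
    rw [← Real.rpow_add hP]; congr 1; ring
  have hQ : 0 < P ^ (2 * (1 - α)) := by positivity
  rw [mul_pow, mul_pow, e3, ← e4]
  field_simp
  ring

end RF

namespace RF

/-- Peierls objects. -/
def Bs (α : ℝ) (M : ℕ) (Λ : Finset ℤ) : Finset (Finset ℤ) :=
  Λ.powerset.filter (fun B => Indec α M B ∧ (0:ℤ) ∈ B)

lemma mem_Bs {α : ℝ} {M : ℕ} {Λ B : Finset ℤ} :
    B ∈ Bs α M Λ ↔ B ⊆ Λ ∧ Indec α M B ∧ (0:ℤ) ∈ B := by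
  unfold Bs; rw [Finset.mem_filter, Finset.mem_powerset]

def Ent (α : ℝ) (M Kc C3 : ℕ) : Prop :=
  ∀ m : ℕ, 1 ≤ m → ∀ Λ : Finset ℤ, ∀ 𝓑 : Finset (Finset ℤ),
      (∀ B ∈ 𝓑, Indec α M B ∧ (0:ℤ) ∈ B ∧ qq α B ≤ m) → ∀ k ≤ Kc + Nat.clog 2 m,
      ((𝓑.image (fun B => crs Λ B k)).card : ℝ) ≤ Real.exp (C3 * m / 2 ^ k)

lemma sum_exp_neg (N : ℕ) : ∑ m ∈ Finset.Icc 1 N, Real.exp (-(m:ℝ)) ≤ 1 := by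
  have h : ∀ N : ℕ, ∑ m ∈ Finset.Icc 1 N, ((1:ℝ)/2) ^ m ≤ 1 - (1/2) ^ N := by
    intro N
    induction N with
    | zero => simp
    | succ n ih =>
      rw [Finset.sum_Icc_succ_top (by omega), pow_succ]
      linarith
  refine le_trans (Finset.sum_le_sum (g := fun m : ℕ => ((1:ℝ)/2) ^ m) ?_) ((h N).trans ?_)
  · intro m _
    have h1 : Real.exp (-(m:ℝ)) = (Real.exp (-1)) ^ m := by
      rw [← Real.exp_nat_mul]; congr 1; ring
    rw [h1]
    gcongr
    rw [Real.exp_neg, one_div]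
    apply inv_anti₀ (by norm_num)
    have := Real.add_one_le_exp (1:ℝ)
    linarith
  · have : (0:ℝ) ≤ (1/2) ^ N := by positivity
    linarith

lemma geom_le {r : ℝ} (hr0 : 0 < r) (hr1 : r < 1) (K : ℕ) :
    (1 - r) / 8 * ∑ k ∈ Finset.range K, r ^ k ≤ 1 / 8 := by
  have h := mul_neg_geom_sum r K
  have : 0 < r ^ K := by positivity
  nlinarith

lemma good_det {α : ℝ} (h0 : 1 / 2 < α) (h : α < 1) {M : ℕ} (hG : GapM α M) {Kc C3 : ℕ} (hKc : 1 ≤ Kc)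
    (hE : Ent α M Kc C3) {j β κ r : ℝ} (hj : 0 ≤ j) (hβ : 8 * (C3 + 1 : ℝ) ≤ β)
    (hr0 : 0 < r) (hr1 : r < 1) (a b : ℤ) (S : Finset ℤ)
    (hgood : ∀ B ∈ Bs α M (Finset.Icc a b), ∀ k < Kc + Nat.clog 2 (qq α B),
      Real.log (Zf (Finset.Icc a b) (fun A => Real.exp (-(β * EJ α j A))) κ
        (symmDiff S (crs (Finset.Icc a b) B k))) -
      Real.log (Zf (Finset.Icc a b) (fun A => Real.exp (-(β * EJ α j A))) κ
        (symmDiff S (crs (Finset.Icc a b) B (k+1)))) < β * ((1 - r) / 8 * (qq α B + j) * r ^ k)) :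
    ∑ A ∈ (Finset.Icc a b).powerset.filter (fun A => (0:ℤ) ∈ A),
      Real.exp (-(β * EJ α j A)) * Real.exp (-(κ * (symmDiff A S).card)) ≤
    Real.exp (-(β * j)) * Zf (Finset.Icc a b) (fun A => Real.exp (-(β * EJ α j A))) κ S := by
  have hC3 : (0:ℝ) ≤ C3 := by positivity
  have hβ0 : 0 < β := by linarith
  refine (peierls (by linarith) h hG hj hβ0.le a b S).trans ?_
  obtain ⟨Λ, hΛ⟩ : ∃ Λ, Λ = Finset.Icc a b := ⟨_, rfl⟩
  rw [← hΛ] at hgood ⊢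
  change ∑ B ∈ Bs α M Λ, _ ≤ _
  obtain ⟨Z, hZ⟩ : ∃ Z : Finset ℤ → ℝ, Z = Zf Λ (fun A => Real.exp (-(β * EJ α j A))) κ := ⟨_, rfl⟩
  rw [← hZ] at hgood ⊢
  have hZp : ∀ S, 0 < Z S := by
    intro S; rw [hZ]; exact Zf_pos Λ (fun A => Real.exp_pos _) κ S
  have hB : ∀ B ∈ Bs α M Λ, Real.exp (-(β * ((qq α B : ℝ) / 4 + 4 * j))) * Z (symmDiff S B) ≤
      Real.exp (-((C3 + 1) * (qq α B : ℝ))) * (Real.exp (-(β * j)) * Z S) := by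
    intro B hBm
    obtain ⟨hBΛ, hBi, hB0⟩ := mem_Bs.1 hBm
    have hg := hgood B hBm
    obtain ⟨m, hm⟩ : ∃ m, m = qq α B := ⟨_, rfl⟩
    rw [← hm] at hg ⊢
    obtain ⟨K, hK⟩ : ∃ K, K = Kc + Nat.clog 2 m := ⟨_, rfl⟩
    rw [← hK] at hg
    have hs := Finset.sum_range_sub' (fun k => Real.log (Z (symmDiff S (crs Λ B k)))) K
    have hcK : crs Λ B K = ∅ := by
      apply crs_top
      have := card_le_qq_sq h0 h (B := B) ⟨0, hB0⟩
      rw [← hm] at this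
      have h4 := four_pow_K hKc m
      rw [hK]; omega
    rw [crs_zero hBΛ, hcK, ← Finset.bot_eq_empty, symmDiff_bot] at hs
    have hs2 : Real.log (Z (symmDiff S B)) - Real.log (Z S) ≤
        ∑ k ∈ Finset.range K, β * ((1 - r) / 8 * (m + j) * r ^ k) := by
      rw [← hs]
      exact Finset.sum_le_sum (fun k hk => (hg k (Finset.mem_range.1 hk)).le)
    have hs3 : ∑ k ∈ Finset.range K, β * ((1 - r) / 8 * (m + j) * r ^ k) ≤ β * ((m + j) / 8) := by
      have := geom_le hr0 hr1 K
      have hmj : (0:ℝ) ≤ β * (m + j) := by positivity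
      calc _ = β * (m + j) * ((1 - r) / 8 * ∑ k ∈ Finset.range K, r ^ k) := by
            rw [Finset.mul_sum, Finset.mul_sum]
            apply Finset.sum_congr rfl; intro k _; ring
        _ ≤ β * (m + j) * (1 / 8) := by gcongr
        _ = _ := by ring
    have hZZ : Z (symmDiff S B) ≤ Real.exp (β * ((m + j) / 8)) * Z S := by
      rw [← Real.log_le_log_iff (hZp _) (mul_pos (Real.exp_pos _) (hZp _)),
        Real.log_mul (Real.exp_pos _).ne' (hZp _).ne', Real.log_exp]
      linarith
    calc _ ≤ Real.exp (-(β * ((m : ℝ) / 4 + 4 * j))) * (Real.exp (β * ((m + j) / 8)) * Z S) := by gcongr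
      _ = Real.exp (-(β * ((m : ℝ) / 4 + 4 * j)) + β * ((m + j) / 8)) * Z S := by
          rw [← mul_assoc, ← Real.exp_add]
      _ ≤ Real.exp (-((C3 + 1) * (m : ℝ)) + -(β * j)) * Z S := by
          refine mul_le_mul_of_nonneg_right (Real.exp_le_exp.2 ?_) (hZp S).le
          have h1 : 0 ≤ β * j := by positivity
          have h2 : 8 * (C3 + 1 : ℝ) * m ≤ β * m := by gcongr
          nlinarith
      _ = _ := by rw [Real.exp_add]; ring
  refine (Finset.sum_le_sum hB).trans ?_
  rw [← Finset.sum_mul]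
  have hone : ∑ B ∈ Bs α M Λ, Real.exp (-((C3 + 1) * (qq α B : ℝ))) ≤ 1 := by
    have hmap : ∀ B ∈ Bs α M Λ, qq α B ∈ Finset.Icc 1 ((Bs α M Λ).sup (qq α)) := by
      intro B hBm
      rw [Finset.mem_Icc]
      exact ⟨one_le_qq (by linarith) h ⟨0, (mem_Bs.1 hBm).2.2⟩, Finset.le_sup (f := qq α) hBm⟩
    rw [← Finset.sum_fiberwise_of_maps_to hmap]
    refine le_trans (Finset.sum_le_sum ?_) (sum_exp_neg ((Bs α M Λ).sup (qq α)))
    intro m hm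
    have hm1 := (Finset.mem_Icc.1 hm).1
    have e1 : ∀ B ∈ (Bs α M Λ).filter (fun B => qq α B = m),
        Real.exp (-((C3 + 1) * (qq α B : ℝ))) = Real.exp (-((C3 + 1) * (m : ℝ))) := by
      intro B hB; rw [(Finset.mem_filter.1 hB).2]
    rw [Finset.sum_congr rfl e1, Finset.sum_const, nsmul_eq_mul]
    have hcard := hE m hm1 Λ ((Bs α M Λ).filter (fun B => qq α B = m)) (by
      intro B hB
      obtain ⟨hB1, hB2⟩ := Finset.mem_filter.1 hB
      exact ⟨(mem_Bs.1 hB1).2.1, (mem_Bs.1 hB1).2.2, hB2.le⟩) 0 (by omega)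
    have himg : ((Bs α M Λ).filter (fun B => qq α B = m)).image (fun B => crs Λ B 0) =
        (Bs α M Λ).filter (fun B => qq α B = m) := by
      rw [Finset.image_congr (g := id), Finset.image_id]
      intro B hB
      exact crs_zero (mem_Bs.1 (Finset.mem_filter.1 hB).1).1
    rw [himg] at hcard
    calc _ ≤ Real.exp (C3 * m / 2 ^ 0) * Real.exp (-((C3 + 1) * (m : ℝ))) := by gcongr
      _ = _ := by rw [← Real.exp_add]; congr 1; simp; ring
  have := mul_pos (Real.exp_pos (-(β * j))) (hZp S)
  nlinarith

lemma bad_count {α : ℝ} (h0 : 1 / 2 < α) (h : α < 1) {M Kc C3 : ℕ}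
    (hE : Ent α M Kc C3) {κ : ℝ} (hκ : 0 < κ) (Λ : Finset ℤ) {w : Finset ℤ → ℝ} (hw : ∀ A, 0 < w A)
    (t : ℕ → ℕ → ℝ) (ht : ∀ m k, 1 ≤ m → 0 < t m k) (N : ℕ) (hN : ∀ B ∈ Bs α M Λ, qq α B ≤ N) :
    ((Λ.powerset.filter (fun S => ∃ B ∈ Bs α M Λ, ∃ k < Kc + Nat.clog 2 (qq α B),
      t (qq α B) k ≤ Real.log (Zf Λ w κ (symmDiff S (crs Λ B k))) -
        Real.log (Zf Λ w κ (symmDiff S (crs Λ B (k+1)))))).card : ℝ) ≤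
    2 ^ Λ.card * ∑ m ∈ Finset.Icc 1 N, ∑ k ∈ Finset.range (Kc + Nat.clog 2 m),
      Real.exp (2 * C3 * m / 2 ^ k) *
        Real.exp (-((t m k) ^ 2 / (2 * (16 * m * ((4:ℝ) ^ k) ^ (1 - α)) * κ ^ 2))) := by
  obtain ⟨P, hP⟩ : ∃ P : ℕ → ℕ → Finset (Finset ℤ × Finset ℤ), P = fun m k =>
    ((Bs α M Λ).filter (fun B => qq α B = m)).image (fun B => (crs Λ B k, crs Λ B (k+1))) := ⟨_, rfl⟩
  obtain ⟨Q, hQ⟩ : ∃ Q : ℕ → ℕ → Finset ℤ × Finset ℤ → Finset (Finset ℤ), Q = fun m k p =>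
    Λ.powerset.filter (fun S => t m k ≤ Real.log (Zf Λ w κ (symmDiff S p.1)) -
        Real.log (Zf Λ w κ (symmDiff S p.2))) := ⟨_, rfl⟩
  have hsub : (Λ.powerset.filter (fun S => ∃ B ∈ Bs α M Λ, ∃ k < Kc + Nat.clog 2 (qq α B),
      t (qq α B) k ≤ Real.log (Zf Λ w κ (symmDiff S (crs Λ B k))) -
        Real.log (Zf Λ w κ (symmDiff S (crs Λ B (k+1)))))) ⊆
      (Finset.Icc 1 N).biUnion (fun m => (Finset.range (Kc + Nat.clog 2 m)).biUnion
        (fun k => (P m k).biUnion (Q m k))) := by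
    intro S hS
    obtain ⟨hSΛ, B, hB, k, hk, hle⟩ := Finset.mem_filter.1 hS
    rw [Finset.mem_biUnion]
    refine ⟨qq α B, Finset.mem_Icc.2 ⟨one_le_qq (by linarith) h ⟨0, (mem_Bs.1 hB).2.2⟩, hN B hB⟩, ?_⟩
    rw [Finset.mem_biUnion]
    refine ⟨k, Finset.mem_range.2 hk, ?_⟩
    rw [Finset.mem_biUnion]
    refine ⟨(crs Λ B k, crs Λ B (k+1)), ?_, ?_⟩
    · rw [hP]; exact Finset.mem_image.2 ⟨B, Finset.mem_filter.2 ⟨hB, rfl⟩, rfl⟩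
    · rw [hQ]; exact Finset.mem_filter.2 ⟨hSΛ, hle⟩
  have hc1 := (Finset.card_le_card hsub).trans Finset.card_biUnion_le
  have hc2 : ((Λ.powerset.filter (fun S => ∃ B ∈ Bs α M Λ, ∃ k < Kc + Nat.clog 2 (qq α B),
      t (qq α B) k ≤ Real.log (Zf Λ w κ (symmDiff S (crs Λ B k))) -
        Real.log (Zf Λ w κ (symmDiff S (crs Λ B (k+1)))))).card : ℝ) ≤
      ∑ m ∈ Finset.Icc 1 N, (((Finset.range (Kc + Nat.clog 2 m)).biUnion
        (fun k => (P m k).biUnion (Q m k))).card : ℝ) := by exact_mod_cast hc1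
  refine hc2.trans ?_
  rw [Finset.mul_sum]
  apply Finset.sum_le_sum
  intro m hm
  have hm1 := (Finset.mem_Icc.1 hm).1
  have hc3 : (((Finset.range (Kc + Nat.clog 2 m)).biUnion
        (fun k => (P m k).biUnion (Q m k))).card : ℝ) ≤
      ∑ k ∈ Finset.range (Kc + Nat.clog 2 m), (((P m k).biUnion (Q m k)).card : ℝ) := by
    exact_mod_cast Finset.card_biUnion_le
  refine hc3.trans ?_
  rw [Finset.mul_sum]
  apply Finset.sum_le_sum
  intro k hk
  have hk' := Finset.mem_range.1 hk
  have hc4 : (((P m k).biUnion (Q m k)).card : ℝ) ≤ ∑ p ∈ P m k, ((Q m k p).card : ℝ) := by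
    exact_mod_cast Finset.card_biUnion_le
  have hmR : (0:ℝ) < m := by exact_mod_cast hm1
  have hQb : ∀ p ∈ P m k, ((Q m k p).card : ℝ) ≤ 2 ^ Λ.card *
      Real.exp (-((t m k) ^ 2 / (2 * (16 * m * ((4:ℝ) ^ k) ^ (1 - α)) * κ ^ 2))) := by
    intro p hp
    rw [hP] at hp
    obtain ⟨B, hB, rfl⟩ := Finset.mem_image.1 hp
    obtain ⟨hB1, hB2⟩ := Finset.mem_filter.1 hB
    rw [hQ]
    apply Zf_conc Λ hw hκ _ _ (crs_subset _ _ _) (crs_subset _ _ _) _ _ (ht m k hm1) (by positivity)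
    exact crs_step (by linarith) h (mem_Bs.1 hB1).1 hB2.le k
  have hPc : ((P m k).card : ℝ) ≤ Real.exp (2 * C3 * m / 2 ^ k) := by
    have hind : ∀ B ∈ (Bs α M Λ).filter (fun B => qq α B = m),
        Indec α M B ∧ (0:ℤ) ∈ B ∧ qq α B ≤ m := by
      intro B hB
      obtain ⟨hB1, hB2⟩ := Finset.mem_filter.1 hB
      exact ⟨(mem_Bs.1 hB1).2.1, (mem_Bs.1 hB1).2.2, hB2.le⟩
    have c1 := hE m hm1 Λ _ hind k (by omega)
    have c2 := hE m hm1 Λ _ hind (k+1) (by omega)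
    have hPs : P m k ⊆ (((Bs α M Λ).filter (fun B => qq α B = m)).image (fun B => crs Λ B k)) ×ˢ
        (((Bs α M Λ).filter (fun B => qq α B = m)).image (fun B => crs Λ B (k+1))) := by
      rw [hP]
      intro p hp
      obtain ⟨B, hB, rfl⟩ := Finset.mem_image.1 hp
      exact Finset.mem_product.2 ⟨Finset.mem_image_of_mem _ hB, Finset.mem_image_of_mem _ hB⟩
    have c3 := Finset.card_le_card hPs
    rw [Finset.card_product] at c3
    have c3' : ((P m k).card : ℝ) ≤ _ := Nat.cast_le.2 c3
    push_cast at c3'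
    refine c3'.trans ?_
    calc _ ≤ Real.exp (C3 * m / 2 ^ k) * Real.exp (C3 * m / 2 ^ (k+1)) := by gcongr
      _ = Real.exp (C3 * m / 2 ^ k + C3 * m / 2 ^ (k+1)) := by rw [Real.exp_add]
      _ ≤ _ := by
          apply Real.exp_le_exp.2
          have : (C3 * m / 2 ^ (k+1) : ℝ) ≤ C3 * m / 2 ^ k := by
            gcongr
            · norm_num
            · omega
          calc _ ≤ (C3 * m / 2 ^ k : ℝ) + C3 * m / 2 ^ k := by linarith
            _ = _ := by ring
  refine hc4.trans ((Finset.sum_le_sum hQb).trans ?_)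
  rw [Finset.sum_const, nsmul_eq_mul, mul_left_comm]
  gcongr

end RF

namespace RF

theorem main_interval {α : ℝ} (h0 : 1 / 2 < α) (h : α < 1) :
    ∃ θ₀ > (0:ℝ), ∃ β₀ > (0:ℝ), ∃ jmin : ℝ, 1 ≤ jmin ∧ ∀ j ≥ jmin, ∀ θ : ℝ, 0 < θ → θ ≤ θ₀ →
      ∀ β ≥ β₀, ∀ a b : ℤ,
      (((Finset.Icc a b).powerset.filter (fun S => ¬ (
        ∑ A ∈ (Finset.Icc a b).powerset.filter (fun A => (0:ℤ) ∈ A),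
          Real.exp (-(β * EJ α j A)) * Real.exp (-(2 * β * θ * (symmDiff A S).card)) ≤
        Real.exp (-(β * j)) *
          Zf (Finset.Icc a b) (fun A => Real.exp (-(β * EJ α j A))) (2 * β * θ) S))).card : ℝ) ≤
      2 ^ (Finset.Icc a b).card * Real.exp (-(1 / θ ^ 2)) := by
  obtain ⟨M, hG⟩ : ∃ M, GapM α M := exists_M h0 h
  obtain ⟨Kc, C3, hKc, hE⟩ := entropy h0 h hG.1
  have hE' : Ent α M Kc C3 := hE
  obtain ⟨ε, hεd⟩ : ∃ ε : ℝ, ε = (2 * α - 1) / 2 := ⟨_, rfl⟩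
  have hε : 0 < ε := by rw [hεd]; linarith
  have hε1 : ε < 1 := by rw [hεd]; linarith
  obtain ⟨a0, ha0, hsum⟩ := sum_bound hε Kc
  obtain ⟨r, hr⟩ : ∃ r : ℝ, r = 2 ^ (-((2 * α - 1) / 4)) := ⟨_, rfl⟩
  have hr0 : 0 < r := by rw [hr]; positivity
  have hr1 : r < 1 := by
    rw [hr]; apply Real.rpow_lt_one_of_one_lt_of_neg (by norm_num); linarith
  obtain ⟨ct, hct⟩ : ∃ ct, ct = (1 - r) / 8 := ⟨_, rfl⟩
  have hct0 : 0 < ct := by rw [hct]; linarith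
  obtain ⟨c1, hc1⟩ : ∃ c1, c1 = ct ^ 2 / 128 := ⟨_, rfl⟩
  have hc10 : 0 < c1 := by rw [hc1]; positivity
  obtain ⟨L, hL⟩ : ∃ L : ℝ, L = 2 ^ (Kc + 1) := ⟨_, rfl⟩
  have hL1 : 1 ≤ L := by rw [hL]; exact one_le_pow₀ (by norm_num)
  obtain ⟨c2, hc2⟩ : ∃ c2, c2 = c1 / (2 * L) := ⟨_, rfl⟩
  have hc20 : 0 < c2 := by rw [hc2]; positivity
  have hC3 : (0:ℝ) ≤ C3 := by positivity
  obtain ⟨q, hq⟩ : ∃ q, q = min (c1 / (4 * C3 + 1)) (c2 / (2 * a0)) := ⟨_, rfl⟩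
  have hq0 : 0 < q := by rw [hq]; positivity
  refine ⟨Real.sqrt q, Real.sqrt_pos.2 hq0, 8 * (C3 + 1), by positivity,
    max 1 ((2 / c2) ^ (1 / ε)), le_max_left _ _, ?_⟩
  intro j hj θ hθ hθ0 β hβ a b
  have hj1 : 1 ≤ j := (le_max_left _ _).trans hj
  have hjε : 2 / c2 ≤ j ^ ε := by
    have h1 := (le_max_right 1 ((2 / c2) ^ (1 / ε))).trans hj
    calc 2 / c2 = ((2 / c2) ^ (1 / ε)) ^ ε := by
          rw [← Real.rpow_mul (by positivity), one_div, inv_mul_cancel₀ hε.ne', Real.rpow_one]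
      _ ≤ _ := by gcongr
  have hθ2 : θ ^ 2 ≤ q := by
    calc θ ^ 2 ≤ (Real.sqrt q) ^ 2 := by gcongr
      _ = q := Real.sq_sqrt hq0.le
  have hθsqpos : 0 < θ ^ 2 := by positivity
  have hA1 : 4 * (C3:ℝ) ≤ c1 / θ ^ 2 := by
    have := hθ2.trans (hq ▸ min_le_left _ _)
    rw [le_div_iff₀ (by positivity)] at this ⊢
    nlinarith
  have hA2 : a0 ≤ c2 / θ ^ 2 / 2 := by
    have := hθ2.trans (hq ▸ min_le_right _ _)
    rw [le_div_iff₀ (by positivity)] at this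
    rw [div_div, le_div_iff₀ (by positivity)]
    nlinarith
  have hβ0 : 0 < β := lt_of_lt_of_le (by positivity) hβ
  obtain ⟨Λ, hΛ⟩ : ∃ Λ, Λ = Finset.Icc a b := ⟨_, rfl⟩
  have hw : ∀ A, 0 < (fun A => Real.exp (-(β * EJ α j A))) A := fun A => Real.exp_pos _
  have hbad := bad_count h0 h hE' (κ := 2 * β * θ) (by positivity) Λ hw
    (fun m k => β * (ct * (m + j) * r ^ k)) (by
      intro m k hm
      have : (0:ℝ) ≤ m := by positivity
      have : 0 < m + j := by linarith
      positivity) ((Bs α M Λ).sup (qq α)) (fun B hB => Finset.le_sup (f := qq α) hB)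
  have hsub : (Λ.powerset.filter (fun S => ¬ (
        ∑ A ∈ Λ.powerset.filter (fun A => (0:ℤ) ∈ A),
          Real.exp (-(β * EJ α j A)) * Real.exp (-(2 * β * θ * (symmDiff A S).card)) ≤
        Real.exp (-(β * j)) *
          Zf Λ (fun A => Real.exp (-(β * EJ α j A))) (2 * β * θ) S))) ⊆
      (Λ.powerset.filter (fun S => ∃ B ∈ Bs α M Λ, ∃ k < Kc + Nat.clog 2 (qq α B),
      β * (ct * (qq α B + j) * r ^ k) ≤
        Real.log (Zf Λ (fun A => Real.exp (-(β * EJ α j A))) (2 * β * θ) (symmDiff S (crs Λ B k))) -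
        Real.log (Zf Λ (fun A => Real.exp (-(β * EJ α j A))) (2 * β * θ)
          (symmDiff S (crs Λ B (k+1)))))) := by
    intro S hS
    obtain ⟨hS1, hS2⟩ := Finset.mem_filter.1 hS
    refine Finset.mem_filter.2 ⟨hS1, ?_⟩
    by_contra hc
    apply hS2
    rw [hΛ]
    refine good_det h0 h hG hKc hE' (by linarith) hβ hr0 hr1 a b S ?_
    intro B hB k hk
    rw [← hΛ] at hB ⊢
    by_contra hlt
    rw [← hct] at hlt
    exact hc ⟨B, hB, k, hk, not_lt.1 hlt⟩
  rw [← hΛ]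
  have hcard : (_ : ℝ) ≤ _ := Nat.cast_le.2 (Finset.card_le_card hsub)
  refine hcard.trans (hbad.trans ?_)
  refine mul_le_mul_of_nonneg_left ?_ (by positivity)
  have hterm : ∀ m ∈ Finset.Icc 1 ((Bs α M Λ).sup (qq α)),
      ∑ k ∈ Finset.range (Kc + Nat.clog 2 m), Real.exp (2 * C3 * m / 2 ^ k) *
        Real.exp (-((β * (ct * (m + j) * r ^ k)) ^ 2 /
          (2 * (16 * m * ((4:ℝ) ^ k) ^ (1 - α)) * (2 * β * θ) ^ 2))) ≤
      Real.exp (-(1 / θ ^ 2)) * (((Kc + m : ℕ) : ℝ) * Real.exp (-(a0 * (m:ℝ) ^ ε))) := by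
    intro m hm
    have hm1 := (Finset.mem_Icc.1 hm).1
    have hm1' : (1:ℝ) ≤ m := by exact_mod_cast hm1
    have hk : ∀ k ∈ Finset.range (Kc + Nat.clog 2 m), Real.exp (2 * C3 * m / 2 ^ k) *
        Real.exp (-((β * (ct * (m + j) * r ^ k)) ^ 2 /
          (2 * (16 * m * ((4:ℝ) ^ k) ^ (1 - α)) * (2 * β * θ) ^ 2))) ≤
        Real.exp (-(1 / θ ^ 2)) * Real.exp (-(a0 * (m:ℝ) ^ ε)) := by
      intro k hk
      rw [← Real.exp_add, ← Real.exp_add]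
      apply Real.exp_le_exp.2
      rw [hr, t_identity hθ hβ0 (by linarith) k, ← hc1, ← hεd]
      have hP : (2:ℝ) ^ k ≤ L * m := by
        have h1 := two_pow_K_le Kc hm1
        have h2 : 2 ^ k ≤ 2 ^ (Kc + 1) * m :=
          (Nat.pow_le_pow_right (by norm_num) (Finset.mem_range.1 hk).le).trans h1
        rw [hL]; exact_mod_cast h2
      have ht := term_bound hε hε1 (c := c1 / θ ^ 2) (C := C3) (L := L) (j := j) (P := 2 ^ k) (m := m)
        (by positivity) hA1 hC3 hL1 (by linarith) hm1' (one_le_pow₀ (by norm_num)) hP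
      have e : c1 / θ ^ 2 / (2 * L) = c2 / θ ^ 2 := by rw [hc2]; field_simp
      rw [e] at ht
      have u1 : (m:ℝ) ^ ε ≤ (m + j) ^ ε := Real.rpow_le_rpow (by linarith) (by linarith) hε.le
      have u2 : j ^ ε ≤ (m + j) ^ ε := Real.rpow_le_rpow (by linarith) (by linarith) hε.le
      have u3 : 1 / θ ^ 2 ≤ c2 / θ ^ 2 / 2 * (m + j) ^ ε := by
        calc 1 / θ ^ 2 = c2 / θ ^ 2 / 2 * (2 / c2) := by field_simp
          _ ≤ _ := by gcongr; exact hjε.trans u2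
      have u4 : a0 * (m:ℝ) ^ ε ≤ c2 / θ ^ 2 / 2 * (m + j) ^ ε := by gcongr
      linarith
    refine (Finset.sum_le_sum hk).trans ?_
    rw [Finset.sum_const, Finset.card_range, nsmul_eq_mul, mul_left_comm]
    have := clog_le_self m
    gcongr
  refine (Finset.sum_le_sum hterm).trans ?_
  rw [← Finset.mul_sum]
  have := hsum a0 le_rfl ((Bs α M Λ).sup (qq α))
  have hp := Real.exp_pos (-(1 / θ ^ 2))
  nlinarith

end RF

namespace RF
open scoped FinsetFamily

lemma card_sub_aux {X Y Z W : Finset ℤ} (h1 : X ∪ Y ⊆ Z ∪ W) (h2 : X ∩ Y ⊆ Z ∩ W) :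
    X.card + Y.card ≤ Z.card + W.card := by
  rw [← Finset.card_union_add_card_inter, ← Finset.card_union_add_card_inter Z W]
  exact Nat.add_le_add (Finset.card_le_card h1) (Finset.card_le_card h2)

lemma walls_sub (A B : Finset ℤ) :
    (walls (A ∩ B)).card + (walls (A ∪ B)).card ≤ (walls A).card + (walls B).card := by
  apply card_sub_aux
  · intro i
    simp only [Finset.mem_union, mem_walls, Wall, Sep, Finset.mem_inter]
    by_cases h1 : i ∈ A <;> by_cases h2 : i ∈ B <;> by_cases h3 : i + 1 ∈ A <;>
      by_cases h4 : i + 1 ∈ B <;> simp [h1, h2, h3, h4]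
  · intro i
    simp only [Finset.mem_union, mem_walls, Wall, Sep, Finset.mem_inter]
    by_cases h1 : i ∈ A <;> by_cases h2 : i ∈ B <;> by_cases h3 : i + 1 ∈ A <;>
      by_cases h4 : i + 1 ∈ B <;> simp [h1, h2, h3, h4]

lemma sd_sub (A B S : Finset ℤ) :
    (symmDiff (A ∩ B) S).card + (symmDiff (A ∪ B) S).card ≤
      (symmDiff A S).card + (symmDiff B S).card := by
  apply card_sub_aux
  · intro i
    simp only [Finset.mem_union, Finset.mem_symmDiff, Finset.mem_inter]
    by_cases h1 : i ∈ A <;> by_cases h2 : i ∈ B <;> by_cases h3 : i ∈ S <;> simp [h1, h2, h3]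
  · intro i
    simp only [Finset.mem_union, Finset.mem_symmDiff, Finset.mem_inter]
    by_cases h1 : i ∈ A <;> by_cases h2 : i ∈ B <;> by_cases h3 : i ∈ S <;> simp [h1, h2, h3]

lemma En_sub (J : ℕ → ENNReal) (A B : Finset ℤ) :
    En J (A ∩ B) + En J (A ∪ B) ≤ En J A + En J B := by
  unfold En fE
  rw [← ENNReal.tsum_add, ← ENNReal.tsum_add]
  apply ENNReal.tsum_le_tsum; intro x
  rw [← ENNReal.tsum_add, ← ENNReal.tsum_add]
  apply ENNReal.tsum_le_tsum; intro y
  simp only [Sep, Finset.mem_union, Finset.mem_inter]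
  by_cases h1 : x ∈ A <;> by_cases h2 : x ∈ B <;> by_cases h3 : y ∈ A <;>
      by_cases h4 : y ∈ B <;> simp [h1, h2, h3, h4]

lemma EJ_sub {α j : ℝ} (h : α < 1) (hj : 0 ≤ j) (A B : Finset ℤ) :
    EJ α j (A ∩ B) + EJ α j (A ∪ B) ≤ EJ α j A + EJ α j B := by
  have h1 := ENNReal.toReal_mono (ENNReal.add_ne_top.2 ⟨En_ne_top h A, En_ne_top h B⟩)
    (En_sub (kern α) A B)
  rw [ENNReal.toReal_add (En_ne_top h _) (En_ne_top h _),
    ENNReal.toReal_add (En_ne_top h _) (En_ne_top h _)] at h1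
  have h2 : ((walls (A ∩ B)).card : ℝ) + (walls (A ∪ B)).card ≤ (walls A).card + (walls B).card := by
    exact_mod_cast walls_sub A B
  unfold EJ
  nlinarith

lemma fkg_ineq {W : Finset ℤ → ℝ} (hW : ∀ A, 0 ≤ W A)
    (hs : ∀ A B, W A * W B ≤ W (A ∩ B) * W (A ∪ B)) {Λ Λ' : Finset ℤ} (hΛ : Λ ⊆ Λ') :
    (∑ A ∈ Λ.powerset.filter (fun A => (0:ℤ) ∈ A), W A) * ∑ A ∈ Λ'.powerset, W A ≤
    (∑ A ∈ Λ.powerset, W A) * ∑ A ∈ Λ'.powerset.filter (fun A => (0:ℤ) ∈ A), W A := by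
  have h1 := four_functions_theorem W W W W hW hW hW hW hs
    (Λ.powerset.filter (fun A => (0:ℤ) ∈ A)) Λ'.powerset
  refine h1.trans ?_
  have s1 : (Λ.powerset.filter (fun A => (0:ℤ) ∈ A)) ⊼ Λ'.powerset ⊆ Λ.powerset := by
    intro C hC
    obtain ⟨A, hA, B, hB, rfl⟩ := Finset.mem_infs.1 hC
    have hA' := Finset.mem_powerset.1 (Finset.mem_filter.1 hA).1
    exact Finset.mem_powerset.2 (Finset.inter_subset_left.trans hA')
  have s2 : (Λ.powerset.filter (fun A => (0:ℤ) ∈ A)) ⊻ Λ'.powerset ⊆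
      Λ'.powerset.filter (fun A => (0:ℤ) ∈ A) := by
    intro C hC
    obtain ⟨A, hA, B, hB, rfl⟩ := Finset.mem_sups.1 hC
    have hA' := Finset.mem_powerset.1 (Finset.mem_filter.1 hA).1
    have hA0 := (Finset.mem_filter.1 hA).2
    exact Finset.mem_filter.2 ⟨Finset.mem_powerset.2 (Finset.union_subset (hA'.trans hΛ)
      (Finset.mem_powerset.1 hB)), Finset.mem_union_left _ hA0⟩
  have t1 := Finset.sum_le_sum_of_subset_of_nonneg s1 (f := W) (fun A _ _ => hW A)
  have t2 := Finset.sum_le_sum_of_subset_of_nonneg s2 (f := W) (fun A _ _ => hW A)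
  exact mul_le_mul t1 t2 (Finset.sum_nonneg (fun A _ => hW A)) (Finset.sum_nonneg (fun A _ => hW A))

lemma sd_union_card {A S T Λ : Finset ℤ} (hA : A ⊆ Λ) (hT : Disjoint Λ T) (hS : S ⊆ Λ) :
    (symmDiff A (S ∪ T)).card = (symmDiff A S).card + T.card := by
  rw [← Finset.card_union_of_disjoint]
  · congr 1
    ext x
    have h1 : x ∈ T → x ∉ Λ := fun h h' => Finset.disjoint_left.1 hT h' h
    have h2 := @hA x
    have h3 := @hS x
    simp only [Finset.mem_symmDiff, Finset.mem_union]
    by_cases p : x ∈ T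
    · have := h1 p
      have q1 : x ∉ A := fun hh => this (h2 hh)
      simp [p, q1]
    · simp [p]
  · rw [Finset.disjoint_left]
    intro x hx hxT
    have hx' : x ∉ Λ := fun h' => Finset.disjoint_left.1 hT h' hxT
    rw [Finset.mem_symmDiff] at hx
    rcases hx with h | h
    · exact hx' (hA h.1)
    · exact hx' (hS h.1)

theorem main_any {α : ℝ} (h0 : 1 / 2 < α) (h : α < 1) :
    ∃ θ₀ > (0:ℝ), ∃ β₀ > (0:ℝ), ∃ jmin : ℝ, 1 ≤ jmin ∧ ∀ j ≥ jmin, ∀ θ : ℝ, 0 < θ → θ ≤ θ₀ →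
      ∀ β ≥ β₀, ∀ Λ : Finset ℤ,
      ((Λ.powerset.filter (fun S => ¬ (
        ∑ A ∈ Λ.powerset.filter (fun A => (0:ℤ) ∈ A),
          Real.exp (-(β * EJ α j A)) * Real.exp (-(2 * β * θ * (symmDiff A S).card)) ≤
        Real.exp (-(β * j)) *
          Zf Λ (fun A => Real.exp (-(β * EJ α j A))) (2 * β * θ) S))).card : ℝ) ≤
      2 ^ Λ.card * Real.exp (-(1 / θ ^ 2)) := by
  obtain ⟨θ₀, hθ₀, β₀, hβ₀, jmin, hjm, hmain⟩ := main_interval h0 h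
  refine ⟨θ₀, hθ₀, β₀, hβ₀, jmin, hjm, ?_⟩
  intro j hj θ hθ hθ' β hβ Λ
  have hj0 : 0 ≤ j := by linarith
  have hβ0 : 0 < β := by linarith
  obtain ⟨Λ', hΛΛ', a, b, hab⟩ : ∃ Λ', Λ ⊆ Λ' ∧ ∃ a b : ℤ, Λ' = Finset.Icc a b := by
    refine ⟨Finset.Icc (-((Λ.sup Int.natAbs : ℕ) : ℤ)) (Λ.sup Int.natAbs : ℕ), ?_, _, _, rfl⟩
    intro x hx
    have := Finset.le_sup (f := Int.natAbs) hx
    rw [Finset.mem_Icc]; omega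
  have hm := hmain j hj θ hθ hθ' β hβ a b
  rw [← hab] at hm
  obtain ⟨κ, hκ⟩ : ∃ κ, κ = 2 * β * θ := ⟨_, rfl⟩
  have hκ0 : 0 < κ := by rw [hκ]; positivity
  rw [← hκ] at hm ⊢
  obtain ⟨w, hw⟩ : ∃ w : Finset ℤ → ℝ, w = fun A => Real.exp (-(β * EJ α j A)) := ⟨_, rfl⟩
  have hwA : ∀ A, Real.exp (-(β * EJ α j A)) = w A := fun A => by rw [hw]
  simp only [hwA] at hm ⊢
  obtain ⟨e, he⟩ : ∃ e, e = Real.exp (-(β * j)) := ⟨_, rfl⟩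
  rw [← he] at hm ⊢
  have hw0 : ∀ A, 0 < w A := fun A => by rw [hw]; exact Real.exp_pos _
  have hsm : ∀ S A B, (w A * Real.exp (-(κ * (symmDiff A S).card))) *
      (w B * Real.exp (-(κ * (symmDiff B S).card))) ≤
      (w (A ∩ B) * Real.exp (-(κ * (symmDiff (A ∩ B) S).card))) *
      (w (A ∪ B) * Real.exp (-(κ * (symmDiff (A ∪ B) S).card))) := by
    intro S A B
    rw [hw]
    simp only [← Real.exp_add]
    apply Real.exp_le_exp.2
    have h1 := EJ_sub h hj0 A B
    have h2 : ((symmDiff (A ∩ B) S).card : ℝ) + (symmDiff (A ∪ B) S).card ≤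
      (symmDiff A S).card + (symmDiff B S).card := by exact_mod_cast sd_sub A B S
    nlinarith
  obtain ⟨bad, hbad⟩ : ∃ bad : Finset ℤ → Finset (Finset ℤ), bad = fun Λ =>
    Λ.powerset.filter (fun S => ¬ (∑ A ∈ Λ.powerset.filter (fun A => (0:ℤ) ∈ A),
          w A * Real.exp (-(κ * (symmDiff A S).card)) ≤ e * Zf Λ w κ S)) := ⟨_, rfl⟩
  have hb1 : ∀ Λ, bad Λ = Λ.powerset.filter (fun S => ¬ (∑ A ∈ Λ.powerset.filter (fun A => (0:ℤ) ∈ A),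
          w A * Real.exp (-(κ * (symmDiff A S).card)) ≤ e * Zf Λ w κ S)) := fun Λ => by rw [hbad]
  rw [← hb1] at hm ⊢
  have hkey : ∀ S ∈ bad Λ, ∀ T ∈ (Λ' \ Λ).powerset, S ∪ T ∈ bad Λ' := by
    intro S hS T hT
    rw [hb1] at hS ⊢
    obtain ⟨hS1, hS2⟩ := Finset.mem_filter.1 hS
    rw [Finset.mem_powerset] at hS1 hT
    refine Finset.mem_filter.2 ⟨Finset.mem_powerset.2 (Finset.union_subset (hS1.trans hΛΛ')
      (hT.trans Finset.sdiff_subset)), ?_⟩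
    have hd : Disjoint Λ T := by
      rw [Finset.disjoint_left]; intro x hx hxT
      exact (Finset.mem_sdiff.1 (hT hxT)).2 hx
    intro hgood
    apply hS2
    have hf := fkg_ineq (W := fun A => w A * Real.exp (-(κ * (symmDiff A (S ∪ T)).card)))
      (fun A => mul_nonneg (hw0 A).le (Real.exp_pos _).le) (hsm (S ∪ T)) hΛΛ'
    have hp : ∀ A ∈ Λ.powerset, w A * Real.exp (-(κ * (symmDiff A (S ∪ T)).card)) =
        Real.exp (-(κ * T.card)) * (w A * Real.exp (-(κ * (symmDiff A S).card))) := by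
      intro A hA
      rw [sd_union_card (Finset.mem_powerset.1 hA) hd hS1, mul_left_comm, ← Real.exp_add]
      congr 2; push_cast; ring
    rw [Finset.sum_congr rfl hp, Finset.sum_congr rfl (fun A hA => hp A (Finset.mem_filter.1 hA).1),
      ← Finset.mul_sum, ← Finset.mul_sum] at hf
    have hZ' := Zf_pos Λ' hw0 κ (S ∪ T)
    have hZ := Zf_pos Λ hw0 κ S
    have hq := Real.exp_pos (-(κ * T.card))
    unfold Zf at hZ' hZ hgood ⊢
    obtain ⟨x, hx⟩ : ∃ x, x = ∑ A ∈ Λ.powerset.filter (fun A => (0:ℤ) ∈ A),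
      w A * Real.exp (-(κ * (symmDiff A S).card)) := ⟨_, rfl⟩
    obtain ⟨z, hz⟩ : ∃ z, z = ∑ A ∈ Λ.powerset, w A * Real.exp (-(κ * (symmDiff A S).card)) := ⟨_, rfl⟩
    obtain ⟨x', hx'⟩ : ∃ x', x' = ∑ A ∈ Λ'.powerset.filter (fun A => (0:ℤ) ∈ A),
      w A * Real.exp (-(κ * (symmDiff A (S ∪ T)).card)) := ⟨_, rfl⟩
    obtain ⟨z', hz'⟩ : ∃ z', z' = ∑ A ∈ Λ'.powerset,
      w A * Real.exp (-(κ * (symmDiff A (S ∪ T)).card)) := ⟨_, rfl⟩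
    rw [← hx, ← hz, ← hx', ← hz'] at hf
    rw [← hz'] at hZ' hgood
    rw [← hx'] at hgood
    rw [← hz] at hZ
    rw [← hx, ← hz]
    have hf2 : x * z' ≤ z * x' := by
      rw [mul_assoc, mul_assoc] at hf
      exact le_of_mul_le_mul_left hf hq
    have hf3 : x * z' ≤ (e * z) * z' := by
      calc _ ≤ z * x' := hf2
        _ ≤ z * (e * z') := by gcongr
        _ = _ := by ring
    exact le_of_mul_le_mul_right hf3 hZ'
  have hcard : (bad Λ).card * 2 ^ (Λ' \ Λ).card ≤ (bad Λ').card := by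
    rw [← Finset.card_powerset, ← Finset.card_product]
    apply Finset.card_le_card_of_injOn (fun p => p.1 ∪ p.2)
    · intro p hp
      obtain ⟨h1, h2⟩ := Finset.mem_product.1 hp
      exact hkey _ h1 _ h2
    · intro p hp p' hp' heq
      obtain ⟨h1, h2⟩ := Finset.mem_product.1 hp
      obtain ⟨h1', h2'⟩ := Finset.mem_product.1 hp'
      rw [hb1] at h1 h1'
      have a1 := Finset.mem_powerset.1 (Finset.mem_filter.1 h1).1
      have a1' := Finset.mem_powerset.1 (Finset.mem_filter.1 h1').1
      rw [Finset.mem_powerset] at h2 h2'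
      have hx : ∀ x, (x ∈ p.1 ∨ x ∈ p.2) ↔ (x ∈ p'.1 ∨ x ∈ p'.2) := by
        intro x
        have := Finset.ext_iff.1 heq x
        simpa only [Finset.mem_union] using this
      apply Prod.ext
      · ext x
        constructor
        · intro hh
          rcases (hx x).1 (Or.inl hh) with h3 | h3
          · exact h3
          · exact absurd (a1 hh) (Finset.mem_sdiff.1 (h2' h3)).2
        · intro hh
          rcases (hx x).2 (Or.inl hh) with h3 | h3
          · exact h3
          · exact absurd (a1' hh) (Finset.mem_sdiff.1 (h2 h3)).2
      · ext x
        constructor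
        · intro hh
          rcases (hx x).1 (Or.inr hh) with h3 | h3
          · exact absurd (a1' h3) (Finset.mem_sdiff.1 (h2 hh)).2
          · exact h3
        · intro hh
          rcases (hx x).2 (Or.inr hh) with h3 | h3
          · exact absurd (a1 h3) (Finset.mem_sdiff.1 (h2' hh)).2
          · exact h3
  have hcard' : ((bad Λ).card : ℝ) * 2 ^ (Λ' \ Λ).card ≤ (bad Λ').card := by exact_mod_cast hcard
  have hc2 : Λ'.card = Λ.card + (Λ' \ Λ).card := by
    rw [Finset.card_sdiff_of_subset hΛΛ']
    have := Finset.card_le_card hΛΛ'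
    omega
  rw [hc2, pow_add] at hm
  have hp : (0:ℝ) < 2 ^ (Λ' \ Λ).card := by positivity
  refine le_of_mul_le_mul_right (hcard'.trans (hm.trans (le_of_eq ?_))) hp
  ring

end RF

namespace RF

lemma summ_rpow {α : ℝ} (h : α < 1) (x : ℤ) :
    Summable (fun y : ℤ => (((x - y).natAbs : ℕ) : ℝ) ^ (α - 2)) := by
  have h1 : ∑' y : ℤ, kern α (x - y).natAbs ≠ ⊤ :=
    ne_top_of_le_ne_top (ENNReal.mul_ne_top (by simp) (kS_ne_top h)) (kern_total α x)
  refine (ENNReal.summable_toReal h1).congr ?_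
  intro y
  unfold kern
  rw [ENNReal.toReal_ofReal (by positivity)]

lemma Jcoup_eq (J₁ α : ℝ) (n : ℕ) :
    Jcoup J₁ α n = (n:ℝ) ^ (α - 2) + (if n = 1 then J₁ - 1 else 0) := by
  unfold Jcoup
  split_ifs with hn
  · subst hn; simp
  · simp

lemma nn_tsum (c : ℝ) (x : ℤ) (p : ℤ → Prop) :
    HasSum (fun y : ℤ => if p y then (if (x - y).natAbs = 1 then c else 0) else 0)
      ((if p (x + 1) then c else 0) + (if p (x - 1) then c else 0)) := by
  have h1 : HasSum (fun y : ℤ => if p y then (if (x - y).natAbs = 1 then c else 0) else 0)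
      (∑ y ∈ ({x + 1, x - 1} : Finset ℤ), if p y then (if (x - y).natAbs = 1 then c else 0) else 0) :=
    hasSum_sum_of_ne_finset_zero (by
      intro y hy
      rw [Finset.mem_insert, Finset.mem_singleton] at hy
      have : ¬ (x - y).natAbs = 1 := by omega
      simp [this])
  rw [Finset.sum_pair (by omega)] at h1
  have e1 : (x - (x + 1)).natAbs = 1 := by omega
  have e2 : (x - (x - 1)).natAbs = 1 := by omega
  rw [e1, e2] at h1
  simpa using h1

lemma summ_J {α : ℝ} (h : α < 1) (J₁ : ℝ) (x : ℤ) :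
    Summable (fun y : ℤ => Jcoup J₁ α (x - y).natAbs) := by
  have h1 := (summ_rpow h x).add (nn_tsum (J₁ - 1) x (fun _ => True)).summable
  refine h1.congr ?_
  intro y
  rw [Jcoup_eq]; simp

lemma summ_J_ite {α : ℝ} (h : α < 1) (J₁ : ℝ) (x : ℤ) (p : ℤ → Prop) :
    Summable (fun y : ℤ => if p y then Jcoup J₁ α (x - y).natAbs else 0) := by
  have := (summ_J h J₁ x).indicator {y | p y}
  refine this.congr ?_
  intro y
  rw [Set.indicator_apply]; rfl

lemma walls_card (A : Finset ℤ) : ((walls A).card : ℝ) =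
    ∑ x ∈ A, ((if x + 1 ∉ A then (1:ℝ) else 0) + (if x - 1 ∉ A then 1 else 0)) := by
  rw [Finset.sum_add_distrib, ← Finset.sum_filter, ← Finset.sum_filter]
  rw [Finset.sum_const, Finset.sum_const, nsmul_eq_mul, nsmul_eq_mul, mul_one, mul_one]
  rw [← Finset.card_image_of_injective (A.filter (fun x => x - 1 ∉ A))
    (f := fun x : ℤ => x - 1) (fun a b hab => by simpa using hab)]
  rw [← Nat.cast_add, ← Finset.card_union_of_disjoint]
  · congr 2
    ext i
    rw [mem_walls, Finset.mem_union, Finset.mem_filter, Finset.mem_image]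
    unfold Wall Sep
    constructor
    · intro hi
      by_cases h1 : i ∈ A
      · by_cases h2 : i + 1 ∈ A
        · exact absurd (by simp [h1, h2]) hi
        · exact Or.inl ⟨h1, h2⟩
      · by_cases h2 : i + 1 ∈ A
        · exact Or.inr ⟨i + 1, Finset.mem_filter.2 ⟨h2, by simpa using h1⟩, by ring⟩
        · exact absurd (by simp [h1, h2]) hi
    · rintro (⟨h1, h2⟩ | ⟨y, hy, rfl⟩)
      · simp [h1, h2]
      · obtain ⟨h1, h2⟩ := Finset.mem_filter.1 hy
        simp [h1, h2]
  · rw [Finset.disjoint_left]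
    intro i hi hi'
    obtain ⟨y, hy, rfl⟩ := Finset.mem_image.1 hi'
    exact (Finset.mem_filter.1 hy).2 (Finset.mem_filter.1 hi).1

lemma EJ_eq {α : ℝ} (h : α < 1) (J₁ : ℝ) (A : Finset ℤ) :
    EJ α (J₁ - 1) A =
      2 * ∑ x ∈ A, ∑' y : ℤ, (if y ∉ A then Jcoup J₁ α (x - y).natAbs else 0) := by
  unfold EJ
  rw [En_eq_two, ENNReal.toReal_mul, walls_card]
  have hne : ∀ x, fE (kern α) A x ≠ ⊤ := fun x =>
    ne_top_of_le_ne_top (ENNReal.mul_ne_top (by simp) (kS_ne_top h)) (fE_le α A x)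
  rw [ENNReal.toReal_sum (fun x _ => hne x)]
  rw [show (ENNReal.toReal 2) = 2 by simp, mul_assoc, ← mul_add, Finset.mul_sum,
    ← Finset.sum_add_distrib]
  congr 1
  apply Finset.sum_congr rfl
  intro x hx
  have e1 : (fE (kern α) A x).toReal =
      ∑' y : ℤ, (if y ∉ A then (((x - y).natAbs : ℕ) : ℝ) ^ (α - 2) else 0) := by
    unfold fE
    rw [ENNReal.tsum_toReal_eq]
    · apply tsum_congr
      intro y
      have : Sep A x y ↔ y ∉ A := by unfold Sep; simp [hx]
      by_cases hy : y ∈ A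
      · simp [this, hy]
      · rw [if_pos (this.2 hy), if_pos hy]
        unfold kern
        rw [ENNReal.toReal_ofReal (by positivity)]
    · intro y
      split_ifs
      · unfold kern; exact ENNReal.ofReal_ne_top
      · simp
  have hs1 : Summable (fun y : ℤ => if y ∉ A then (((x - y).natAbs : ℕ) : ℝ) ^ (α - 2) else 0) := by
    have := (summ_rpow h x).indicator {y | y ∉ A}
    refine this.congr ?_
    intro y
    rw [Set.indicator_apply]; rfl
  have hs2 : HasSum (fun y : ℤ => if y ∉ A then (if (x - y).natAbs = 1 then J₁ - 1 else 0) else 0)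
      ((if x + 1 ∉ A then J₁ - 1 else 0) + (if x - 1 ∉ A then J₁ - 1 else 0)) := by
    convert nn_tsum (J₁ - 1) x (fun y => y ∉ A)
  have e2 : (J₁ - 1) * ((if x + 1 ∉ A then (1:ℝ) else 0) + (if x - 1 ∉ A then 1 else 0)) =
      ∑' y : ℤ, (if y ∉ A then (if (x - y).natAbs = 1 then J₁ - 1 else 0) else 0) := by
    rw [hs2.tsum_eq, mul_add, mul_ite, mul_ite, mul_one, mul_zero]
  rw [e1, e2, ← hs1.tsum_add hs2.summable]
  apply tsum_congr
  intro y
  rw [Jcoup_eq]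
  split_ifs <;> simp

/-- minus set -/
def mset (Λ : Finset ℤ) (σ : Λ → Bool) : Finset ℤ := Λ.filter (fun i => ∃ hi : i ∈ Λ, σ ⟨i, hi⟩ = false)

lemma mem_mset {Λ : Finset ℤ} {σ : Λ → Bool} (i : Λ) : (i : ℤ) ∈ mset Λ σ ↔ σ i = false := by
  unfold mset
  rw [Finset.mem_filter]
  constructor
  · rintro ⟨_, _, h⟩; exact h
  · intro h; exact ⟨i.2, i.2, h⟩

lemma mset_subset (Λ : Finset ℤ) (σ : Λ → Bool) : mset Λ σ ⊆ Λ := Finset.filter_subset _ _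

lemma sum_mset (Λ : Finset ℤ) (F : Finset ℤ → ℝ) :
    ∑ σ : Λ → Bool, F (mset Λ σ) = ∑ A ∈ Λ.powerset, F A := by
  apply Finset.sum_nbij' (fun σ => mset Λ σ) (fun A i => decide ((i:ℤ) ∉ A))
  · intro σ _; exact Finset.mem_powerset.2 (mset_subset Λ σ)
  · intro A _; exact Finset.mem_univ _
  · intro σ _
    funext i
    have := mem_mset (σ := σ) i
    cases hσ : σ i <;> simp [this, hσ]
  · intro A hA
    rw [Finset.mem_powerset] at hA
    ext x
    by_cases hx : x ∈ Λ
    · have := mem_mset (σ := fun i : Λ => decide ((i:ℤ) ∉ A)) ⟨x, hx⟩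
      simpa using this
    · have h1 : x ∉ A := fun hh => hx (hA hh)
      have h2 : x ∉ mset Λ (fun i : Λ => decide ((i:ℤ) ∉ A)) := fun hh => hx (mset_subset _ _ hh)
      exact iff_of_false h2 h1
  · intro σ _; rfl

lemma spin_eq {Λ : Finset ℤ} (σ : Λ → Bool) (i : Λ) :
    spin (σ i) = 1 - 2 * (if (i:ℤ) ∈ mset Λ σ then 1 else 0) := by
  have := mem_mset (σ := σ) i
  unfold spin
  cases hσ : σ i
  · rw [if_pos (this.2 hσ)]; norm_num
  · have hn : (i:ℤ) ∉ mset Λ σ := fun hh => by simp [this.1 hh] at hσ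
    simp [hn]

/-- the field attached to a Boolean configuration -/
def fld (Λ : Finset ℤ) (η : Λ → Bool) : ℤ → ℝ :=
  fun i => if hi : i ∈ Λ then spin (η ⟨i, hi⟩) else 1

lemma ham_eq {α : ℝ} (h : α < 1) (J₁ θ : ℝ) (Λ : Finset ℤ) (η σ : Λ → Bool) :
    Ham J₁ α θ 1 Λ (fld Λ η) σ = EJ α (J₁ - 1) (mset Λ σ) +
      2 * θ * (symmDiff (mset Λ σ) (mset Λ η)).card - θ * Λ.card := by
  obtain ⟨A, hA⟩ : ∃ A, A = mset Λ σ := ⟨_, rfl⟩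
  obtain ⟨S, hS⟩ : ∃ S, S = mset Λ η := ⟨_, rfl⟩
  have hAΛ : A ⊆ Λ := hA ▸ mset_subset Λ σ
  have hSΛ : S ⊆ Λ := hS ▸ mset_subset Λ η
  unfold Ham
  -- field part
  have f1 : ∑ i : Λ, fld Λ η (i : ℤ) * spin (σ i) =
      Λ.card - 2 * (symmDiff A S).card := by
    have : ∀ i : Λ, fld Λ η (i : ℤ) * spin (σ i) =
        (fun x : ℤ => 1 - 2 * (if x ∈ symmDiff A S then (1:ℝ) else 0)) (i : ℤ) := by
      intro i
      have e : fld Λ η (i : ℤ) = spin (η i) := by unfold fld; rw [dif_pos i.2]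
      rw [e, spin_eq, spin_eq, ← hA, ← hS]
      simp only [Finset.mem_symmDiff]
      by_cases p : (i:ℤ) ∈ A <;> by_cases q : (i:ℤ) ∈ S <;> simp [p, q] <;> norm_num
    rw [Finset.sum_congr rfl (fun i _ => this i),
      Finset.sum_coe_sort Λ (fun x : ℤ => 1 - 2 * (if x ∈ symmDiff A S then (1:ℝ) else 0)),
      Finset.sum_sub_distrib, ← Finset.mul_sum, ← Finset.sum_filter]
    have e : Λ.filter (fun x => x ∈ symmDiff A S) = symmDiff A S := by
      ext x
      rw [Finset.mem_filter, and_iff_right_iff_imp, Finset.mem_symmDiff]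
      rintro (hh | hh)
      · exact hAΛ hh.1
      · exact hSΛ hh.1
    rw [e]; simp
  -- boundary part
  have b1 : ∑ i : Λ, (∑' j : ℤ, if j ∈ Λ then 0 else Jcoup J₁ α ((i : ℤ) - j).natAbs)
      * (1 - 1 * spin (σ i)) =
      2 * ∑ x ∈ A, (∑' j : ℤ, if j ∈ Λ then 0 else Jcoup J₁ α (x - j).natAbs) := by
    have : ∀ i : Λ, (∑' j : ℤ, if j ∈ Λ then 0 else Jcoup J₁ α ((i : ℤ) - j).natAbs)
      * (1 - 1 * spin (σ i)) = (fun x : ℤ => if x ∈ A then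
        2 * (∑' j : ℤ, if j ∈ Λ then 0 else Jcoup J₁ α (x - j).natAbs) else 0) (i : ℤ) := by
      intro i
      rw [spin_eq, ← hA]
      by_cases p : (i:ℤ) ∈ A
      · simp only [p, if_true]; ring
      · simp [p]
    rw [Finset.sum_congr rfl (fun i _ => this i),
      Finset.sum_coe_sort Λ (fun x : ℤ => if x ∈ A then
        2 * (∑' j : ℤ, if j ∈ Λ then 0 else Jcoup J₁ α (x - j).natAbs) else 0),
      ← Finset.sum_filter, Finset.mul_sum]
    apply Finset.sum_congr _ (fun _ _ => rfl)
    ext x; rw [Finset.mem_filter, and_iff_right_iff_imp]; exact fun hh => hAΛ hh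
  -- bulk part
  have p1 : (1 / 2) * ∑ i : Λ, ∑ j : Λ, (if i = j then 0 else
      Jcoup J₁ α ((i : ℤ) - (j : ℤ)).natAbs * (1 - spin (σ i) * spin (σ j))) =
      2 * ∑ x ∈ A, ∑ y ∈ Λ.filter (fun y => y ∉ A), Jcoup J₁ α (x - y).natAbs := by
    obtain ⟨G, hGd⟩ : ∃ G : ℤ → ℤ → ℝ, G = fun x y =>
      if x ∈ A then (if y ∉ A then Jcoup J₁ α (x - y).natAbs else 0) else 0 := ⟨_, rfl⟩
    have : ∀ i j : Λ, (if i = j then 0 else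
      Jcoup J₁ α ((i : ℤ) - (j : ℤ)).natAbs * (1 - spin (σ i) * spin (σ j))) =
        2 * G i j + 2 * G j i := by
      intro i j
      rw [spin_eq, spin_eq, ← hA, hGd]
      have hsym : ((j:ℤ) - i).natAbs = ((i:ℤ) - j).natAbs := by omega
      by_cases hij : i = j
      · subst hij
        by_cases p : (i:ℤ) ∈ A <;> simp [p]
      · simp only [hij, if_false, hsym]
        by_cases p : (i:ℤ) ∈ A <;> by_cases q : (j:ℤ) ∈ A <;>
          simp only [p, q, if_true, if_false, not_true, not_false_iff] <;> ring
    simp only [this]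
    simp only [Finset.sum_add_distrib, ← Finset.mul_sum]
    have hc : ∑ i : Λ, ∑ j : Λ, G (j:ℤ) (i:ℤ) = ∑ i : Λ, ∑ j : Λ, G (i:ℤ) (j:ℤ) := Finset.sum_comm
    rw [hc]
    have hG2 : ∑ i : Λ, ∑ j : Λ, G (i:ℤ) (j:ℤ) = ∑ x ∈ Λ, ∑ y ∈ Λ, G x y := by
      rw [← Finset.sum_coe_sort Λ (fun x => ∑ y ∈ Λ, G x y)]
      apply Finset.sum_congr rfl; intro i _
      exact Finset.sum_coe_sort Λ (fun y => G (i:ℤ) y)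
    rw [hG2]
    have hG3 : ∑ x ∈ Λ, ∑ y ∈ Λ, G x y =
        ∑ x ∈ A, ∑ y ∈ Λ.filter (fun y => y ∉ A), Jcoup J₁ α (x - y).natAbs := by
      rw [← Finset.sum_subset hAΛ]
      · apply Finset.sum_congr rfl
        intro x hx
        rw [Finset.sum_filter, hGd]
        simp [hx]
      · intro x _ hx
        rw [hGd]; simp [hx]
    rw [hG3]; ring
  rw [p1, b1, f1, ← hA, ← hS, EJ_eq h, ← mul_add, ← Finset.sum_add_distrib]
  have hsum : ∀ x ∈ A, (∑ y ∈ Λ.filter (fun y => y ∉ A), Jcoup J₁ α (x - y).natAbs +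
      ∑' j : ℤ, if j ∈ Λ then 0 else Jcoup J₁ α (x - j).natAbs) =
      ∑' y : ℤ, (if y ∉ A then Jcoup J₁ α (x - y).natAbs else 0) := by
    intro x _
    have s1 : HasSum (fun y : ℤ => if y ∈ Λ.filter (fun y => y ∉ A) then Jcoup J₁ α (x - y).natAbs else 0)
        (∑ y ∈ Λ.filter (fun y => y ∉ A), Jcoup J₁ α (x - y).natAbs) := by
      have : HasSum (fun y : ℤ => if y ∈ Λ.filter (fun y => y ∉ A) then Jcoup J₁ α (x - y).natAbs else 0)
        (∑ y ∈ Λ.filter (fun y => y ∉ A),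
          if y ∈ Λ.filter (fun y => y ∉ A) then Jcoup J₁ α (x - y).natAbs else 0) :=
        hasSum_sum_of_ne_finset_zero (fun y hy => if_neg hy)
      rwa [Finset.sum_congr rfl (fun y hy => if_pos hy)] at this
    have s2 : Summable (fun j : ℤ => if j ∈ Λ then 0 else Jcoup J₁ α (x - j).natAbs) := by
      refine (summ_J_ite h J₁ x (fun j => j ∉ Λ)).congr ?_
      intro j; by_cases hj : j ∈ Λ <;> simp [hj]
    rw [← s1.tsum_eq, ← s1.summable.tsum_add s2]
    apply tsum_congr
    intro y
    by_cases q : y ∈ Λ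
    · by_cases p : y ∈ A <;> simp [p, q]
    · have p : y ∉ A := fun hh => q (hAΛ hh)
      simp [p, q]
  rw [Finset.sum_congr rfl hsum]
  ring

end RF

namespace RF

lemma gibbs_le {α : ℝ} (h : α < 1) (J₁ θ β c : ℝ) (Λ : Finset ℤ) (h0 : (0:ℤ) ∈ Λ) (η : Λ → Bool)
    (hg : ∑ A ∈ Λ.powerset.filter (fun A => (0:ℤ) ∈ A),
        Real.exp (-(β * EJ α (J₁ - 1) A)) * Real.exp (-(2*β*θ*(symmDiff A (mset Λ η)).card))
        ≤ c * Zf Λ (fun A => Real.exp (-(β * EJ α (J₁ - 1) A))) (2*β*θ) (mset Λ η)) :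
    gibbs J₁ α θ 1 β Λ (fld Λ η) (fun σ => spin (σ ⟨0, h0⟩) = -1) ≤ c := by
  have key : ∀ σ : Λ → Bool, Real.exp (-β * Ham J₁ α θ 1 Λ (fld Λ η) σ) =
      Real.exp (β * θ * Λ.card) * (Real.exp (-(β * EJ α (J₁ - 1) (mset Λ σ))) *
        Real.exp (-(2*β*θ*(symmDiff (mset Λ σ) (mset Λ η)).card))) := by
    intro σ
    rw [ham_eq h, ← Real.exp_add, ← Real.exp_add]
    congr 1; ring
  have ev : ∀ σ : Λ → Bool, spin (σ ⟨0, h0⟩) = -1 ↔ (0:ℤ) ∈ mset Λ σ := by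
    intro σ
    rw [mem_mset (σ := σ) ⟨0, h0⟩]
    unfold spin
    cases σ ⟨0, h0⟩ <;> norm_num
  unfold gibbs
  have hden : ∑ σ : Λ → Bool, Real.exp (-β * Ham J₁ α θ 1 Λ (fld Λ η) σ) =
      Real.exp (β * θ * Λ.card) *
        Zf Λ (fun A => Real.exp (-(β * EJ α (J₁ - 1) A))) (2*β*θ) (mset Λ η) := by
    rw [Finset.sum_congr rfl (fun σ _ => key σ), ← Finset.mul_sum]
    rw [sum_mset Λ (fun A => Real.exp (-(β * EJ α (J₁ - 1) A)) *
        Real.exp (-(2*β*θ*(symmDiff A (mset Λ η)).card)))]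
    rfl
  have hnum : (∑ σ : Λ → Bool, if spin (σ ⟨0, h0⟩) = -1 then
      Real.exp (-β * Ham J₁ α θ 1 Λ (fld Λ η) σ) else 0) =
      Real.exp (β * θ * Λ.card) * ∑ A ∈ Λ.powerset.filter (fun A => (0:ℤ) ∈ A),
        Real.exp (-(β * EJ α (J₁ - 1) A)) * Real.exp (-(2*β*θ*(symmDiff A (mset Λ η)).card)) := by
    rw [Finset.sum_filter, ← sum_mset Λ (fun A => if (0:ℤ) ∈ A then
      Real.exp (-(β * EJ α (J₁ - 1) A)) * Real.exp (-(2*β*θ*(symmDiff A (mset Λ η)).card)) else 0),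
      Finset.mul_sum]
    apply Finset.sum_congr rfl
    intro σ _
    rw [key σ]
    by_cases hz : (0:ℤ) ∈ mset Λ σ
    · rw [if_pos ((ev σ).2 hz), if_pos hz]
    · rw [if_neg (fun hh => hz ((ev σ).1 hh)), if_neg hz, mul_zero]
  rw [hden]
  have hZ : 0 < Zf Λ (fun A => Real.exp (-(β * EJ α (J₁ - 1) A))) (2*β*θ) (mset Λ η) :=
    Zf_pos Λ (fun _ => Real.exp_pos _) _ _
  rw [div_le_iff₀ (mul_pos (Real.exp_pos _) hZ)]
  calc _ = _ := hnum
    _ ≤ Real.exp (β * θ * Λ.card) * (c * Zf Λ (fun A => Real.exp (-(β * EJ α (J₁ - 1) A))) (2*β*θ) (mset Λ η)) :=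
      mul_le_mul_of_nonneg_left hg (Real.exp_pos _).le
    _ = _ := by ring

lemma final {α : ℝ} (h12 : 1/2 < α) (h1 : α < 1) {ζ : ℝ} (hz : 0 < ζ) (hz1 : ζ < 1) :
    ∃ θ₀ > (0 : ℝ), ∃ β₀ > (0 : ℝ), ∃ J₁min : ℝ, ∀ J₁ : ℝ, J₁min ≤ J₁ →
      ∀ θ : ℝ, 0 < θ → θ ≤ θ₀ → ∀ β : ℝ, β₀ ≤ β →
      ∀ Λ : Finset ℤ, ∀ h0 : (0 : ℤ) ∈ Λ,
        fieldE Λ (fun h =>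
            if Real.exp (-(min (β * ζ / 4) (ζ ^ 2 / (2 ^ 10 * θ ^ 2))) / 200) ≤
                gibbs J₁ α θ 1 β Λ h (fun σ => spin (σ ⟨0, h0⟩) = -1)
            then 1 else 0)
          ≤ Real.exp (-(min (β * ζ / 4) (ζ ^ 2 / (2 ^ 10 * θ ^ 2))) / 200) := by
  obtain ⟨θ₀, hθ₀, β₀, hβ₀, jmin, hj1, hmain⟩ := main_any h12 h1
  refine ⟨θ₀, hθ₀, β₀, hβ₀, jmin + 1, ?_⟩
  intro J₁ hJ θ hθ hθ' β hβ Λ h0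
  have hm := hmain (J₁ - 1) (by linarith) θ hθ hθ' β hβ Λ
  have hβp : 0 < β := lt_of_lt_of_le hβ₀ hβ
  obtain ⟨b, hb⟩ : ∃ b, b = min (β * ζ / 4) (ζ ^ 2 / (2 ^ 10 * θ ^ 2)) := ⟨_, rfl⟩
  rw [← hb]
  have hb1 : b ≤ β * ζ / 4 := hb ▸ min_le_left _ _
  have hb2 : b ≤ ζ ^ 2 / (2 ^ 10 * θ ^ 2) := hb ▸ min_le_right _ _
  have hb0 : 0 < b := by rw [hb]; positivity
  have hb3 : b / 200 < β * (J₁ - 1) := by nlinarith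
  have hb4 : b / 200 ≤ 1 / θ ^ 2 := by
    have : ζ ^ 2 / (2 ^ 10 * θ ^ 2) ≤ 1 / θ ^ 2 := by
      apply div_le_div₀ (by norm_num) (by nlinarith) (by positivity)
      nlinarith [sq_nonneg θ]
    linarith
  have hlt : Real.exp (-(β * (J₁ - 1))) < Real.exp (-b / 200) := Real.exp_lt_exp.2 (by linarith)
  obtain ⟨P, hP⟩ : ∃ P : Finset ℤ → Prop, P = fun S =>
    (∑ A ∈ Λ.powerset.filter (fun A => (0:ℤ) ∈ A),
        Real.exp (-(β * EJ α (J₁ - 1) A)) * Real.exp (-(2*β*θ*(symmDiff A S).card))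
        ≤ Real.exp (-(β * (J₁ - 1))) * Zf Λ (fun A => Real.exp (-(β * EJ α (J₁ - 1) A))) (2*β*θ) S) := ⟨_, rfl⟩
  have hm' : ((Λ.powerset.filter (fun S => ¬ P S)).card : ℝ) ≤ 2 ^ Λ.card * Real.exp (-(1/θ^2)) := by
    rw [hP]; convert hm
  have hpt : ∀ η : Λ → Bool, (if Real.exp (-b / 200) ≤
      gibbs J₁ α θ 1 β Λ (fld Λ η) (fun σ => spin (σ ⟨0, h0⟩) = -1) then (1:ℝ) else 0) ≤
      (fun S => if ¬ P S then (1:ℝ) else 0) (mset Λ η) := by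
    intro η
    by_cases hp : P (mset Λ η)
    · have hp' := hp
      rw [hP] at hp'
      have := gibbs_le h1 J₁ θ β _ Λ h0 η hp'
      rw [if_neg (by linarith)]
      simp [hp]
    · simp only [hp, not_false_iff, if_true]
      split_ifs <;> norm_num
  have hsum := Finset.sum_le_sum (fun η (_ : η ∈ (Finset.univ : Finset (Λ → Bool))) => hpt η)
  have hR : ∑ S ∈ Λ.powerset, (if ¬ P S then (1:ℝ) else 0) =
      ((Λ.powerset.filter (fun S => ¬ P S)).card : ℝ) := by
    rw [← Finset.sum_filter, Finset.sum_const, nsmul_eq_mul, mul_one]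
  rw [sum_mset Λ (fun S => if ¬ P S then (1:ℝ) else 0), hR] at hsum
  have h2 : (0:ℝ) < 2 ^ Λ.card := by positivity
  have hfin : fieldE Λ (fun h =>
            if Real.exp (-b / 200) ≤
                gibbs J₁ α θ 1 β Λ h (fun σ => spin (σ ⟨0, h0⟩) = -1)
            then 1 else 0) = (1 / 2 ^ Λ.card) * ∑ η : Λ → Bool, (if Real.exp (-b / 200) ≤
      gibbs J₁ α θ 1 β Λ (fld Λ η) (fun σ => spin (σ ⟨0, h0⟩) = -1) then (1:ℝ) else 0) := rfl
  rw [hfin, one_div, inv_mul_le_iff₀ h2]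
  calc _ ≤ _ := hsum
    _ ≤ _ := hm'
    _ ≤ _ := mul_le_mul_of_nonneg_left (Real.exp_le_exp.2 (by linarith)) h2.le

lemma two_rpow_lt {α : ℝ} (h : α < Real.log 3 / Real.log 2 - 1) : (2:ℝ) ^ α < 3 / 2 := by
  have hl : 0 < Real.log 2 := Real.log_pos (by norm_num)
  have h1 : (α + 1) * Real.log 2 < Real.log 3 := by
    rw [← lt_div_iff₀ hl]; linarith
  have h2 : (2:ℝ) ^ (α + 1) < 3 := by
    rw [Real.rpow_def_of_pos (by norm_num), ← Real.lt_log_iff_exp_lt (by norm_num)]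
    linarith
  rw [Real.rpow_add (by norm_num), Real.rpow_one] at h2
  linarith

end RF

/-- **Quenched Peierls estimate.**  For `α ∈ (1/2, ln 3/ln 2 - 1)` and
`ζ = 1 - 2(2^α - 1) > 0`, there exist `θ₀(α) > 0`, `β₀(α) > 0` and a large enough value of
`J(1)` such that for all `0 < θ ≤ θ₀`, `β ≥ β₀` and every finite `Λ ∋ 0`, the probability
(over the random field) of the event `μ⁺_Λ(σ₀ = -1) ≥ e^{-b̄/200}` is at most `e^{-b̄/200}`,
where `b̄ = min(βζ/4, ζ²/(2¹⁰θ²))`. -/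
theorem quenched_minus_spin_at_origin
    (α : ℝ) (hα₁ : 1 / 2 < α) (hα₂ : α < Real.log 3 / Real.log 2 - 1)
    (ζ : ℝ) (hζdef : ζ = 1 - 2 * ((2 : ℝ) ^ α - 1)) :
    0 < ζ ∧
    ∃ θ₀ > (0 : ℝ), ∃ β₀ > (0 : ℝ), ∃ J₁min : ℝ, ∀ J₁ : ℝ, J₁min ≤ J₁ →
      ∀ θ : ℝ, 0 < θ → θ ≤ θ₀ → ∀ β : ℝ, β₀ ≤ β →
      ∀ Λ : Finset ℤ, ∀ h0 : (0 : ℤ) ∈ Λ,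
        fieldE Λ (fun h =>
            if Real.exp (-(min (β * ζ / 4) (ζ ^ 2 / (2 ^ 10 * θ ^ 2))) / 200) ≤
                gibbs J₁ α θ 1 β Λ h (fun σ => spin (σ ⟨0, h0⟩) = -1)
            then 1 else 0)
          ≤ Real.exp (-(min (β * ζ / 4) (ζ ^ 2 / (2 ^ 10 * θ ^ 2))) / 200) := by
  have h32 := RF.two_rpow_lt hα₂
  have hz : 0 < ζ := by rw [hζdef]; linarith
  have h2a : (1:ℝ) < (2:ℝ) ^ α := Real.one_lt_rpow (by norm_num) (by linarith)
  have hz1 : ζ < 1 := by rw [hζdef]; linarith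
  have h1 : α < 1 := by
    by_contra hc
    have h3 : (2:ℝ) ^ (1:ℝ) ≤ (2:ℝ) ^ α :=
      Real.rpow_le_rpow_of_exponent_le (by norm_num) (not_lt.1 hc)
    rw [Real.rpow_one] at h3
    linarith
  exact ⟨hz, RF.final hα₁ h1 hz hz1⟩
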